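/- Let p ∈ (1,∞) and let T be a Calderón–Zygmund operator with normalised standard kernel of Hölder exponent γ. Then for every s ∈ ℕ the operator Ψ_s := Σ_{k∈ℤ} (Id − E_k) T_{4·2^{−k}} D_{k+s} satisfies ‖Ψ_s f‖_{L^p} ≤ C (1+s) 2^{−sγ} ‖f‖_{L^p} for every f ∈ L^p(ℝⁿ) with finite Haar expansion, with C depending only on n, p, γ. -/

import Mathlib

open MeasureTheory

noncomputable section

open Classical in
/-- Classical indicator of a proposition. -/
def indR (P : Prop) : ℝ := if P then 1 else 0

/-- The real sign associated to a boolean. -/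
def sgnB (b : Bool) : ℝ := if b then 1 else -1

/-- The `ℓ∞` norm of an integer vector, as a real number. -/
def inorm {n : ℕ} (m : Fin n → ℤ) : ℝ := ‖(fun i => (m i : ℝ) : Fin n → ℝ)‖

/-- The dyadic cube `2^{-k}([0,1)^n + m)` of generation `k` in `ℝ^n` (with the `ℓ∞` metric). -/
def dyadicCube (n : ℕ) (k : ℤ) (m : Fin n → ℤ) : Set (Fin n → ℝ) :=
  {x | ∀ i, (2:ℝ) ^ (-k) * m i ≤ x i ∧ x i < (2:ℝ) ^ (-k) * (m i + 1)}

/-- The side length `2^{-k}` of a dyadic cube of generation `k`. -/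
def sideLen (k : ℤ) : ℝ := (2:ℝ) ^ (-k)

/-- One-dimensional Haar function on the dyadic interval `2^{-k}[m, m+1)`:
the non-cancellative `h⁰` for `η = false`, the cancellative `h¹` for `η = true`. -/
def haar1D (k : ℤ) (m : ℤ) (η : Bool) (t : ℝ) : ℝ :=
  (Real.sqrt ((2:ℝ) ^ (-k)))⁻¹ *
    (if η then
        (Set.Ico ((2:ℝ) ^ (-k) * m) ((2:ℝ) ^ (-k) * (m + 1/2))).indicator 1 t
          - (Set.Ico ((2:ℝ) ^ (-k) * (m + 1/2)) ((2:ℝ) ^ (-k) * (m + 1))).indicator 1 t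
      else (Set.Ico ((2:ℝ) ^ (-k) * m) ((2:ℝ) ^ (-k) * (m + 1))).indicator 1 t)

/-- The Haar function `h^η_I` for the dyadic cube `I` indexed by `(k, m)`. -/
def haarFn (n : ℕ) (k : ℤ) (m : Fin n → ℤ) (η : Fin n → Bool) (x : Fin n → ℝ) : ℝ :=
  ∏ i, haar1D k (m i) (η i) (x i)

/-- The non-cancellative Haar function `h⁰_I = |I|^{-1/2} 1_I`. -/
def haarZero (n : ℕ) (k : ℤ) (m : Fin n → ℤ) : (Fin n → ℝ) → ℝ :=
  haarFn n k m (fun _ => false)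

/-- The pairing `⟨g, f⟩ = ∫ g f dx`. -/
def pairing {n : ℕ} (g f : (Fin n → ℝ) → ℝ) : ℝ := ∫ x, g x * f x

/-- A normalised standard kernel with Hölder exponent `γ` (with respect to the `ℓ∞` metric). -/
structure IsNormalisedKernel (n : ℕ) (γ : ℝ) (K : (Fin n → ℝ) → (Fin n → ℝ) → ℝ) : Prop where
  size : ∀ x y, x ≠ y → |K x y| ≤ dist x y ^ (-(n:ℝ))
  smooth : ∀ x y h, 2 * ‖h‖ < dist x y →
    |K (x + h) y - K x y| + |K x (y + h) - K x y| ≤ ‖h‖ ^ γ * dist x y ^ (-(n:ℝ) - γ)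

/-- The singular integral `Tf(x) = ∫ K(x,y) f(y) dy`. -/
def czIntegral {n : ℕ} (K : (Fin n → ℝ) → (Fin n → ℝ) → ℝ) (f : (Fin n → ℝ) → ℝ)
    (x : Fin n → ℝ) : ℝ := ∫ y, K x y * f y

/-- The truncated singular integral `T_ε f(x) = ∫_{|y-x|>ε} K(x,y) f(y) dy`. -/
def czTrunc {n : ℕ} (K : (Fin n → ℝ) → (Fin n → ℝ) → ℝ) (ε : ℝ) (f : (Fin n → ℝ) → ℝ)
    (x : Fin n → ℝ) : ℝ := ∫ y in {y | ε < dist x y}, K x y * f y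

/-- The dyadic conditional expectation `E_k f`. -/
def dyadicE (n : ℕ) (k : ℤ) (f : (Fin n → ℝ) → ℝ) (x : Fin n → ℝ) : ℝ :=
  (2:ℝ) ^ (k * (n:ℤ)) * ∫ y in dyadicCube n k (fun i => ⌊(2:ℝ) ^ k * x i⌋), f y

/-- The dyadic martingale difference `D_k f = E_{k+1} f - E_k f`. -/
def dyadicD (n : ℕ) (k : ℤ) (f : (Fin n → ℝ) → ℝ) (x : Fin n → ℝ) : ℝ :=
  dyadicE n (k+1) f x - dyadicE n k f x

/-- The centre of the dyadic cube indexed by `(k, m)`. -/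
def cubeCenter (n : ℕ) (k : ℤ) (m : Fin n → ℤ) : Fin n → ℝ :=
  fun i => (2:ℝ) ^ (-k) * (m i + 1/2)

/-- The concentric `c`-fold expansion of the dyadic cube indexed by `(k, m)`. -/
def expandCube (n : ℕ) (k : ℤ) (m : Fin n → ℤ) (c : ℝ) : Set (Fin n → ℝ) :=
  {x | ∀ i, |x i - cubeCenter n k m i| ≤ c * (2:ℝ) ^ (-k) / 2}

/-- The set `Σ_{f,s} = ⋃_k 9Ω_k`, where `Ω_k` is the union of the cubes `I ∈ 𝒟_k` on which
`D_{k+s} f` is not a.e. zero. -/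
def SigmaSet (n : ℕ) (f : (Fin n → ℝ) → ℝ) (s : ℕ) : Set (Fin n → ℝ) :=
  ⋃ (k : ℤ) (m : Fin n → ℤ)
    (_ : ¬ (∀ᵐ x ∂(volume.restrict (dyadicCube n k m)), dyadicD n (k + (s:ℤ)) f x = 0)),
      expandCube n k m 9

/-- The (measure-theoretic) support of a measurable function: the complement of the union of
all balls on which the function vanishes a.e. -/
def suppAE {n : ℕ} (f : (Fin n → ℝ) → ℝ) : Set (Fin n → ℝ) :=
  {x | ∀ r > 0, ¬ (∀ᵐ y ∂(volume.restrict (Metric.ball x r)), f y = 0)}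

/-- The axis-parallel closed cube with centre `c` and side length `ρ`. -/
def cube (n : ℕ) (c : Fin n → ℝ) (ρ : ℝ) : Set (Fin n → ℝ) :=
  {x | ∀ i, |x i - c i| ≤ ρ / 2}

/-- The index of the `s`-th dyadic ancestor `I^{(s)}` of the cube indexed by `(k, m)`
(the ancestor is the cube indexed by `(k - s, ancestorIdx s m)`). -/
def ancestorIdx {n : ℕ} (s : ℕ) (m : Fin n → ℤ) : Fin n → ℤ :=
  fun i => Int.fdiv (m i) (2 ^ s)

/-- The distance between two sets (in the ambient metric). -/
def setDist {α : Type*} [PseudoMetricSpace α] (A B : Set α) : ℝ :=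
  sInf (Set.image2 dist A B)

/-- The operator `Ψ_s = Σ_k (Id - E_k) T_{4·2^{-k}} D_{k+s}`, as a pointwise sum over `k`. -/
def PsiOp (n : ℕ) (K : (Fin n → ℝ) → (Fin n → ℝ) → ℝ) (s : ℕ)
    (f : (Fin n → ℝ) → ℝ) (x : Fin n → ℝ) : ℝ :=
  ∑' k : ℤ,
    (czTrunc K (4 * (2:ℝ) ^ (-k)) (dyadicD n (k + (s:ℤ)) f) x -
      dyadicE n k (czTrunc K (4 * (2:ℝ) ^ (-k)) (dyadicD n (k + (s:ℤ)) f)) x)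

/-- The index of the dyadic cube of generation `k` containing `x`. -/
def cubeIdx {n : ℕ} (k : ℤ) (x : Fin n → ℝ) : Fin n → ℤ := fun i => ⌊(2:ℝ) ^ k * x i⌋

lemma mem_dyadicCube_iff {n : ℕ} (k : ℤ) (m : Fin n → ℤ) (x : Fin n → ℝ) :
    x ∈ dyadicCube n k m ↔ cubeIdx k x = m := by
  have h2 : (0:ℝ) < (2:ℝ) ^ k := by positivity
  have key : ∀ i, ((2:ℝ) ^ (-k) * m i ≤ x i ∧ x i < (2:ℝ) ^ (-k) * (m i + 1)) ↔
      ⌊(2:ℝ) ^ k * x i⌋ = m i := by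
    intro i
    rw [Int.floor_eq_iff, zpow_neg, inv_mul_le_iff₀ h2, lt_inv_mul_iff₀ h2]
  simp only [dyadicCube, Set.mem_ofPred_eq, key, cubeIdx, funext_iff]

lemma measurable_cubeIdx {n : ℕ} (k : ℤ) : Measurable (cubeIdx (n := n) k) := by
  unfold cubeIdx
  fun_prop

lemma dyadicCube_eq {n : ℕ} (k : ℤ) (m : Fin n → ℤ) :
    dyadicCube n k m = {x | cubeIdx k x = m} := by
  ext x; exact mem_dyadicCube_iff k m x

lemma measurableSet_dyadicCube {n : ℕ} (k : ℤ) (m : Fin n → ℤ) :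
    MeasurableSet (dyadicCube n k m) := by
  rw [dyadicCube_eq]
  exact measurable_cubeIdx k (measurableSet_singleton m)

lemma dyadicCube_eq_pi {n : ℕ} (k : ℤ) (m : Fin n → ℤ) :
    dyadicCube n k m =
      Set.univ.pi fun i => Set.Ico ((2:ℝ) ^ (-k) * m i) ((2:ℝ) ^ (-k) * (m i + 1)) := by
  ext x; simp [dyadicCube, Set.mem_pi]

lemma volume_dyadicCube {n : ℕ} (k : ℤ) (m : Fin n → ℤ) :
    volume (dyadicCube n k m) = ENNReal.ofReal ((2:ℝ) ^ (-(k * (n:ℤ)))) := by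
  rw [dyadicCube_eq_pi, Real.volume_pi_Ico]
  have : ∀ i, (2:ℝ) ^ (-k) * (m i + 1) - (2:ℝ) ^ (-k) * m i = (2:ℝ) ^ (-k) := fun i => by ring
  simp only [this, Finset.prod_const, Finset.card_univ, Fintype.card_fin]
  rw [← ENNReal.ofReal_pow (by positivity), ← zpow_natCast, ← zpow_mul]
  congr 2; ring

lemma dist_lt_of_cubeIdx_eq {n : ℕ} {k : ℤ} {x y : Fin n → ℝ} (h : cubeIdx k x = cubeIdx k y) :
    dist x y < (2:ℝ) ^ (-k) := by
  rw [dist_pi_lt_iff (by positivity)]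
  intro i
  have := congrFun h i
  simp only [cubeIdx] at this
  have h1 := Int.abs_sub_lt_one_of_floor_eq_floor this
  have h2 : (0:ℝ) < (2:ℝ) ^ k := by positivity
  rw [← mul_sub, abs_mul, abs_of_pos h2] at h1
  rwa [Real.dist_eq, zpow_neg, ← one_div, lt_div_iff₀' h2]

lemma cubeIdx_eq_of_le {n : ℕ} {k j : ℤ} (hkj : k ≤ j) {x y : Fin n → ℝ}
    (h : cubeIdx j x = cubeIdx j y) : cubeIdx k x = cubeIdx k y := by
  obtain ⟨d, rfl⟩ := Int.le.dest hkj
  funext i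
  have h1 := congrFun h i
  simp only [cubeIdx] at h1 ⊢
  have key : ∀ t : ℝ, (2:ℝ) ^ k * t = ((2:ℝ) ^ (k + d) * t) / ((2 ^ d : ℕ) : ℝ) := by
    intro t
    rw [zpow_add₀ (by norm_num), zpow_natCast]
    push_cast
    field_simp
  rw [key, key, Int.floor_div_natCast, Int.floor_div_natCast, h1]

/-- Functions (or predicates) constant on the dyadic cubes of generation `k`. -/
def CubeInv {n : ℕ} {α : Type*} (k : ℤ) (h : (Fin n → ℝ) → α) : Prop :=
  ∀ x y, cubeIdx k x = cubeIdx k y → h x = h y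

lemma CubeInv.mono {n : ℕ} {α : Type*} {k j : ℤ} (hkj : k ≤ j) {h : (Fin n → ℝ) → α}
    (hh : CubeInv k h) : CubeInv j h := fun x y hxy => hh x y (cubeIdx_eq_of_le hkj hxy)

open Classical in
lemma CubeInv.measurable {n : ℕ} {α : Type*} [MeasurableSpace α] {k : ℤ} {h : (Fin n → ℝ) → α}
    (hh : CubeInv k h) : Measurable h := by
  by_cases hne : Nonempty α
  · let φ : (Fin n → ℤ) → α := fun m =>
      if hm : ∃ x, cubeIdx k x = m then h hm.choose else Classical.choice hne
    have : h = φ ∘ cubeIdx k := by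
      funext x
      have hx : ∃ y, cubeIdx k y = cubeIdx k x := ⟨x, rfl⟩
      simp only [Function.comp, φ]
      rw [dif_pos hx]
      exact hh _ _ hx.choose_spec.symm
    rw [this]
    exact (measurable_of_countable φ).comp (measurable_cubeIdx k)
  · exact (hne ⟨h 0⟩).elim

lemma CubeInv.measurableSet {n : ℕ} {k : ℤ} {S : Set (Fin n → ℝ)}
    (hS : CubeInv k (· ∈ S)) : MeasurableSet S :=
  measurableSet_setOfPred.2 hS.measurable

lemma dyadicE_eq {n : ℕ} (k : ℤ) (f : (Fin n → ℝ) → ℝ) (x : Fin n → ℝ) :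
    dyadicE n k f x = (2:ℝ) ^ (k * (n:ℤ)) * ∫ y in dyadicCube n k (cubeIdx k x), f y := rfl

lemma cubeInv_dyadicE {n : ℕ} (k : ℤ) (f : (Fin n → ℝ) → ℝ) : CubeInv k (dyadicE n k f) := by
  intro x y hxy
  rw [dyadicE_eq, dyadicE_eq, hxy]

lemma measurable_dyadicE {n : ℕ} (k : ℤ) (f : (Fin n → ℝ) → ℝ) : Measurable (dyadicE n k f) :=
  (cubeInv_dyadicE k f).measurable

lemma dyadicE_mul_left {n : ℕ} {k : ℤ} {h : (Fin n → ℝ) → ℝ} (hh : CubeInv k h)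
    (f : (Fin n → ℝ) → ℝ) (x : Fin n → ℝ) :
    dyadicE n k (fun y => h y * f y) x = h x * dyadicE n k f x := by
  rw [dyadicE_eq, dyadicE_eq, setIntegral_congr_fun (g := fun y => h x * f y)
    (measurableSet_dyadicCube _ _), integral_const_mul]
  · ring
  · intro y hy
    rw [mem_dyadicCube_iff] at hy
    simp only [hh y x hy]

lemma dyadicE_const {n : ℕ} (k : ℤ) (c : ℝ) (x : Fin n → ℝ) :
    dyadicE n k (fun _ => c) x = c := by
  rw [dyadicE_eq, setIntegral_const, measureReal_def, volume_dyadicCube,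
    ENNReal.toReal_ofReal (by positivity), zpow_neg, smul_eq_mul]
  field_simp

lemma dyadicE_of_inv {n : ℕ} {k : ℤ} {h : (Fin n → ℝ) → ℝ} (hh : CubeInv k h) (x : Fin n → ℝ) :
    dyadicE n k h x = h x := by
  have := dyadicE_mul_left hh (fun _ => 1) x
  simpa [dyadicE_const] using this

lemma volume_dyadicCube_lt_top {n : ℕ} (k : ℤ) (m : Fin n → ℤ) :
    volume (dyadicCube n k m) < ⊤ := by
  rw [volume_dyadicCube]; exact ENNReal.ofReal_lt_top

/-- Functions integrable over every dyadic cube. -/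
def CubeLoc {n : ℕ} (f : (Fin n → ℝ) → ℝ) : Prop :=
  ∀ (k : ℤ) (m : Fin n → ℤ), IntegrableOn f (dyadicCube n k m)

lemma dyadicE_add {n : ℕ} {f g : (Fin n → ℝ) → ℝ} (hf : CubeLoc f) (hg : CubeLoc g) (k : ℤ) :
    dyadicE n k (f + g) = dyadicE n k f + dyadicE n k g := by
  funext x
  simp only [dyadicE_eq, Pi.add_apply]
  rw [integral_add (hf _ _) (hg _ _), mul_add]

lemma dyadicE_sub {n : ℕ} {f g : (Fin n → ℝ) → ℝ} (hf : CubeLoc f) (hg : CubeLoc g) (k : ℤ) :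
    dyadicE n k (f - g) = dyadicE n k f - dyadicE n k g := by
  funext x
  simp only [dyadicE_eq, Pi.sub_apply]
  rw [integral_sub (hf _ _) (hg _ _), mul_sub]

lemma abs_dyadicE_le {n : ℕ} (f : (Fin n → ℝ) → ℝ) (k : ℤ) (x : Fin n → ℝ) :
    |dyadicE n k f x| ≤ dyadicE n k (fun y => |f y|) x := by
  rw [dyadicE_eq, dyadicE_eq, abs_mul, abs_of_pos (by positivity : (0:ℝ) < 2 ^ (k * (n:ℤ)))]
  gcongr
  exact abs_integral_le_integral_abs

lemma dyadicE_mono {n : ℕ} {f g : (Fin n → ℝ) → ℝ} (hf : CubeLoc f) (hg : CubeLoc g) (k : ℤ)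
    (h : ∀ x, f x ≤ g x) (x : Fin n → ℝ) : dyadicE n k f x ≤ dyadicE n k g x := by
  rw [dyadicE_eq, dyadicE_eq]
  exact mul_le_mul_of_nonneg_left (setIntegral_mono (hf _ _) (hg _ _) h) (by positivity)

/-- The kernel of `E_k`. -/
def eKer (n : ℕ) (k : ℤ) (x y : Fin n → ℝ) : ℝ :=
  (2:ℝ) ^ (k * (n:ℤ)) * Set.indicator {y | cubeIdx k y = cubeIdx k x} 1 y

lemma dyadicE_eq_integral {n : ℕ} (k : ℤ) (f : (Fin n → ℝ) → ℝ) (x : Fin n → ℝ) :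
    dyadicE n k f x = ∫ y, eKer n k x y * f y := by
  rw [dyadicE_eq, ← integral_indicator (measurableSet_dyadicCube _ _), ← integral_const_mul]
  congr 1
  funext y
  rw [dyadicCube_eq]
  by_cases h : cubeIdx k y = cubeIdx k x <;> simp [eKer, Set.indicator, h]

lemma eKer_symm {n : ℕ} (k : ℤ) (x y : Fin n → ℝ) : eKer n k x y = eKer n k y x := by
  by_cases h : cubeIdx k y = cubeIdx k x
  · simp [eKer, Set.indicator, h]
  · simp [eKer, Set.indicator, h, Ne.symm h]

lemma eKer_nonneg {n : ℕ} (k : ℤ) (x y : Fin n → ℝ) : 0 ≤ eKer n k x y := by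
  unfold eKer
  exact mul_nonneg (by positivity) (Set.indicator_nonneg (by simp) _)

lemma measurable_eKer {n : ℕ} (k : ℤ) : Measurable (Function.uncurry (eKer n k)) := by
  have : Function.uncurry (eKer n k) = fun z : (Fin n → ℝ) × (Fin n → ℝ) => (2:ℝ) ^ (k * (n:ℤ)) *
      Set.indicator {z : (Fin n → ℝ) × (Fin n → ℝ) | cubeIdx k z.2 = cubeIdx k z.1} 1 z := by
    funext z; simp [eKer, Function.uncurry, Set.indicator]
  rw [this]
  refine measurable_const.mul ((measurable_const (a := (1:ℝ))).indicator ?_)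
  exact measurableSet_eq_fun ((measurable_cubeIdx k).comp measurable_snd)
    ((measurable_cubeIdx k).comp measurable_fst)

lemma lintegral_eKer {n : ℕ} (k : ℤ) (y : Fin n → ℝ) :
    ∫⁻ x, ENNReal.ofReal (eKer n k x y) = 1 := by
  have : ∀ x, ENNReal.ofReal (eKer n k x y) =
    (dyadicCube n k (cubeIdx k y)).indicator (fun _ => ENNReal.ofReal ((2:ℝ) ^ (k * (n:ℤ)))) x := by
    intro x
    rw [eKer_symm, dyadicCube_eq]
    by_cases h : cubeIdx k x = cubeIdx k y <;> simp [eKer, Set.indicator, h]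
  simp_rw [this]
  rw [lintegral_indicator_const (measurableSet_dyadicCube _ _), volume_dyadicCube,
    ← ENNReal.ofReal_mul (by positivity), ← zpow_add₀ (by norm_num)]
  simp

/-- Bounded measurable functions. -/
def BddMeas {n : ℕ} (f : (Fin n → ℝ) → ℝ) : Prop :=
  Measurable f ∧ ∃ M, ∀ x, |f x| ≤ M

/-- Bounded, measurable and integrable functions. -/
def Nice {n : ℕ} (f : (Fin n → ℝ) → ℝ) : Prop := BddMeas f ∧ Integrable f

section Closure
variable {n : ℕ} {f g : (Fin n → ℝ) → ℝ}

lemma BddMeas.add (hf : BddMeas f) (hg : BddMeas g) : BddMeas (f + g) := by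
  obtain ⟨hf, M, hM⟩ := hf
  obtain ⟨hg, M', hM'⟩ := hg
  exact ⟨hf.add hg, M + M', fun x => (abs_add_le _ _).trans (add_le_add (hM x) (hM' x))⟩

lemma BddMeas.neg (hf : BddMeas f) : BddMeas (-f) := by
  obtain ⟨hf, M, hM⟩ := hf
  exact ⟨hf.neg, M, fun x => by simpa using hM x⟩

lemma BddMeas.sub (hf : BddMeas f) (hg : BddMeas g) : BddMeas (f - g) := by
  rw [sub_eq_add_neg]; exact hf.add hg.neg

lemma BddMeas.integrable_mul (hf : BddMeas f) (hg : Integrable g) :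
    Integrable (fun x => f x * g x) := by
  obtain ⟨hf, M, hM⟩ := hf
  exact hg.bdd_mul hf.aestronglyMeasurable (Filter.Eventually.of_forall hM)

lemma BddMeas.indicator (hf : BddMeas f) {S : Set (Fin n → ℝ)} (hS : MeasurableSet S) :
    BddMeas (S.indicator f) := by
  obtain ⟨hf, M, hM⟩ := hf
  refine ⟨hf.indicator hS, M, fun x => ?_⟩
  by_cases hx : x ∈ S
  · simpa [hx] using hM x
  · simpa [hx] using (abs_nonneg _).trans (hM x)

lemma BddMeas.cubeLoc (hf : BddMeas f) : CubeLoc f := by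
  obtain ⟨hf, M, hM⟩ := hf
  intro k m
  exact Measure.integrableOn_of_bounded (volume_dyadicCube_lt_top k m).ne
    hf.aestronglyMeasurable (Filter.Eventually.of_forall hM)

lemma Nice.add (hf : Nice f) (hg : Nice g) : Nice (f + g) :=
  ⟨hf.1.add hg.1, hf.2.add hg.2⟩

lemma Nice.sub (hf : Nice f) (hg : Nice g) : Nice (f - g) :=
  ⟨hf.1.sub hg.1, hf.2.sub hg.2⟩

lemma Nice.zero : Nice (0 : (Fin n → ℝ) → ℝ) :=
  ⟨⟨measurable_zero, 0, by simp⟩, integrable_zero _ _ _⟩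

lemma Nice.sum {ι : Type*} (A : Finset ι) {u : ι → (Fin n → ℝ) → ℝ}
    (hu : ∀ i ∈ A, Nice (u i)) : Nice (∑ i ∈ A, u i) := by
  classical
  induction A using Finset.induction_on with
  | empty => simpa using Nice.zero
  | insert a A ha ih =>
    rw [Finset.sum_insert ha]
    exact (hu a (by simp)).add (ih fun i hi => hu i (by simp [hi]))

lemma Nice.indicator (hf : Nice f) {S : Set (Fin n → ℝ)} (hS : MeasurableSet S) :
    Nice (S.indicator f) := ⟨hf.1.indicator hS, hf.2.indicator hS⟩

lemma Nice.mul (hf : Nice f) (hg : Nice g) : Integrable (fun x => f x * g x) :=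
  hf.1.integrable_mul hg.2

lemma Nice.measurable (hf : Nice f) : Measurable f := hf.1.1

end Closure

section Expectation
variable {n : ℕ} {f g : (Fin n → ℝ) → ℝ}

lemma BddMeas.dyadicE (hf : BddMeas f) (k : ℤ) : BddMeas (dyadicE n k f) := by
  have hloc := hf.cubeLoc
  obtain ⟨hm, M, hM⟩ := hf
  refine ⟨measurable_dyadicE k f, M, fun x => (abs_dyadicE_le f k x).trans ?_⟩
  have hc : BddMeas (fun _ : Fin n → ℝ => M) := ⟨measurable_const, |M|, by simp⟩
  have := dyadicE_mono (f := fun y => |f y|) (fun k m => (hloc k m).abs) hc.cubeLoc k hM x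
  rwa [dyadicE_const] at this

lemma enorm_dyadicE_le (k : ℤ) (f : (Fin n → ℝ) → ℝ) (x : Fin n → ℝ) :
    ‖dyadicE n k f x‖ₑ ≤ ∫⁻ y, ENNReal.ofReal (eKer n k x y) * ‖f y‖ₑ := by
  rw [dyadicE_eq_integral]
  refine (enorm_integral_le_lintegral_enorm _).trans (lintegral_mono fun y => ?_)
  rw [enorm_mul, Real.enorm_of_nonneg (eKer_nonneg k x y)]

lemma measurable_ofReal_eKer (k : ℤ) : Measurable
    (fun z : (Fin n → ℝ) × (Fin n → ℝ) => ENNReal.ofReal (eKer n k z.1 z.2)) :=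
  (measurable_eKer k).ennreal_ofReal

lemma measurable_ofReal_eKer_left (k : ℤ) (y : Fin n → ℝ) :
    Measurable fun x => ENNReal.ofReal (eKer n k x y) :=
  Measurable.of_uncurry_right (f := fun x y => ENNReal.ofReal (eKer n k x y))
    (measurable_ofReal_eKer k)

lemma lintegral_eKer_mul (k : ℤ) (y : Fin n → ℝ) (c : ENNReal) :
    ∫⁻ x, ENNReal.ofReal (eKer n k x y) * c = c := by
  rw [lintegral_mul_const _ (measurable_ofReal_eKer_left k y), lintegral_eKer, one_mul]

lemma lintegral_enorm_dyadicE_le (hf : Measurable f) (k : ℤ) :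
    ∫⁻ x, ‖dyadicE n k f x‖ₑ ≤ ∫⁻ x, ‖f x‖ₑ := by
  refine (lintegral_mono fun x => enorm_dyadicE_le k f x).trans ?_
  rw [lintegral_lintegral_swap]
  · exact (lintegral_congr fun y => lintegral_eKer_mul k y _).le
  · exact ((measurable_ofReal_eKer k).mul (hf.enorm.comp measurable_snd)).aemeasurable

lemma dyadicE_indicator {S : Set (Fin n → ℝ)} {k : ℤ} (hS : CubeInv k (· ∈ S))
    (f : (Fin n → ℝ) → ℝ) :
    dyadicE n k (S.indicator f) = S.indicator (dyadicE n k f) := by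
  classical
  have h : CubeInv k (S.indicator (1 : (Fin n → ℝ) → ℝ)) := by
    intro x y hxy
    have h := hS x y hxy
    simp only [Set.indicator, Pi.one_apply]
    simp only [eq_iff_iff] at h
    simp [h]
  have h1 : ∀ g : (Fin n → ℝ) → ℝ, S.indicator g = fun y => S.indicator 1 y * g y := by
    intro g; funext y
    by_cases hy : y ∈ S <;> simp [hy]
  funext x
  rw [h1 f, dyadicE_mul_left h, h1 (dyadicE n k f)]

lemma setLIntegral_enorm_dyadicE_le (hf : Measurable f) {k : ℤ} {S : Set (Fin n → ℝ)}
    (hS : CubeInv k (· ∈ S)) :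
    ∫⁻ x in S, ‖dyadicE n k f x‖ₑ ≤ ∫⁻ x in S, ‖f x‖ₑ := by
  have hm := hS.measurableSet
  have key := lintegral_enorm_dyadicE_le (hf.indicator hm) k
  rw [dyadicE_indicator hS] at key
  simpa only [enorm_indicator_eq_indicator_enorm, lintegral_indicator hm] using key

lemma integrable_prod_eKer (hg : BddMeas g) (hfm : Measurable f) (hf : Integrable f) (k : ℤ) :
    Integrable (Function.uncurry fun x y => g x * (eKer n k x y * f y))
      ((volume : Measure (Fin n → ℝ)).prod volume) := by
  obtain ⟨hg, M, hM⟩ := hg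
  have hmeas : Measurable (Function.uncurry fun x y => g x * (eKer n k x y * f y)) :=
    (hg.comp measurable_fst).mul ((measurable_eKer k).mul (hfm.comp measurable_snd))
  refine ⟨hmeas.aestronglyMeasurable, ?_⟩
  rw [HasFiniteIntegral, lintegral_prod_symm _ hmeas.enorm.aemeasurable]
  calc _ ≤ ∫⁻ y, ENNReal.ofReal M * ‖f y‖ₑ := by
        refine lintegral_mono fun y => ?_
        calc _ ≤ ∫⁻ x, ENNReal.ofReal (eKer n k x y) * (ENNReal.ofReal M * ‖f y‖ₑ) := by
              refine lintegral_mono fun x => ?_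
              simp only [Function.uncurry]
              rw [enorm_mul, enorm_mul, Real.enorm_of_nonneg (eKer_nonneg k x y),
                mul_left_comm]
              gcongr
              rw [Real.enorm_eq_ofReal_abs]
              exact ENNReal.ofReal_le_ofReal (hM x)
          _ = _ := lintegral_eKer_mul k y _
    _ < ⊤ := by
        rw [lintegral_const_mul _ hfm.enorm]
        exact ENNReal.mul_lt_top ENNReal.ofReal_lt_top hf.2

lemma integral_mul_dyadicE (hg : BddMeas g) (hfm : Measurable f) (hf : Integrable f) (k : ℤ) :
    ∫ x, g x * dyadicE n k f x = ∫ x, dyadicE n k g x * f x := by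
  have := integral_integral_swap (integrable_prod_eKer hg hfm hf k)
  simp only [integral_const_mul] at this
  simp only [dyadicE_eq_integral]
  rw [this]
  congr 1
  funext y
  rw [← integral_mul_const]
  congr 1
  funext x
  rw [eKer_symm k y x]
  ring

lemma integrable_dyadicE (hfm : Measurable f) (hf : Integrable f) (k : ℤ) :
    Integrable (dyadicE n k f) :=
  ⟨(measurable_dyadicE k f).aestronglyMeasurable,
    (lintegral_enorm_dyadicE_le hfm k).trans_lt hf.2⟩

lemma Nice.dyadicE (hf : Nice f) (k : ℤ) : Nice (dyadicE n k f) :=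
  ⟨hf.1.dyadicE k, integrable_dyadicE hf.1.1 hf.2 k⟩

lemma Nice.dyadicD (hf : Nice f) (k : ℤ) : Nice (dyadicD n k f) :=
  (hf.dyadicE (k + 1)).sub (hf.dyadicE k)

lemma bddMeas_eKer (k : ℤ) (x : Fin n → ℝ) : BddMeas (eKer n k x) := by
  refine ⟨(measurable_eKer k).comp (measurable_const.prodMk measurable_id),
    (2:ℝ) ^ (k * (n:ℤ)), fun y => ?_⟩
  rw [abs_of_nonneg (eKer_nonneg k x y), eKer]
  refine mul_le_of_le_one_right (by positivity) ?_
  by_cases h : cubeIdx k y = cubeIdx k x <;> simp [Set.indicator, h]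

lemma dyadicE_dyadicE_of_ge {k j : ℤ} (hkj : k ≤ j) (f : (Fin n → ℝ) → ℝ) :
    dyadicE n j (dyadicE n k f) = dyadicE n k f :=
  funext fun x => dyadicE_of_inv ((cubeInv_dyadicE k f).mono hkj) x

lemma dyadicE_dyadicE_of_le {k j : ℤ} (hkj : k ≤ j) (hfm : Measurable f) (hf : Integrable f) :
    dyadicE n k (dyadicE n j f) = dyadicE n k f := by
  funext x
  rw [dyadicE_eq_integral, integral_mul_dyadicE (bddMeas_eKer k x) hfm hf, dyadicE_eq_integral]
  have : CubeInv j (eKer n k x) := by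
    refine CubeInv.mono hkj fun y z hyz => ?_
    rw [eKer_symm k x y, eKer_symm k x z]
    by_cases h : cubeIdx k x = cubeIdx k z <;> simp [eKer, Set.indicator, hyz, h]
  simp only [dyadicE_of_inv this]

end Expectation

section Radial
variable {n : ℕ}

lemma lintegral_norm_fun (hn : 0 < n) {φ : ℝ → ℝ} (h0 : ∀ r, 0 ≤ φ r)
    (hi : IntegrableOn (fun r : ℝ => r ^ (n - 1) * φ r) (Set.Ioi 0)) :
    ∫⁻ z : Fin n → ℝ, ENNReal.ofReal (φ ‖z‖) =
      ENNReal.ofReal (n * 2 ^ n * ∫ r in Set.Ioi (0:ℝ), r ^ (n - 1) * φ r) := by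
  have : Nonempty (Fin n) := ⟨⟨0, hn⟩⟩
  have hfr : Module.finrank ℝ (Fin n → ℝ) = n := by simp
  have hi' : Integrable (fun z : Fin n → ℝ => φ ‖z‖) := by
    rw [integrable_fun_norm_addHaar (volume : Measure (Fin n → ℝ)) (f := φ), hfr]
    exact hi
  rw [← ofReal_integral_eq_lintegral_ofReal hi' (Filter.Eventually.of_forall fun z => h0 _),
    integral_fun_norm_addHaar (volume : Measure (Fin n → ℝ)) φ, hfr]
  congr 1
  have hb : (volume : Measure (Fin n → ℝ)).real (Metric.ball 0 1) = 2 ^ n := by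
    rw [measureReal_def, Real.volume_pi_ball _ one_pos]
    simp
  rw [hb]
  simp only [smul_eq_mul, nsmul_eq_mul]
  ring

lemma lintegral_norm_tail (hn : 0 < n) {γ a : ℝ} (hγ : 0 < γ) (ha : 0 < a) :
    ∫⁻ z : Fin n → ℝ, ENNReal.ofReal
        ((Set.Ioi a).indicator (fun r : ℝ => r ^ (-(n:ℝ) - γ)) ‖z‖) =
      ENNReal.ofReal (n * 2 ^ n * (a ^ (-γ) / γ)) := by
  have hfun : ∀ r ∈ Set.Ioi (0:ℝ), r ^ (n - 1) *
      (Set.Ioi a).indicator (fun r : ℝ => r ^ (-(n:ℝ) - γ)) r =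
      (Set.Ioi a).indicator (fun r : ℝ => r ^ (-1 - γ)) r := by
    intro r hr
    have hr : 0 < r := hr
    by_cases h : a < r
    · simp only [Set.indicator, Set.mem_Ioi, h, if_true]
      rw [← Real.rpow_natCast, ← Real.rpow_add hr, Nat.cast_sub hn]
      congr 1; push_cast; ring
    · simp [Set.indicator, h]
  have hint : IntegrableOn (fun r : ℝ => r ^ (-1 - γ)) (Set.Ioi a) :=
    integrableOn_Ioi_rpow_of_lt (by linarith) ha
  rw [lintegral_norm_fun hn, setIntegral_congr_fun measurableSet_Ioi hfun,
    setIntegral_indicator measurableSet_Ioi, Set.inter_eq_right.2 (Set.Ioi_subset_Ioi ha.le),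
    integral_Ioi_rpow_of_lt (by linarith) ha]
  · congr 2
    rw [show -1 - γ + 1 = -γ by ring, neg_div_neg_eq]
  · intro r
    refine Set.indicator_nonneg (fun r hr => ?_) r
    exact Real.rpow_nonneg (ha.le.trans (le_of_lt hr)) _
  · rw [integrableOn_congr_fun hfun measurableSet_Ioi]
    exact (hint.integrable_indicator measurableSet_Ioi).integrableOn

lemma lintegral_norm_ring (hn : 0 < n) {a b : ℝ} (hb : 0 ≤ b) (hab : b ≤ a) :
    ∫⁻ z : Fin n → ℝ, ENNReal.ofReal
        ((Set.Icc (a - b) (a + b)).indicator (fun _ : ℝ => (1:ℝ)) ‖z‖) ≤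
      ENNReal.ofReal (n * 2 ^ n * ((a + b) ^ (n - 1) * (2 * b))) := by
  have hfun : (fun r : ℝ => r ^ (n - 1) * (Set.Icc (a - b) (a + b)).indicator (fun _ => (1:ℝ)) r) =
      (Set.Icc (a - b) (a + b)).indicator (fun r : ℝ => r ^ (n - 1)) := by
    funext r
    by_cases h : r ∈ Set.Icc (a - b) (a + b) <;> simp [h]
  have hint : IntegrableOn (fun r : ℝ => r ^ (n - 1)) (Set.Icc (a - b) (a + b)) :=
    (continuous_pow _).continuousOn.integrableOn_compact isCompact_Icc
  have hcst : IntegrableOn (fun r : ℝ => (a + b) ^ (n - 1)) (Set.Icc (a - b) (a + b)) :=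
    continuousOn_const.integrableOn_compact isCompact_Icc
  rw [lintegral_norm_fun hn, hfun]
  · refine ENNReal.ofReal_le_ofReal (mul_le_mul_of_nonneg_left ?_ (by positivity))
    rw [setIntegral_indicator measurableSet_Icc]
    calc _ ≤ ∫ r in Set.Ioi 0 ∩ Set.Icc (a - b) (a + b), (a + b) ^ (n - 1) := by
          refine setIntegral_mono_on (hint.mono_set Set.inter_subset_right)
            (hcst.mono_set Set.inter_subset_right) (measurableSet_Ioi.inter measurableSet_Icc) ?_
          rintro r ⟨hr, hr'⟩
          exact pow_le_pow_left₀ (le_of_lt hr) hr'.2 _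
      _ ≤ ∫ r in Set.Icc (a - b) (a + b), (a + b) ^ (n - 1) := by
          refine setIntegral_mono_set hcst (Filter.Eventually.of_forall fun r => ?_)
            Set.inter_subset_right.eventuallyLE
          exact pow_nonneg (by linarith) _
      _ = _ := by
          rw [setIntegral_const, measureReal_def, Real.volume_Icc,
            ENNReal.toReal_ofReal (by linarith), smul_eq_mul]
          ring
  · intro r
    exact Set.indicator_nonneg (fun _ _ => zero_le_one) r
  · rw [hfun]
    exact (hint.integrable_indicator measurableSet_Icc).integrableOn

end Radial

/-- Radial profile dominating the increments, at scale `2^{-j}`, of a standard kernel truncated at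
distance `4·2^{-k}`. -/
def rho (n : ℕ) (γ : ℝ) (k j : ℤ) (r : ℝ) : ℝ :=
  ((2:ℝ) ^ (-j)) ^ γ * (Set.Ioi (4 * (2:ℝ) ^ (-k))).indicator (fun r : ℝ => r ^ (-(n:ℝ) - γ)) r +
    (2:ℝ) ^ (k * (n:ℤ)) * (Set.Icc (4 * (2:ℝ) ^ (-k) - (2:ℝ) ^ (-j))
      (4 * (2:ℝ) ^ (-k) + (2:ℝ) ^ (-j))).indicator (fun _ => (1:ℝ)) r

/-- The constant in the bound for the mass of `rho`. -/
def rhoC (n : ℕ) (γ : ℝ) : ℝ := n * 2 ^ n * (1 / γ + 2 * 5 ^ n)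

lemma rhoC_pos {n : ℕ} (hn : 0 < n) {γ : ℝ} (hγ : 0 < γ) : 0 < rhoC n γ := by
  unfold rhoC
  have : (0:ℝ) < n := by exact_mod_cast hn
  positivity

section Rho
variable {n : ℕ} {γ : ℝ}

lemma ind_tail_nonneg {a : ℝ} (ha : 0 ≤ a) (s r : ℝ) :
    0 ≤ (Set.Ioi a).indicator (fun r : ℝ => r ^ s) r :=
  Set.indicator_nonneg (fun _ hr => Real.rpow_nonneg (ha.trans (le_of_lt hr)) _) r

lemma rho_nonneg (k j : ℤ) (r : ℝ) : 0 ≤ rho n γ k j r := by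
  unfold rho
  have h2 : 0 ≤ (Set.Icc (4 * (2:ℝ) ^ (-k) - (2:ℝ) ^ (-j))
      (4 * (2:ℝ) ^ (-k) + (2:ℝ) ^ (-j))).indicator (fun _ => (1:ℝ)) r :=
    Set.indicator_nonneg (fun _ _ => zero_le_one) r
  have h1 := ind_tail_nonneg (a := 4 * (2:ℝ) ^ (-k)) (by positivity) (-(n:ℝ) - γ) r
  positivity

lemma measurable_ind_tail (a s : ℝ) :
    Measurable ((Set.Ioi a).indicator (fun r : ℝ => r ^ s)) :=
  (measurable_id.pow_const s).indicator measurableSet_Ioi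

lemma measurable_rho (k j : ℤ) : Measurable (rho n γ k j) := by
  unfold rho
  exact ((measurable_ind_tail _ _).const_mul _).add
    ((measurable_const.indicator measurableSet_Icc).const_mul _)

lemma two_zpow_neg_add (k : ℤ) (d : ℕ) : (2:ℝ) ^ (-(k + d)) = (2:ℝ) ^ (-k) * (1/2) ^ d := by
  rw [neg_add, zpow_add₀ (by norm_num), zpow_neg 2 (d:ℤ), zpow_natCast, one_div, inv_pow]

lemma half_pow_rpow (γ : ℝ) (d : ℕ) : (((1:ℝ)/2) ^ d) ^ γ = ((1/2) ^ γ) ^ d := by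
  rw [← Real.rpow_natCast, ← Real.rpow_mul (by norm_num), mul_comm, Real.rpow_mul (by norm_num),
    Real.rpow_natCast]

lemma lintegral_rho_le (hn : 0 < n) (hγ0 : 0 < γ) (hγ1 : γ ≤ 1) (k : ℤ) (d : ℕ) :
    ∫⁻ z : Fin n → ℝ, ENNReal.ofReal (rho n γ k (k + d) ‖z‖) ≤
      ENNReal.ofReal (rhoC n γ * ((1/2 : ℝ) ^ γ) ^ d) := by
  set t : ℝ := (2:ℝ) ^ (-k) with ht
  have htpos : 0 < t := by positivity
  set q : ℝ := (1/2 : ℝ) ^ d with hq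
  have hqpos : 0 < q := by positivity
  have hq1 : q ≤ 1 := pow_le_one₀ (by norm_num) (by norm_num)
  have hj : (2:ℝ) ^ (-(k + (d:ℤ))) = t * q := two_zpow_neg_add k d
  have hkn : (2:ℝ) ^ (k * (n:ℤ)) = (t ^ n)⁻¹ := by
    rw [ht, ← zpow_natCast, ← zpow_mul, ← zpow_neg]; congr 1; ring
  have hqγ : q ≤ q ^ γ := by
    calc q = q ^ (1:ℝ) := (Real.rpow_one q).symm
      _ ≤ q ^ γ := Real.rpow_le_rpow_of_exponent_ge hqpos hq1 hγ1
  have hint : ∀ z : Fin n → ℝ, ENNReal.ofReal (rho n γ k (k + d) ‖z‖) =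
      ENNReal.ofReal ((t * q) ^ γ) * ENNReal.ofReal
        ((Set.Ioi (4 * t)).indicator (fun r : ℝ => r ^ (-(n:ℝ) - γ)) ‖z‖) +
      ENNReal.ofReal ((t ^ n)⁻¹) * ENNReal.ofReal
        ((Set.Icc (4 * t - t * q) (4 * t + t * q)).indicator (fun _ => (1:ℝ)) ‖z‖) := by
    intro z
    rw [rho, hj, hkn, ENNReal.ofReal_add, ENNReal.ofReal_mul (by positivity),
      ENNReal.ofReal_mul (by positivity)]
    · exact mul_nonneg (by positivity) (ind_tail_nonneg (by positivity) _ _)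
    · exact mul_nonneg (by positivity) (Set.indicator_nonneg (fun _ _ => zero_le_one) _)
  have hm1 : Measurable fun z : Fin n → ℝ => ENNReal.ofReal
        ((Set.Ioi (4 * t)).indicator (fun r : ℝ => r ^ (-(n:ℝ) - γ)) ‖z‖) :=
    ((measurable_ind_tail _ _).comp measurable_norm).ennreal_ofReal
  have hm2 : Measurable fun z : Fin n → ℝ => ENNReal.ofReal
        ((Set.Icc (4 * t - t * q) (4 * t + t * q)).indicator (fun _ => (1:ℝ)) ‖z‖) :=
    ((measurable_const.indicator measurableSet_Icc).comp measurable_norm).ennreal_ofReal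
  simp_rw [hint]
  rw [lintegral_add_left (hm1.const_mul _), lintegral_const_mul _ hm1, lintegral_const_mul _ hm2,
    lintegral_norm_tail hn hγ0 (by positivity)]
  calc _ ≤ ENNReal.ofReal ((t * q) ^ γ) * ENNReal.ofReal (n * 2 ^ n * ((4 * t) ^ (-γ) / γ)) +
        ENNReal.ofReal ((t ^ n)⁻¹) * ENNReal.ofReal
          (n * 2 ^ n * ((4 * t + t * q) ^ (n - 1) * (2 * (t * q)))) := by
        gcongr
        refine lintegral_norm_ring hn (by positivity) ?_
        nlinarith
    _ ≤ _ := by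
        rw [← ENNReal.ofReal_mul (by positivity), ← ENNReal.ofReal_mul (by positivity),
          ← ENNReal.ofReal_add (by positivity) (by positivity)]
        refine ENNReal.ofReal_le_ofReal ?_
        have e1 : (t * q) ^ γ * (n * 2 ^ n * ((4 * t) ^ (-γ) / γ)) ≤
            n * 2 ^ n * (1 / γ) * q ^ γ := by
          rw [Real.mul_rpow htpos.le hqpos.le, Real.mul_rpow (by norm_num) htpos.le,
            Real.rpow_neg htpos.le]
          have h4 : (4:ℝ) ^ (-γ) ≤ 1 :=
            Real.rpow_le_one_of_one_le_of_nonpos (by norm_num) (by linarith)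
          have htγ : 0 < t ^ γ := by positivity
          calc _ = (4:ℝ) ^ (-γ) * (n * 2 ^ n * (1 / γ) * q ^ γ) := by field_simp
            _ ≤ 1 * (n * 2 ^ n * (1 / γ) * q ^ γ) := by gcongr
            _ = _ := one_mul _
        have e2 : (t ^ n)⁻¹ * (n * 2 ^ n * ((4 * t + t * q) ^ (n - 1) * (2 * (t * q)))) ≤
            n * 2 ^ n * (2 * 5 ^ n) * q ^ γ := by
          have h5 : (4 * t + t * q) ^ (n - 1) ≤ (5 * t) ^ (n - 1) := by
            gcongr
            nlinarith
          calc _ ≤ (t ^ n)⁻¹ * (n * 2 ^ n * ((5 * t) ^ (n - 1) * (2 * (t * q)))) := by gcongr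
            _ = n * 2 ^ n * (2 * 5 ^ (n - 1)) * q := by
                obtain ⟨m, rfl⟩ : ∃ m, n = m + 1 := ⟨n - 1, by omega⟩
                simp only [Nat.add_sub_cancel, mul_pow, pow_succ t m]
                field_simp
            _ ≤ _ := by
                gcongr
                · norm_num
                · omega
        rw [← half_pow_rpow, ← hq]
        calc _ ≤ n * 2 ^ n * (1 / γ) * q ^ γ + n * 2 ^ n * (2 * 5 ^ n) * q ^ γ := add_le_add e1 e2
          _ = _ := by unfold rhoC; ring

/-- Far from the truncation sphere the profile has mass decaying with the distance. -/
lemma lintegral_rho_tail_le (hn : 0 < n) (hγ0 : 0 < γ) (i : ℤ) (d s : ℕ) :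
    ∫⁻ z in {z : Fin n → ℝ | 5 * (2:ℝ) ^ (-i) < ‖z‖},
        ENNReal.ofReal (rho n γ (i + d) (i + d + s) ‖z‖) ≤
      ENNReal.ofReal (rhoC n γ * (((1/2 : ℝ) ^ γ) ^ s * ((1/2 : ℝ) ^ γ) ^ d)) := by
  set t : ℝ := (2:ℝ) ^ (-i) with ht
  have htpos : 0 < t := by positivity
  set q : ℝ := (1/2 : ℝ) ^ d with hq
  have hqpos : 0 < q := by positivity
  have hq1 : q ≤ 1 := pow_le_one₀ (by norm_num) (by norm_num)
  set q' : ℝ := (1/2 : ℝ) ^ s with hq'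
  have hqpos' : 0 < q' := by positivity
  have hq1' : q' ≤ 1 := pow_le_one₀ (by norm_num) (by norm_num)
  have hk : (2:ℝ) ^ (-(i + (d:ℤ))) = t * q := two_zpow_neg_add i d
  have hj : (2:ℝ) ^ (-(i + (d:ℤ) + (s:ℤ))) = t * q * q' := by
    rw [two_zpow_neg_add (i + d) s, hk]
  have hms : MeasurableSet {z : Fin n → ℝ | 5 * t < ‖z‖} :=
    measurableSet_lt measurable_const measurable_norm
  have hm1 : Measurable fun z : Fin n → ℝ => ENNReal.ofReal
        ((Set.Ioi (5 * t)).indicator (fun r : ℝ => r ^ (-(n:ℝ) - γ)) ‖z‖) :=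
    ((measurable_ind_tail _ _).comp measurable_norm).ennreal_ofReal
  calc _ ≤ ∫⁻ z : Fin n → ℝ, ENNReal.ofReal ((t * q * q') ^ γ) * ENNReal.ofReal
        ((Set.Ioi (5 * t)).indicator (fun r : ℝ => r ^ (-(n:ℝ) - γ)) ‖z‖) := by
        rw [← lintegral_indicator hms]
        refine lintegral_mono fun z => ?_
        by_cases hz : 5 * t < ‖z‖
        · have h1 : 4 * (t * q) < ‖z‖ := by nlinarith
          have h2 : ¬ ‖z‖ ≤ 4 * (t * q) + t * q * q' := by
            have : t * q ≤ t := by nlinarith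
            have : t * q * q' ≤ t * q := by nlinarith [mul_pos htpos hqpos]
            linarith
          have hz' : z ∈ {z : Fin n → ℝ | 5 * t < ‖z‖} := hz
          rw [Set.indicator_of_mem hz', rho, hj, hk, ← ENNReal.ofReal_mul (by positivity)]
          refine le_of_eq (congrArg _ ?_)
          simp [Set.indicator, h1, h2, hz]
        · have hz' : z ∉ {z : Fin n → ℝ | 5 * t < ‖z‖} := hz
          rw [Set.indicator_of_notMem hz']
          exact zero_le
    _ = ENNReal.ofReal ((t * q * q') ^ γ * (n * 2 ^ n * ((5 * t) ^ (-γ) / γ))) := by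
        rw [lintegral_const_mul _ hm1, lintegral_norm_tail hn hγ0 (by positivity),
          ← ENNReal.ofReal_mul (by positivity)]
    _ ≤ _ := by
        refine ENNReal.ofReal_le_ofReal ?_
        rw [← half_pow_rpow, ← half_pow_rpow, ← hq, ← hq', Real.mul_rpow (by positivity) hqpos'.le,
          Real.mul_rpow htpos.le hqpos.le, Real.mul_rpow (by norm_num) htpos.le,
          Real.rpow_neg htpos.le]
        have h4 : (5:ℝ) ^ (-γ) ≤ 1 :=
          Real.rpow_le_one_of_one_le_of_nonpos (by norm_num) (by linarith)
        have htγ : 0 < t ^ γ := by positivity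
        calc _ = (5:ℝ) ^ (-γ) * (n * 2 ^ n * (1 / γ) * (q' ^ γ * q ^ γ)) := by field_simp
          _ ≤ 1 * (n * 2 ^ n * (1 / γ + 2 * 5 ^ n) * (q' ^ γ * q ^ γ)) := by
              gcongr
              linarith [show (0:ℝ) ≤ 2 * 5 ^ n by positivity]
          _ = _ := by rw [rhoC, one_mul]

end Rho

/-- The kernel `K` truncated at distance `4·2^{-k}`. -/
def tker {n : ℕ} (K : (Fin n → ℝ) → (Fin n → ℝ) → ℝ) (k : ℤ) (x y : Fin n → ℝ) : ℝ :=
  {y | 4 * (2:ℝ) ^ (-k) < dist x y}.indicator (K x) y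

/-- The singular integral truncated at distance `4·2^{-k}`. -/
def tOp {n : ℕ} (K : (Fin n → ℝ) → (Fin n → ℝ) → ℝ) (k : ℤ) (f : (Fin n → ℝ) → ℝ) :
    (Fin n → ℝ) → ℝ := czTrunc K (4 * (2:ℝ) ^ (-k)) f

/-- The transposed kernel. -/
def kerT {n : ℕ} (K : (Fin n → ℝ) → (Fin n → ℝ) → ℝ) : (Fin n → ℝ) → (Fin n → ℝ) → ℝ :=
  fun x y => K y x

section Kernel
variable {n : ℕ} {γ : ℝ} {K : (Fin n → ℝ) → (Fin n → ℝ) → ℝ}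

lemma IsNormalisedKernel.transpose (hK : IsNormalisedKernel n γ K) :
    IsNormalisedKernel n γ (kerT K) where
  size x y hxy := by
    rw [dist_comm]; exact hK.size y x hxy.symm
  smooth x y h hh := by
    rw [dist_comm] at hh ⊢
    have := hK.smooth y x h hh
    simp only [kerT]
    linarith

lemma tker_transpose (k : ℤ) (x y : Fin n → ℝ) : tker (kerT K) k x y = tker K k y x := by
  simp only [tker, Set.indicator, Set.mem_ofPred_eq, kerT, dist_comm]

lemma tOp_eq (k : ℤ) (f : (Fin n → ℝ) → ℝ) (x : Fin n → ℝ) :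
    tOp K k f x = ∫ y, tker K k x y * f y := by
  have hm : MeasurableSet {y | 4 * (2:ℝ) ^ (-k) < dist x y} :=
    measurableSet_lt measurable_const (measurable_const.dist measurable_id)
  rw [tOp, czTrunc, ← integral_indicator hm]
  congr 1
  funext y
  by_cases h : 4 * (2:ℝ) ^ (-k) < dist x y <;> simp [tker, Set.indicator]

lemma IsNormalisedKernel.abs_sub_left (hK : IsNormalisedKernel n γ K) {x x' y : Fin n → ℝ}
    (h : 2 * dist x x' < dist x y) :
    |K x' y - K x y| ≤ dist x x' ^ γ * dist x y ^ (-(n:ℝ) - γ) := by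
  have h1 : ‖x' - x‖ = dist x x' := by rw [dist_comm, dist_eq_norm]
  have := hK.smooth x y (x' - x) (by rwa [h1])
  rw [h1] at this
  rw [add_sub_cancel] at this
  exact (le_add_of_nonneg_right (abs_nonneg _)).trans this

lemma IsNormalisedKernel.abs_sub_right (hK : IsNormalisedKernel n γ K) {x y y' : Fin n → ℝ}
    (h : 2 * dist y y' < dist x y) :
    |K x y' - K x y| ≤ dist y y' ^ γ * dist x y ^ (-(n:ℝ) - γ) := by
  rw [dist_comm x y] at h ⊢
  exact hK.transpose.abs_sub_left h

lemma IsNormalisedKernel.abs_tker_le (hK : IsNormalisedKernel n γ K) (k : ℤ) (x y : Fin n → ℝ) :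
    |tker K k x y| ≤ (2:ℝ) ^ (k * (n:ℤ)) := by
  by_cases h : 4 * (2:ℝ) ^ (-k) < dist x y
  · have ht : (0:ℝ) < (2:ℝ) ^ (-k) := by positivity
    have hxy : x ≠ y := by
      rintro rfl
      rw [dist_self] at h
      linarith
    have h1 : (2:ℝ) ^ (-k) ≤ dist x y := by linarith
    simp only [tker, Set.indicator, Set.mem_ofPred_eq, h, if_true]
    calc _ ≤ dist x y ^ (-(n:ℝ)) := hK.size x y hxy
      _ ≤ ((2:ℝ) ^ (-k)) ^ (-(n:ℝ)) :=
          Real.rpow_le_rpow_of_nonpos ht h1 (by simp)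
      _ = _ := by
          rw [Real.rpow_neg ht.le, Real.rpow_natCast, ← zpow_natCast, ← zpow_mul, ← zpow_neg]
          congr 1; ring
  · simp only [tker, Set.indicator, Set.mem_ofPred_eq, h, if_false, abs_zero]
    positivity

lemma IsNormalisedKernel.abs_tker_sub_le (hγ0 : 0 ≤ γ) (hK : IsNormalisedKernel n γ K) {k j : ℤ}
    (hkj : k ≤ j) {x x' : Fin n → ℝ} (hx : dist x x' ≤ (2:ℝ) ^ (-j)) (y : Fin n → ℝ) :
    |tker K k x y - tker K k x' y| ≤ rho n γ k j ‖x - y‖ := by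
  have ht : (0:ℝ) < (2:ℝ) ^ (-k) := by positivity
  have hjk : (2:ℝ) ^ (-j) ≤ (2:ℝ) ^ (-k) := zpow_le_zpow_right₀ (by norm_num) (by omega)
  have hr1 : dist x y ≤ dist x x' + dist x' y := dist_triangle _ _ _
  have hr2 : dist x' y ≤ dist x x' + dist x y := dist_triangle_left _ _ _
  by_cases h : 4 * (2:ℝ) ^ (-k) < dist x y ↔ 4 * (2:ℝ) ^ (-k) < dist x' y
  · by_cases h1 : 4 * (2:ℝ) ^ (-k) < dist x y
    · have h2 := h.1 h1
      simp only [tker, Set.indicator, Set.mem_ofPred_eq, h1, h2, if_true]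
      rw [abs_sub_comm]
      refine (hK.abs_sub_left (by linarith)).trans ?_
      rw [rho, ← dist_eq_norm]
      refine le_add_of_le_of_nonneg ?_ (mul_nonneg (by positivity)
        (Set.indicator_nonneg (fun _ _ => zero_le_one) _))
      simp only [Set.indicator, Set.mem_Ioi, h1, if_true]
      gcongr
    · have h2 := mt h.2 h1
      simp only [tker, Set.indicator, Set.mem_ofPred_eq, h1, h2, if_false, sub_zero, abs_zero]
      exact rho_nonneg _ _ _
  · have hle : |tker K k x y - tker K k x' y| ≤ (2:ℝ) ^ (k * (n:ℤ)) := by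
      by_cases h1 : 4 * (2:ℝ) ^ (-k) < dist x y
      · have h2 : ¬ 4 * (2:ℝ) ^ (-k) < dist x' y := fun h2 => h ⟨fun _ => h2, fun _ => h1⟩
        have : tker K k x' y = 0 := by
          simp only [tker, Set.indicator, Set.mem_ofPred_eq, h2, if_false]
        rw [this, sub_zero]
        exact hK.abs_tker_le k x y
      · have : tker K k x y = 0 := by
          simp only [tker, Set.indicator, Set.mem_ofPred_eq, h1, if_false]
        rw [this, zero_sub, abs_neg]
        exact hK.abs_tker_le k x' y
    have hmem : dist x y ∈ Set.Icc (4 * (2:ℝ) ^ (-k) - (2:ℝ) ^ (-j))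
        (4 * (2:ℝ) ^ (-k) + (2:ℝ) ^ (-j)) := by
      constructor
      · by_contra hc
        exact h ⟨fun _ => by linarith, fun _ => by linarith⟩
      · by_contra hc
        exact h ⟨fun _ => by linarith, fun _ => by linarith⟩
    rw [rho, ← dist_eq_norm]
    refine le_add_of_nonneg_of_le (mul_nonneg (by positivity)
      (ind_tail_nonneg (by positivity) _ _)) ?_
    rw [Set.indicator_of_mem hmem, mul_one]
    exact hle

lemma IsNormalisedKernel.continuousOn (hγ0 : 0 < γ) (hK : IsNormalisedKernel n γ K) :
    ContinuousOn (Function.uncurry K) {z | z.1 ≠ z.2} := by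
  rintro ⟨x, y⟩ hxy
  refine ContinuousAt.continuousWithinAt ?_
  have hd : 0 < dist x y := dist_pos.2 hxy
  rw [ContinuousAt, tendsto_iff_dist_tendsto_zero]
  have hnhds : Filter.Tendsto (fun z : (Fin n → ℝ) × (Fin n → ℝ) =>
      dist x z.1 ^ γ * dist x z.2 ^ (-(n:ℝ) - γ) + dist y z.2 ^ γ * dist x y ^ (-(n:ℝ) - γ))
      (nhds (x, y)) (nhds (dist x x ^ γ * dist x y ^ (-(n:ℝ) - γ) +
        dist y y ^ γ * dist x y ^ (-(n:ℝ) - γ))) := by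
    have h1 : Filter.Tendsto (fun z : (Fin n → ℝ) × (Fin n → ℝ) => dist x z.1) (nhds (x, y))
        (nhds (dist x x)) := (continuous_const.dist continuous_fst).tendsto (x, y)
    have h2 : Filter.Tendsto (fun z : (Fin n → ℝ) × (Fin n → ℝ) => dist x z.2) (nhds (x, y))
        (nhds (dist x y)) := (continuous_const.dist continuous_snd).tendsto (x, y)
    have h3 : Filter.Tendsto (fun z : (Fin n → ℝ) × (Fin n → ℝ) => dist y z.2) (nhds (x, y))
        (nhds (dist y y)) := (continuous_const.dist continuous_snd).tendsto (x, y)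
    exact ((h1.rpow_const (Or.inr hγ0.le)).mul (h2.rpow_const (Or.inl hd.ne'))).add
      ((h3.rpow_const (Or.inr hγ0.le)).mul_const _)
  simp only [dist_self, Real.zero_rpow hγ0.ne', zero_mul, add_zero] at hnhds
  refine squeeze_zero' (Filter.Eventually.of_forall fun _ => dist_nonneg) ?_ hnhds
  have e1 : ∀ᶠ z : (Fin n → ℝ) × (Fin n → ℝ) in nhds (x, y), 2 * dist x z.1 < dist x z.2 := by
    refine (isOpen_lt (f := fun z : (Fin n → ℝ) × (Fin n → ℝ) => 2 * dist x z.1)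
      (g := fun z => dist x z.2) (by fun_prop) (by fun_prop)).mem_nhds ?_
    simpa using hxy
  have e2 : ∀ᶠ z : (Fin n → ℝ) × (Fin n → ℝ) in nhds (x, y), 2 * dist y z.2 < dist x y := by
    refine (isOpen_lt (f := fun z : (Fin n → ℝ) × (Fin n → ℝ) => 2 * dist y z.2)
      (g := fun z => dist x y) (by fun_prop) (by fun_prop)).mem_nhds ?_
    simpa using hxy
  filter_upwards [e1, e2] with z h1 h2
  rw [Real.dist_eq]
  calc |K z.1 z.2 - K x y| = |(K z.1 z.2 - K x z.2) + (K x z.2 - K x y)| := by ring_nf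
    _ ≤ _ := (abs_add_le _ _).trans (add_le_add (hK.abs_sub_left h1) (hK.abs_sub_right h2))

lemma IsNormalisedKernel.measurable_tker (hγ0 : 0 < γ) (hK : IsNormalisedKernel n γ K) (k : ℤ) :
    Measurable (Function.uncurry (tker K k)) := by
  have hc := hK.continuousOn hγ0
  have hsm : MeasurableSet {z : (Fin n → ℝ) × (Fin n → ℝ) | 4 * (2:ℝ) ^ (-k) < dist z.1 z.2} :=
    measurableSet_lt measurable_const (measurable_fst.dist measurable_snd)
  have hc' : ContinuousOn (Function.uncurry K)
      {z : (Fin n → ℝ) × (Fin n → ℝ) | 4 * (2:ℝ) ^ (-k) < dist z.1 z.2} := by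
    refine hc.mono fun z hz hz' => ?_
    have hz1 : 4 * (2:ℝ) ^ (-k) < dist z.1 z.2 := hz
    rw [hz', dist_self] at hz1
    linarith [show (0:ℝ) < (2:ℝ) ^ (-k) by positivity]
  classical
  have := hc'.measurable_piecewise (g := fun _ => (0:ℝ)) continuousOn_const hsm
  convert this using 1
  funext z
  by_cases h : 4 * (2:ℝ) ^ (-k) < dist z.1 z.2 <;>
    simp [Function.uncurry, tker, Set.indicator, Set.piecewise]

lemma IsNormalisedKernel.bddMeas_tker (hγ0 : 0 < γ) (hK : IsNormalisedKernel n γ K) (k : ℤ)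
    (x : Fin n → ℝ) : BddMeas (tker K k x) :=
  ⟨(hK.measurable_tker hγ0 k).of_uncurry_left, _, fun y => hK.abs_tker_le k x y⟩

/-- `T_k` maps nice functions to bounded ones. -/
lemma IsNormalisedKernel.bddMeas_tOp (hγ0 : 0 < γ) (hK : IsNormalisedKernel n γ K) (k : ℤ)
    {f : (Fin n → ℝ) → ℝ} (hf : Nice f) : BddMeas (tOp K k f) := by
  refine ⟨?_, (2:ℝ) ^ (k * (n:ℤ)) * ∫ y, |f y|, fun x => ?_⟩
  · have hm : Measurable (Function.uncurry fun x y => tker K k x y * f y) :=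
      (hK.measurable_tker hγ0 k).mul (hf.measurable.comp measurable_snd)
    have := (hm.stronglyMeasurable.integral_prod_right (ν := volume)).measurable
    simpa only [← tOp_eq] using this
  · rw [tOp_eq, ← integral_const_mul]
    refine abs_integral_le_integral_abs.trans (integral_mono_of_nonneg
      (Filter.Eventually.of_forall fun _ => abs_nonneg _) (hf.2.abs.const_mul _)
      (Filter.Eventually.of_forall fun y => ?_))
    simp only [abs_mul]
    gcongr
    exact hK.abs_tker_le k x y

lemma IsNormalisedKernel.tOp_sub (hγ0 : 0 < γ) (hK : IsNormalisedKernel n γ K) (k : ℤ)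
    {f g : (Fin n → ℝ) → ℝ} (hf : Nice f) (hg : Nice g) :
    tOp K k (f - g) = tOp K k f - tOp K k g := by
  funext x
  rw [Pi.sub_apply, tOp_eq, tOp_eq, tOp_eq, ← integral_sub
    ((hK.bddMeas_tker hγ0 k x).integrable_mul hf.2) ((hK.bddMeas_tker hγ0 k x).integrable_mul hg.2)]
  simp [mul_sub]

lemma IsNormalisedKernel.tOp_add (hγ0 : 0 < γ) (hK : IsNormalisedKernel n γ K) (k : ℤ)
    {f g : (Fin n → ℝ) → ℝ} (hf : Nice f) (hg : Nice g) :
    tOp K k (f + g) = tOp K k f + tOp K k g := by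
  funext x
  rw [Pi.add_apply, tOp_eq, tOp_eq, tOp_eq, ← integral_add
    ((hK.bddMeas_tker hγ0 k x).integrable_mul hf.2) ((hK.bddMeas_tker hγ0 k x).integrable_mul hg.2)]
  simp [mul_add]

lemma IsNormalisedKernel.integral_tOp_mul (hγ0 : 0 < γ) (hK : IsNormalisedKernel n γ K) (k : ℤ)
    {f g : (Fin n → ℝ) → ℝ} (hf : Nice f) (hg : Nice g) :
    ∫ x, tOp K k f x * g x = ∫ y, f y * tOp (kerT K) k g y := by
  have hint : Integrable (Function.uncurry fun x y => tker K k x y * (g x * f y))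
      ((volume : Measure (Fin n → ℝ)).prod volume) := by
    refine (hg.2.mul_prod hf.2).bdd_mul (c := (2:ℝ) ^ (k * (n:ℤ)))
      (hK.measurable_tker hγ0 k).aestronglyMeasurable (Filter.Eventually.of_forall fun z => ?_)
    exact hK.abs_tker_le k z.1 z.2
  have := integral_integral_swap hint
  calc _ = ∫ x, ∫ y, tker K k x y * (g x * f y) := by
        congr 1; funext x
        rw [tOp_eq, ← integral_mul_const]
        congr 1; funext y; ring
    _ = _ := this
    _ = _ := by
        congr 1; funext y
        rw [tOp_eq, ← integral_const_mul]
        congr 1; funext x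
        rw [tker_transpose]; ring

/-- `u` is pointwise dominated by the convolution of `|f|` with the radial profile `φ`. -/
def Maj (φ : ℝ → ℝ) (u f : (Fin n → ℝ) → ℝ) : Prop :=
  ∀ x, ‖u x‖ₑ ≤ ∫⁻ y, ENNReal.ofReal (φ ‖x - y‖) * ‖f y‖ₑ

lemma enorm_integral_mul_le {a f : (Fin n → ℝ) → ℝ} {φ : ℝ → ℝ} {x : Fin n → ℝ}
    (h : ∀ y, |a y| ≤ φ ‖x - y‖) :
    ‖∫ y, a y * f y‖ₑ ≤ ∫⁻ y, ENNReal.ofReal (φ ‖x - y‖) * ‖f y‖ₑ := by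
  refine (enorm_integral_le_lintegral_enorm _).trans (lintegral_mono fun y => ?_)
  rw [enorm_mul, Real.enorm_eq_ofReal_abs]
  gcongr
  exact h y

lemma abs_sub_dyadicE_le {g : (Fin n → ℝ) → ℝ} (hg : BddMeas g) {j : ℤ} {y : Fin n → ℝ} {M : ℝ}
    (h : ∀ y', cubeIdx j y' = cubeIdx j y → |g y - g y'| ≤ M) :
    |g y - dyadicE n j g y| ≤ M := by
  have hc : BddMeas (fun _ : Fin n → ℝ => g y) := ⟨measurable_const, |g y|, by simp⟩
  have e1 : g y - dyadicE n j g y = dyadicE n j ((fun _ => g y) - g) y := by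
    rw [dyadicE_sub hc.cubeLoc hg.cubeLoc, Pi.sub_apply, dyadicE_const]
  rw [e1]
  refine (abs_dyadicE_le _ _ _).trans ?_
  have e2 : dyadicE n j (fun z => |((fun _ => g y : (Fin n → ℝ) → ℝ) - g) z|) y ≤ dyadicE n j (fun _ => M) y := by
    rw [dyadicE_eq, dyadicE_eq]
    refine mul_le_mul_of_nonneg_left (setIntegral_mono_on ((hc.sub hg).cubeLoc _ _).abs
      (integrableOn_const (volume_dyadicCube_lt_top _ _).ne) (measurableSet_dyadicCube _ _) ?_)
      (by positivity)
    intro z hz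
    exact h z ((mem_dyadicCube_iff _ _ _).1 hz)
  rwa [dyadicE_const] at e2

/-- `T_k (Id - E_j)` for `j ≥ k`. -/
lemma IsNormalisedKernel.maj_tOp_sub (hγ0 : 0 < γ) (hK : IsNormalisedKernel n γ K) {k j : ℤ}
    (hkj : k ≤ j) {f : (Fin n → ℝ) → ℝ} (hf : Nice f) :
    Maj (rho n γ k j) (tOp K k (f - dyadicE n j f)) f := by
  intro x
  have hb := hK.bddMeas_tker hγ0 k x
  have : tOp K k (f - dyadicE n j f) x =
      ∫ y, (tker K k x y - dyadicE n j (tker K k x) y) * f y := by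
    rw [hK.tOp_sub hγ0 k hf (hf.dyadicE j), Pi.sub_apply, tOp_eq, tOp_eq,
      integral_mul_dyadicE hb hf.measurable hf.2, ← integral_sub (hb.integrable_mul hf.2)
      ((hb.dyadicE j).integrable_mul hf.2)]
    simp [sub_mul]
  rw [this]
  refine enorm_integral_mul_le fun y => abs_sub_dyadicE_le hb fun y' hy' => ?_
  rw [← tker_transpose k y, ← tker_transpose k y', norm_sub_rev]
  exact hK.transpose.abs_tker_sub_le hγ0.le hkj (dist_lt_of_cubeIdx_eq hy'.symm).le x

/-- `(Id - E_j) T_k` for `j ≥ k`. -/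
lemma IsNormalisedKernel.maj_sub_tOp (hγ0 : 0 < γ) (hK : IsNormalisedKernel n γ K) {k j : ℤ}
    (hkj : k ≤ j) {f : (Fin n → ℝ) → ℝ} (hf : Nice f) :
    Maj (rho n γ k j) (tOp K k f - dyadicE n j (tOp K k f)) f := by
  intro x
  by_cases htop : ∫⁻ y, ENNReal.ofReal (rho n γ k j ‖x - y‖) * ‖f y‖ₑ = ⊤
  · rw [htop]; exact le_top
  rw [Pi.sub_apply, Real.enorm_eq_ofReal_abs, ← ENNReal.ofReal_toReal htop]
  refine ENNReal.ofReal_le_ofReal (abs_sub_dyadicE_le (hK.bddMeas_tOp hγ0 k hf) fun x' hx' => ?_)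
  rw [← ENNReal.ofReal_le_iff_le_toReal htop, ← Real.enorm_eq_ofReal_abs, tOp_eq, tOp_eq,
    ← integral_sub ((hK.bddMeas_tker hγ0 k x).integrable_mul hf.2)
      ((hK.bddMeas_tker hγ0 k x').integrable_mul hf.2)]
  simp only [← sub_mul]
  exact enorm_integral_mul_le fun y =>
    hK.abs_tker_sub_le hγ0.le hkj (dist_lt_of_cubeIdx_eq hx'.symm).le y

end Kernel

/-- The `L²` norm. -/
def nrm {n : ℕ} (f : (Fin n → ℝ) → ℝ) : ℝ := √(∫ x, f x * f x)

section MajBounds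
variable {n : ℕ} {φ : ℝ → ℝ} {u f g : (Fin n → ℝ) → ℝ}

lemma lintegral_enorm_sq_eq (hf : Nice f) : ∫⁻ x, ‖f x‖ₑ ^ 2 = ENNReal.ofReal (nrm f ^ 2) := by
  rw [nrm, Real.sq_sqrt (integral_nonneg fun x => mul_self_nonneg _),
    ofReal_integral_eq_lintegral_ofReal (hf.mul hf) (Filter.Eventually.of_forall
    fun x => mul_self_nonneg _)]
  congr 1; funext x
  rw [Real.enorm_eq_ofReal_abs, ← ENNReal.ofReal_pow (abs_nonneg _), sq_abs, sq]

lemma nrm_nonneg : 0 ≤ nrm f := Real.sqrt_nonneg _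

lemma nrm_sq : nrm f ^ 2 = ∫ x, f x * f x :=
  Real.sq_sqrt (integral_nonneg fun _ => mul_self_nonneg _)

lemma Nice.smul (hf : Nice f) (c : ℝ) : Nice (c • f) := by
  refine ⟨⟨hf.measurable.const_smul c, ?_⟩, hf.2.smul c⟩
  obtain ⟨M, hM⟩ := hf.1.2
  refine ⟨|c| * M, fun x => ?_⟩
  rw [Pi.smul_apply, smul_eq_mul, abs_mul]
  gcongr
  exact hM x

lemma integral_add_mul_sq (hf : Nice f) (hg : Nice g) (t : ℝ) :
    ∫ x, (f x + t * g x) * (f x + t * g x) =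
      nrm f ^ 2 + 2 * t * (∫ x, f x * g x) + t * t * nrm g ^ 2 := by
  have h1 : Integrable fun x => 2 * t * (f x * g x) := (hf.mul hg).const_mul _
  have h2 : Integrable fun x => f x * f x + 2 * t * (f x * g x) := (hf.mul hf).add h1
  rw [nrm_sq, nrm_sq, ← integral_const_mul, ← integral_const_mul,
    ← integral_add (hf.mul hf) h1, ← integral_add h2 ((hg.mul hg).const_mul _)]
  congr 1; funext x; ring

lemma abs_integral_mul_le (hf : Nice f) (hg : Nice g) :
    |∫ x, f x * g x| ≤ nrm f * nrm g := by
  have key : ∀ t : ℝ, 0 ≤ nrm g ^ 2 * (t * t) + (2 * ∫ x, f x * g x) * t + nrm f ^ 2 := by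
    intro t
    have h : 0 ≤ ∫ x, (f x + t * g x) * (f x + t * g x) :=
      integral_nonneg fun x => mul_self_nonneg _
    rw [integral_add_mul_sq hf hg] at h
    linarith
  have := discrim_le_zero key
  rw [discrim] at this
  refine abs_le_of_sq_le_sq ?_ (mul_nonneg nrm_nonneg nrm_nonneg)
  nlinarith

lemma lintegral_profile (x : Fin n → ℝ) :
    ∫⁻ y, ENNReal.ofReal (φ ‖x - y‖) = ∫⁻ z : Fin n → ℝ, ENNReal.ofReal (φ ‖z‖) :=
  lintegral_sub_left_eq_self (fun z => ENNReal.ofReal (φ ‖z‖)) x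

lemma measurable_profile (hφ : Measurable φ) :
    Measurable fun z : (Fin n → ℝ) × (Fin n → ℝ) => ENNReal.ofReal (φ ‖z.1 - z.2‖) :=
  (hφ.comp (measurable_fst.sub measurable_snd).norm).ennreal_ofReal

lemma Maj.setLIntegral_le (h : Maj φ u f) (hφ : Measurable φ) (hf : Measurable f)
    {X S : Set (Fin n → ℝ)} (hX : MeasurableSet X) (hfS : ∀ y ∉ S, f y = 0) {a : ℝ}
    (hd : ∀ x ∈ X, ∀ y ∈ S, a < ‖x - y‖) :
    ∫⁻ x in X, ‖u x‖ₑ ≤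
      (∫⁻ z in {z : Fin n → ℝ | a < ‖z‖}, ENNReal.ofReal (φ ‖z‖)) * ∫⁻ y, ‖f y‖ₑ := by
  have hm : MeasurableSet {z : Fin n → ℝ | a < ‖z‖} := measurableSet_lt measurable_const measurable_norm
  have hmeas : Measurable (Function.uncurry fun x y : Fin n → ℝ =>
      ENNReal.ofReal (φ ‖x - y‖) * ‖f y‖ₑ) :=
    (measurable_profile hφ).mul (hf.enorm.comp measurable_snd)
  calc ∫⁻ x in X, ‖u x‖ₑ ≤ ∫⁻ x in X, ∫⁻ y, ENNReal.ofReal (φ ‖x - y‖) * ‖f y‖ₑ :=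
        lintegral_mono fun x => h x
    _ = ∫⁻ y, ∫⁻ x in X, ENNReal.ofReal (φ ‖x - y‖) * ‖f y‖ₑ :=
        lintegral_lintegral_swap hmeas.aemeasurable
    _ ≤ ∫⁻ y, (∫⁻ z in {z : Fin n → ℝ | a < ‖z‖}, ENNReal.ofReal (φ ‖z‖)) * ‖f y‖ₑ := by
        refine lintegral_mono fun y => ?_
        by_cases hy : y ∈ S
        · have hmy : Measurable fun x => ENNReal.ofReal (φ ‖x - y‖) :=
            (measurable_profile hφ).of_uncurry_right (f := fun x y => ENNReal.ofReal (φ ‖x - y‖))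
          rw [lintegral_mul_const _ hmy]
          refine mul_le_mul_left ?_ _
          rw [← lintegral_indicator hX, ← lintegral_indicator hm, ← lintegral_sub_right_eq_self
            ({z : Fin n → ℝ | a < ‖z‖}.indicator fun z => ENNReal.ofReal (φ ‖z‖)) y]
          refine lintegral_mono fun x => ?_
          by_cases hx : x ∈ X
          · rw [Set.indicator_of_mem hx, Set.indicator_of_mem (show x - y ∈ {z : Fin n → ℝ | a < ‖z‖} from hd x hx y hy)]
          · rw [Set.indicator_of_notMem hx]; exact zero_le
        · simp [hfS y hy]
    _ = _ := lintegral_const_mul _ hf.enorm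

lemma Maj.lintegral_le (h : Maj φ u f) (hφ : Measurable φ) (hf : Measurable f) {I : ENNReal}
    (hI : ∫⁻ z : Fin n → ℝ, ENNReal.ofReal (φ ‖z‖) ≤ I) :
    ∫⁻ x, ‖u x‖ₑ ≤ I * ∫⁻ y, ‖f y‖ₑ := by
  have := h.setLIntegral_le hφ hf (X := Set.univ) (S := Set.univ) (a := -1) MeasurableSet.univ
    (by simp) (fun x _ y _ => by linarith [norm_nonneg (x - y)])
  rw [setLIntegral_univ] at this
  refine this.trans ?_
  gcongr
  exact (setLIntegral_le_lintegral _ _).trans hI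

lemma Maj.nice (h : Maj φ u f) (hφ : Measurable φ) (hf : Nice f) (hu : Measurable u) {I : ℝ}
    (hI : ∫⁻ z : Fin n → ℝ, ENNReal.ofReal (φ ‖z‖) ≤ ENNReal.ofReal I) : Nice u := by
  obtain ⟨⟨hfm, M, hM⟩, hfi⟩ := hf
  have hM0 : 0 ≤ M := (abs_nonneg _).trans (hM 0)
  refine ⟨⟨hu, max I 0 * M, fun x => ?_⟩, hu.aestronglyMeasurable, ?_⟩
  · rw [← ENNReal.ofReal_le_ofReal_iff (by positivity), ← Real.enorm_eq_ofReal_abs,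
      ENNReal.ofReal_mul (by positivity)]
    refine (h x).trans ?_
    calc _ ≤ ∫⁻ y, ENNReal.ofReal (φ ‖x - y‖) * ENNReal.ofReal M := by
          refine lintegral_mono fun y => ?_
          gcongr
          rw [Real.enorm_eq_ofReal_abs]
          exact ENNReal.ofReal_le_ofReal (hM y)
      _ = (∫⁻ y, ENNReal.ofReal (φ ‖x - y‖)) * ENNReal.ofReal M :=
          lintegral_mul_const' _ _ ENNReal.ofReal_ne_top
      _ ≤ _ := by
          rw [lintegral_profile]
          gcongr
          exact hI.trans (ENNReal.ofReal_le_ofReal (le_max_left _ _))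
  · exact (h.lintegral_le hφ hfm hI).trans_lt (ENNReal.mul_lt_top ENNReal.ofReal_lt_top hfi.2)

lemma sq_lintegral_mul_le {α : Type*} [MeasurableSpace α] {μ : Measure α} {a b : α → ENNReal}
    (ha : Measurable a) (hb : Measurable b) :
    (∫⁻ x, a x * b x ∂μ) ^ 2 ≤ (∫⁻ x, a x ∂μ) * ∫⁻ x, a x * b x ^ 2 ∂μ := by
  have hs : ∀ t : ENNReal, (t ^ (1/2 : ℝ)) ^ (2:ℝ) = t := fun t => by
    rw [← ENNReal.rpow_mul]; norm_num
  have key := ENNReal.lintegral_mul_le_Lp_mul_Lq μ Real.HolderConjugate.two_two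
    (ha.pow_const (1/2 : ℝ)).aemeasurable ((ha.pow_const (1/2 : ℝ)).mul hb).aemeasurable
  have h2 := ENNReal.rpow_le_rpow key (z := 2) (by norm_num)
  rw [ENNReal.mul_rpow_of_nonneg _ _ (by norm_num : (0:ℝ) ≤ 2), hs, hs] at h2
  convert h2 using 1
  · rw [← ENNReal.rpow_natCast]
    norm_num
    congr 2
    funext x
    rw [← mul_assoc, ← ENNReal.rpow_add_of_nonneg _ _ (by norm_num) (by norm_num)]
    norm_num
  · simp only [hs, Pi.mul_apply, ENNReal.mul_rpow_of_nonneg _ _ (by norm_num : (0:ℝ) ≤ 2)]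
    norm_num

lemma Maj.lintegral_sq_le (h : Maj φ u f) (hφ : Measurable φ) (hf : Measurable f) {I : ENNReal}
    (hI : ∫⁻ z : Fin n → ℝ, ENNReal.ofReal (φ ‖z‖) ≤ I) :
    ∫⁻ x, ‖u x‖ₑ ^ 2 ≤ I ^ 2 * ∫⁻ y, ‖f y‖ₑ ^ 2 := by
  have hmeas : Measurable (Function.uncurry fun x y : Fin n → ℝ =>
      ENNReal.ofReal (φ ‖x - y‖) * ‖f y‖ₑ ^ 2) :=
    (measurable_profile hφ).mul ((hf.enorm.pow_const 2).comp measurable_snd)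
  have hmx : ∀ x : Fin n → ℝ, Measurable fun y => ENNReal.ofReal (φ ‖x - y‖) := fun x =>
    (measurable_profile hφ).of_uncurry_left (f := fun x y => ENNReal.ofReal (φ ‖x - y‖))
  have hmy : ∀ y : Fin n → ℝ, Measurable fun x => ENNReal.ofReal (φ ‖x - y‖) := fun y =>
    (measurable_profile hφ).of_uncurry_right (f := fun x y => ENNReal.ofReal (φ ‖x - y‖))
  calc ∫⁻ x, ‖u x‖ₑ ^ 2 ≤ ∫⁻ x, I * ∫⁻ y, ENNReal.ofReal (φ ‖x - y‖) * ‖f y‖ₑ ^ 2 := by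
        refine lintegral_mono fun x => (pow_le_pow_left' (h x) 2).trans ?_
        refine (sq_lintegral_mul_le (hmx x) hf.enorm).trans ?_
        rw [lintegral_profile]
        gcongr
    _ = I * ∫⁻ y, ∫⁻ x, ENNReal.ofReal (φ ‖x - y‖) * ‖f y‖ₑ ^ 2 := by
        rw [lintegral_const_mul _ (Measurable.lintegral_prod_right hmeas),
          lintegral_lintegral_swap hmeas.aemeasurable]
    _ ≤ I * ∫⁻ y, I * ‖f y‖ₑ ^ 2 := by
        gcongr with y
        rw [lintegral_mul_const _ (hmy y)]
        gcongr
        simp only [norm_sub_rev _ y]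
        rw [lintegral_profile]
        exact hI
    _ = _ := by rw [lintegral_const_mul _ (hf.enorm.pow_const 2), ← mul_assoc, sq]

lemma Maj.nrm_le (h : Maj φ u f) (hφ : Measurable φ) (hf : Nice f) (hu : Measurable u) {I : ℝ}
    (hI0 : 0 ≤ I) (hI : ∫⁻ z : Fin n → ℝ, ENNReal.ofReal (φ ‖z‖) ≤ ENNReal.ofReal I) :
    nrm u ≤ I * nrm f := by
  have h1 := h.lintegral_sq_le hφ hf.measurable hI
  rw [lintegral_enorm_sq_eq (h.nice hφ hf hu hI), lintegral_enorm_sq_eq hf,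
    ← ENNReal.ofReal_pow hI0, ← ENNReal.ofReal_mul (by positivity),
    ENNReal.ofReal_le_ofReal_iff (by positivity), ← mul_pow] at h1
  exact (abs_le_of_sq_le_sq' h1 (mul_nonneg hI0 nrm_nonneg)).2

end MajBounds

/-- The decay weight `min (q^s) (q^d)`. -/
def wt (q : ℝ) (s d : ℕ) : ℝ := min (q ^ s) (q ^ d)

/-- A bound for the total mass of the decay weight. -/
def wtSum (q : ℝ) (s : ℕ) : ℝ := 2 * (q ^ s * (s + (1 - q)⁻¹))

lemma wt_nonneg {q : ℝ} (hq0 : 0 ≤ q) (s d : ℕ) : 0 ≤ wt q s d :=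
  le_min (by positivity) (by positivity)

lemma mul_pow_le_wt {q : ℝ} (hq0 : 0 ≤ q) (hq1 : q ≤ 1) (s d : ℕ) : q ^ s * q ^ d ≤ wt q s d :=
  le_min (mul_le_of_le_one_right (by positivity) (pow_le_one₀ hq0 hq1))
    (mul_le_of_le_one_left (by positivity) (pow_le_one₀ hq0 hq1))

lemma sum_wt_nat_le {q : ℝ} (hq0 : 0 < q) (hq1 : q < 1) (s : ℕ) (D : Finset ℕ) :
    ∑ d ∈ D, wt q s d ≤ q ^ s * (s + (1 - q)⁻¹) := by
  have h1 : D ⊆ Finset.range (s + (D.sup id + 1)) := fun d hd => by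
    have : d ≤ D.sup id := Finset.le_sup (f := id) hd
    simp only [Finset.mem_range]
    omega
  refine (Finset.sum_le_sum_of_subset_of_nonneg h1 fun d _ _ => wt_nonneg hq0.le s d).trans ?_
  rw [Finset.sum_range_add, mul_add]
  refine add_le_add ?_ ?_
  · calc _ ≤ ∑ d ∈ Finset.range s, q ^ s := Finset.sum_le_sum fun d _ => min_le_left _ _
      _ = _ := by simp [mul_comm]
  · calc _ ≤ ∑ d ∈ Finset.range (D.sup id + 1), q ^ s * q ^ d :=
        Finset.sum_le_sum fun d _ => (min_le_right _ _).trans (pow_add q s d).le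
      _ = q ^ s * ∑ d ∈ Finset.range (D.sup id + 1), q ^ d := (Finset.mul_sum _ _ _).symm
      _ ≤ _ := by
        gcongr
        rw [← tsum_geometric_of_lt_one hq0.le hq1]
        exact (summable_geometric_of_lt_one hq0.le hq1).sum_le_tsum _ fun _ _ => by positivity

lemma sum_wt_le {q : ℝ} (hq0 : 0 < q) (hq1 : q < 1) (s : ℕ) (A : Finset ℤ) (i : ℤ) :
    ∑ k ∈ A, wt q s (k - i).natAbs ≤ wtSum q s := by
  rw [wtSum, two_mul, ← Finset.sum_filter_add_sum_filter_not A (fun k => i ≤ k)]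
  refine add_le_add ?_ ?_
  · rw [← Finset.sum_image (f := wt q s) (g := fun k : ℤ => (k - i).natAbs)]
    · exact sum_wt_nat_le hq0 hq1 s _
    · intro a ha b hb hab
      simp only [Finset.coe_filter, Set.mem_ofPred_eq] at ha hb hab
      omega
  · rw [← Finset.sum_image (f := wt q s) (g := fun k : ℤ => (k - i).natAbs)]
    · exact sum_wt_nat_le hq0 hq1 s _
    · intro a ha b hb hab
      simp only [Finset.coe_filter, Set.mem_ofPred_eq] at ha hb hab
      omega

lemma sum_sum_wt_le {q : ℝ} (hq0 : 0 < q) (hq1 : q < 1) (s : ℕ) (A : Finset ℤ) (a : ℤ → ℝ) :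
    ∑ k ∈ A, ∑ l ∈ A, wt q s (k - l).natAbs * (a k * a l) ≤ wtSum q s * ∑ k ∈ A, a k ^ 2 := by
  have hsym : ∀ k l : ℤ, (k - l).natAbs = (l - k).natAbs := fun k l => by omega
  have h1 : ∑ k ∈ A, ∑ l ∈ A, wt q s (k - l).natAbs * a k ^ 2 ≤ wtSum q s * ∑ k ∈ A, a k ^ 2 := by
    rw [Finset.mul_sum]
    refine Finset.sum_le_sum fun k _ => ?_
    rw [← Finset.sum_mul]
    refine mul_le_mul_of_nonneg_right ?_ (sq_nonneg _)
    simp only [hsym k]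
    exact sum_wt_le hq0 hq1 s A k
  have h2 : ∑ k ∈ A, ∑ l ∈ A, wt q s (k - l).natAbs * a l ^ 2 ≤ wtSum q s * ∑ k ∈ A, a k ^ 2 := by
    rw [Finset.sum_comm]
    simpa only [hsym] using h1
  have h3 : ∑ k ∈ A, ∑ l ∈ A, wt q s (k - l).natAbs * (a k * a l) ≤
      (∑ k ∈ A, ∑ l ∈ A, wt q s (k - l).natAbs * a k ^ 2 +
        ∑ k ∈ A, ∑ l ∈ A, wt q s (k - l).natAbs * a l ^ 2) / 2 := by
    rw [← Finset.sum_add_distrib, Finset.sum_div]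
    refine Finset.sum_le_sum fun k _ => ?_
    rw [← Finset.sum_add_distrib, Finset.sum_div]
    refine Finset.sum_le_sum fun l _ => ?_
    nlinarith [mul_nonneg (wt_nonneg hq0.le s (k - l).natAbs) (sq_nonneg (a k - a l))]
  linarith

section Martingale
variable {n : ℕ} {f g : (Fin n → ℝ) → ℝ}

lemma Nice.dyadicE_sub (hf : Nice f) (hg : Nice g) (k : ℤ) :
    _root_.dyadicE n k (f - g) = _root_.dyadicE n k f - _root_.dyadicE n k g :=
  _root_.dyadicE_sub hf.1.cubeLoc hg.1.cubeLoc k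

lemma Nice.dyadicE_add (hf : Nice f) (hg : Nice g) (k : ℤ) :
    _root_.dyadicE n k (f + g) = _root_.dyadicE n k f + _root_.dyadicE n k g :=
  _root_.dyadicE_add hf.1.cubeLoc hg.1.cubeLoc k

lemma dyadicD_eq (k : ℤ) (f : (Fin n → ℝ) → ℝ) :
    dyadicD n k f = dyadicE n (k + 1) f - dyadicE n k f := rfl

lemma BddMeas.dyadicD_add (hf : BddMeas f) (hg : BddMeas g) (k : ℤ) :
    _root_.dyadicD n k (f + g) = _root_.dyadicD n k f + _root_.dyadicD n k g := by
  simp only [dyadicD_eq, _root_.dyadicE_add hf.cubeLoc hg.cubeLoc]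
  abel

lemma BddMeas.dyadicD_sub_dyadicE (hf : BddMeas f) (k : ℤ) :
    _root_.dyadicD n k (f - _root_.dyadicE n k f) = _root_.dyadicD n k f := by
  simp only [dyadicD_eq, dyadicE_sub hf.cubeLoc (hf.dyadicE k).cubeLoc,
    dyadicE_dyadicE_of_ge (le_refl k), dyadicE_dyadicE_of_ge (by omega : k ≤ k + 1)]
  abel

lemma Nice.dyadicE_dyadicE (hf : Nice f) {k j : ℤ} (hkj : k ≤ j) :
    _root_.dyadicE n k (_root_.dyadicE n j f) = _root_.dyadicE n k f :=
  dyadicE_dyadicE_of_le hkj hf.measurable hf.2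

lemma Nice.dyadicE_dyadicD (hf : Nice f) {k j : ℤ} (hkj : k ≤ j) :
    _root_.dyadicE n k (_root_.dyadicD n j f) = 0 := by
  rw [dyadicD_eq, (hf.dyadicE (j + 1)).dyadicE_sub (hf.dyadicE j),
    hf.dyadicE_dyadicE (by omega), hf.dyadicE_dyadicE hkj, sub_self]

lemma Nice.integral_mul_dyadicE_comm (hf : Nice f) (hg : Nice g) (k : ℤ) :
    ∫ x, f x * _root_.dyadicE n k g x = ∫ x, _root_.dyadicE n k f x * g x :=
  integral_mul_dyadicE hf.1 hg.measurable hg.2 k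

lemma Nice.integral_sub_dyadicE_mul (hf : Nice f) (hg : Nice g) (k : ℤ) :
    ∫ x, (f - _root_.dyadicE n k f) x * g x = ∫ x, f x * (g - _root_.dyadicE n k g) x := by
  simp only [Pi.sub_apply, sub_mul, mul_sub]
  rw [integral_sub (hf.mul hg) ((hf.dyadicE k).mul hg), integral_sub (hf.mul hg)
    (hf.mul (hg.dyadicE k)), hf.integral_mul_dyadicE_comm hg]

lemma Nice.integral_dyadicD_mul (hf : BddMeas f) (hg : Nice g) (k : ℤ) :
    ∫ x, _root_.dyadicD n k f x * g x = ∫ x, f x * _root_.dyadicD n k g x := by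
  simp only [dyadicD_eq, Pi.sub_apply, sub_mul, mul_sub]
  rw [integral_sub ((hf.dyadicE _).integrable_mul hg.2) ((hf.dyadicE k).integrable_mul hg.2),
    integral_sub (hf.integrable_mul (hg.dyadicE _).2) (hf.integrable_mul (hg.dyadicE k).2),
    integral_mul_dyadicE hf hg.measurable hg.2, integral_mul_dyadicE hf hg.measurable hg.2]

lemma Nice.integral_dyadicE_sq (hf : Nice f) (k : ℤ) :
    ∫ x, f x * _root_.dyadicE n k f x = nrm (_root_.dyadicE n k f) ^ 2 := by
  rw [nrm_sq, (hf.dyadicE k).integral_mul_dyadicE_comm hf, dyadicE_dyadicE_of_ge le_rfl]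
  simp only [mul_comm]

lemma Nice.nrm_sub_dyadicE_sq (hf : Nice f) (k : ℤ) :
    nrm (f - _root_.dyadicE n k f) ^ 2 = nrm f ^ 2 - nrm (_root_.dyadicE n k f) ^ 2 := by
  have := integral_add_mul_sq hf (hf.dyadicE k) (-1)
  rw [hf.integral_dyadicE_sq] at this
  rw [nrm_sq (f := f - _root_.dyadicE n k f)]
  simp only [Pi.sub_apply]
  simp only [neg_mul, one_mul, ← sub_eq_add_neg] at this
  rw [this]
  ring

lemma Nice.nrm_dyadicE_le (hf : Nice f) (k : ℤ) : nrm (_root_.dyadicE n k f) ≤ nrm f := by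
  refine (abs_le_of_sq_le_sq' ?_ nrm_nonneg).2
  linarith [hf.nrm_sub_dyadicE_sq k, sq_nonneg (nrm (f - _root_.dyadicE n k f))]

lemma Nice.nrm_sub_dyadicE_le (hf : Nice f) (k : ℤ) : nrm (f - _root_.dyadicE n k f) ≤ nrm f := by
  refine (abs_le_of_sq_le_sq' ?_ nrm_nonneg).2
  linarith [hf.nrm_sub_dyadicE_sq k, sq_nonneg (nrm (_root_.dyadicE n k f))]

lemma Nice.nrm_dyadicD_sq (hf : Nice f) (k : ℤ) :
    nrm (_root_.dyadicD n k f) ^ 2 =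
      nrm (_root_.dyadicE n (k + 1) f) ^ 2 - nrm (_root_.dyadicE n k f) ^ 2 := by
  have := (hf.dyadicE (k + 1)).nrm_sub_dyadicE_sq k
  rwa [hf.dyadicE_dyadicE (by omega)] at this

lemma Nice.sum_nrm_dyadicD_sq_le (hf : Nice f) (s : ℤ) (A : Finset ℤ) :
    ∑ k ∈ A, nrm (_root_.dyadicD n (k + s) f) ^ 2 ≤ nrm f ^ 2 := by
  have hmono : ∀ {a b : ℤ}, a ≤ b → nrm (_root_.dyadicE n a f) ^ 2 ≤
      nrm (_root_.dyadicE n b f) ^ 2 := fun {a b} hab => by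
    rw [← hf.dyadicE_dyadicE hab]
    exact pow_le_pow_left₀ nrm_nonneg ((hf.dyadicE b).nrm_dyadicE_le a) 2
  have key : ∀ b : ℤ, (∀ k ∈ A, k < b) →
      ∑ k ∈ A, nrm (_root_.dyadicD n (k + s) f) ^ 2 ≤ nrm (_root_.dyadicE n (b + s) f) ^ 2 := by
    induction A using Finset.induction_on_max with
    | empty => intro b _; simpa using sq_nonneg _
    | insert a A ha ih =>
      intro b hb
      rw [Finset.sum_insert fun h => lt_irrefl _ (ha a h), hf.nrm_dyadicD_sq]
      have h1 := hb a (Finset.mem_insert_self _ _)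
      linarith [ih a ha, hmono (by omega : a + s + 1 ≤ b + s)]
  obtain ⟨b, hb⟩ := A.exists_le
  exact (key (b + 1) fun k hk => by linarith [hb k hk]).trans
    (pow_le_pow_left₀ nrm_nonneg (hf.nrm_dyadicE_le _) 2)

lemma setLIntegral_enorm_sub_dyadicE_le (hf : Measurable f) {k : ℤ} {X : Set (Fin n → ℝ)}
    (hX : CubeInv k (· ∈ X)) :
    ∫⁻ x in X, ‖(f - dyadicE n k f) x‖ₑ ≤ 2 * ∫⁻ x in X, ‖f x‖ₑ := by
  calc _ ≤ ∫⁻ x in X, (‖f x‖ₑ + ‖dyadicE n k f x‖ₑ) := lintegral_mono fun x => enorm_sub_le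
    _ = _ := lintegral_add_left hf.enorm _
    _ ≤ _ := by
      rw [two_mul]
      refine add_le_add le_rfl ?_
      exact setLIntegral_enorm_dyadicE_le hf hX

lemma setLIntegral_enorm_dyadicD_le (hf : Measurable f) {k : ℤ} {X : Set (Fin n → ℝ)}
    (hX : CubeInv k (· ∈ X)) :
    ∫⁻ x in X, ‖dyadicD n k f x‖ₑ ≤ 2 * ∫⁻ x in X, ‖f x‖ₑ := by
  calc _ ≤ ∫⁻ x in X, (‖dyadicE n (k + 1) f x‖ₑ + ‖dyadicE n k f x‖ₑ) :=
        lintegral_mono fun x => enorm_sub_le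
    _ = _ := lintegral_add_left (measurable_dyadicE _ _).enorm _
    _ ≤ _ := by
      rw [two_mul]
      refine add_le_add ?_ ?_
      · exact setLIntegral_enorm_dyadicE_le hf (hX.mono (le_add_of_nonneg_right zero_le_one))
      · exact setLIntegral_enorm_dyadicE_le hf hX

lemma lintegral_enorm_sub_dyadicE_le (hf : Measurable f) (k : ℤ) :
    ∫⁻ x, ‖(f - dyadicE n k f) x‖ₑ ≤ 2 * ∫⁻ x, ‖f x‖ₑ := by
  simpa using setLIntegral_enorm_sub_dyadicE_le hf (k := k) (X := Set.univ) fun _ _ _ => rfl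

lemma lintegral_enorm_dyadicD_le (hf : Measurable f) (k : ℤ) :
    ∫⁻ x, ‖dyadicD n k f x‖ₑ ≤ 2 * ∫⁻ x, ‖f x‖ₑ := by
  simpa using setLIntegral_enorm_dyadicD_le hf (k := k) (X := Set.univ) fun _ _ _ => rfl

/-- `E_k f` is supported in any `k`-invariant set containing the support of `f`. -/
lemma dyadicE_eq_zero_of_notMem {k : ℤ} {S : Set (Fin n → ℝ)} (hS : CubeInv k (· ∈ S))
    (hfS : ∀ y ∉ S, f y = 0) : ∀ y ∉ S, dyadicE n k f y = 0 := by
  intro y hy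
  have : S.indicator f = f := Set.indicator_eq_self.2 fun y hy => by_contra fun h => hy (hfS y h)
  rw [← this, dyadicE_indicator hS, Set.indicator_of_notMem hy]

end Martingale

section Operators
variable {n : ℕ} {γ : ℝ} {K : (Fin n → ℝ) → (Fin n → ℝ) → ℝ} {s : ℕ} {f g b : (Fin n → ℝ) → ℝ}

/-- `T_k D_{k+s}`. -/
def wOp (K : (Fin n → ℝ) → (Fin n → ℝ) → ℝ) (s : ℕ) (k : ℤ) (f : (Fin n → ℝ) → ℝ) :
    (Fin n → ℝ) → ℝ := tOp K k (dyadicD n (k + s) f)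

/-- `(Id - E_k) T_k D_{k+s}`. -/
def pOp (K : (Fin n → ℝ) → (Fin n → ℝ) → ℝ) (s : ℕ) (k : ℤ) (f : (Fin n → ℝ) → ℝ) :
    (Fin n → ℝ) → ℝ := wOp K s k f - dyadicE n k (wOp K s k f)

/-- `D_{k+s} T_k (Id - E_k)`. -/
def qOp (K : (Fin n → ℝ) → (Fin n → ℝ) → ℝ) (s : ℕ) (k : ℤ) (g : (Fin n → ℝ) → ℝ) :
    (Fin n → ℝ) → ℝ := dyadicD n (k + s) (tOp K k (g - dyadicE n k g))

lemma IsNormalisedKernel.maj_wOp (hγ0 : 0 < γ) (hK : IsNormalisedKernel n γ K) (s : ℕ) (k : ℤ)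
    (hf : Nice f) : Maj (rho n γ k (k + s)) (wOp K s k f) (dyadicD n (k + s) f) := by
  have := hK.maj_tOp_sub hγ0 (k := k) (j := k + s) (by omega) (hf.dyadicD (k + s))
  rwa [hf.dyadicE_dyadicD le_rfl, sub_zero] at this

lemma IsNormalisedKernel.nice_wOp (hn : 0 < n) (hγ0 : 0 < γ) (hγ1 : γ ≤ 1)
    (hK : IsNormalisedKernel n γ K) (s : ℕ) (k : ℤ) (hf : Nice f) : Nice (wOp K s k f) :=
  (hK.maj_wOp hγ0 s k hf).nice (measurable_rho _ _) (hf.dyadicD _)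
    (hK.bddMeas_tOp hγ0 k (hf.dyadicD _)).1 (lintegral_rho_le hn hγ0 hγ1 k s)

lemma IsNormalisedKernel.nice_pOp (hn : 0 < n) (hγ0 : 0 < γ) (hγ1 : γ ≤ 1)
    (hK : IsNormalisedKernel n γ K) (s : ℕ) (k : ℤ) (hf : Nice f) : Nice (pOp K s k f) :=
  (hK.nice_wOp hn hγ0 hγ1 s k hf).sub ((hK.nice_wOp hn hγ0 hγ1 s k hf).dyadicE k)

lemma IsNormalisedKernel.nice_tOp_sub_dyadicE (hn : 0 < n) (hγ0 : 0 < γ) (hγ1 : γ ≤ 1)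
    (hK : IsNormalisedKernel n γ K) (s : ℕ) (k : ℤ) (hf : Nice f) :
    Nice (tOp K k f - dyadicE n (k + s) (tOp K k f)) :=
  (hK.maj_sub_tOp hγ0 (by omega) hf).nice (measurable_rho _ _) hf
    ((hK.bddMeas_tOp hγ0 k hf).sub ((hK.bddMeas_tOp hγ0 k hf).dyadicE _)).1
    (lintegral_rho_le hn hγ0 hγ1 k s)

lemma IsNormalisedKernel.qOp_eq (hγ0 : 0 < γ) (hK : IsNormalisedKernel n γ K) (s : ℕ) (k : ℤ)
    (hg : Nice g) : qOp K s k g = dyadicD n (k + s) (tOp K k (g - dyadicE n k g) -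
      dyadicE n (k + s) (tOp K k (g - dyadicE n k g))) :=
  ((hK.bddMeas_tOp hγ0 k (hg.sub (hg.dyadicE k))).dyadicD_sub_dyadicE _).symm

lemma IsNormalisedKernel.nice_qOp (hn : 0 < n) (hγ0 : 0 < γ) (hγ1 : γ ≤ 1)
    (hK : IsNormalisedKernel n γ K) (s : ℕ) (k : ℤ) (hg : Nice g) : Nice (qOp K s k g) := by
  rw [hK.qOp_eq hγ0 s k hg]
  exact (hK.nice_tOp_sub_dyadicE hn hγ0 hγ1 s k (hg.sub (hg.dyadicE k))).dyadicD _

lemma IsNormalisedKernel.wOp_add (hγ0 : 0 < γ)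
    (hK : IsNormalisedKernel n γ K) (s : ℕ) (k : ℤ) (hf : Nice f) (hg : Nice g) :
    wOp K s k (f + g) = wOp K s k f + wOp K s k g := by
  rw [wOp, hf.1.dyadicD_add hg.1, hK.tOp_add hγ0 k (hf.dyadicD _) (hg.dyadicD _)]
  rfl

lemma IsNormalisedKernel.pOp_add (hn : 0 < n) (hγ0 : 0 < γ) (hγ1 : γ ≤ 1)
    (hK : IsNormalisedKernel n γ K) (s : ℕ) (k : ℤ) (hf : Nice f) (hg : Nice g) :
    pOp K s k (f + g) = pOp K s k f + pOp K s k g := by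
  simp only [pOp]
  rw [hK.wOp_add hγ0 s k hf hg, (hK.nice_wOp hn hγ0 hγ1 s k hf).dyadicE_add
    (hK.nice_wOp hn hγ0 hγ1 s k hg)]
  abel

lemma IsNormalisedKernel.qOp_add (hγ0 : 0 < γ)
    (hK : IsNormalisedKernel n γ K) (s : ℕ) (k : ℤ) (hf : Nice f) (hg : Nice g) :
    qOp K s k (f + g) = qOp K s k f + qOp K s k g := by
  have e : f + g - dyadicE n k (f + g) = (f - dyadicE n k f) + (g - dyadicE n k g) := by
    rw [hf.dyadicE_add hg]; abel
  have hf' := hf.sub (hf.dyadicE k)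
  have hg' := hg.sub (hg.dyadicE k)
  rw [qOp, e, hK.tOp_add hγ0 k hf' hg', (hK.bddMeas_tOp hγ0 k hf').dyadicD_add
    (hK.bddMeas_tOp hγ0 k hg')]
  rfl

lemma IsNormalisedKernel.integral_pOp_mul (hn : 0 < n) (hγ0 : 0 < γ) (hγ1 : γ ≤ 1)
    (hK : IsNormalisedKernel n γ K) (s : ℕ) (k : ℤ) (hf : Nice f) (hg : Nice g) :
    ∫ x, pOp K s k f x * g x = ∫ x, f x * qOp (kerT K) s k g x := by
  have hg' := hg.sub (hg.dyadicE k)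
  rw [pOp, (hK.nice_wOp hn hγ0 hγ1 s k hf).integral_sub_dyadicE_mul hg, wOp,
    hK.integral_tOp_mul hγ0 k (hf.dyadicD _) hg', qOp]
  have hb := hK.transpose.bddMeas_tOp hγ0 k hg'
  have := Nice.integral_dyadicD_mul hb hf (k + s)
  simp only [mul_comm (f _)]
  rw [this]
  simp only [mul_comm]

lemma IsNormalisedKernel.nrm_wOp_le (hn : 0 < n) (hγ0 : 0 < γ) (hγ1 : γ ≤ 1)
    (hK : IsNormalisedKernel n γ K) (s : ℕ) (k : ℤ) (hf : Nice f) :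
    nrm (wOp K s k f) ≤ rhoC n γ * ((1/2 : ℝ) ^ γ) ^ s * nrm (dyadicD n (k + s) f) :=
  (hK.maj_wOp hγ0 s k hf).nrm_le (measurable_rho _ _) (hf.dyadicD _)
    (hK.nice_wOp hn hγ0 hγ1 s k hf).measurable (mul_nonneg (rhoC_pos hn hγ0).le (by positivity))
    (lintegral_rho_le hn hγ0 hγ1 k s)

lemma IsNormalisedKernel.nrm_wOp_sub_le (hn : 0 < n) (hγ0 : 0 < γ) (hγ1 : γ ≤ 1)
    (hK : IsNormalisedKernel n γ K) (s : ℕ) (k : ℤ) (d : ℕ) (hf : Nice f) :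
    nrm (wOp K s k f - dyadicE n (k + d) (wOp K s k f)) ≤
      rhoC n γ * wt ((1/2 : ℝ) ^ γ) s d * nrm (dyadicD n (k + s) f) := by
  have hw := hK.nice_wOp hn hγ0 hγ1 s k hf
  have hC := (rhoC_pos hn hγ0).le
  have hD := hf.dyadicD (k + s)
  rw [wt]
  rcases min_choice (((1/2 : ℝ) ^ γ) ^ s) (((1/2 : ℝ) ^ γ) ^ d) with h | h <;> rw [h]
  · exact (hw.nrm_sub_dyadicE_le _).trans (hK.nrm_wOp_le hn hγ0 hγ1 s k hf)
  · exact (hK.maj_sub_tOp hγ0 (by omega) hD).nrm_le (measurable_rho _ _) hD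
      (hw.sub (hw.dyadicE _)).measurable (by positivity) (lintegral_rho_le hn hγ0 hγ1 k d)

lemma IsNormalisedKernel.abs_integral_pOp_le_of_le (hn : 0 < n) (hγ0 : 0 < γ) (hγ1 : γ ≤ 1)
    (hK : IsNormalisedKernel n γ K) (s : ℕ) (k : ℤ) (d : ℕ) (hf : Nice f) :
    |∫ x, pOp K s k f x * pOp K s (k + d) f x| ≤
      rhoC n γ ^ 2 * ((1/2 : ℝ) ^ γ) ^ s * (wt ((1/2 : ℝ) ^ γ) s d *
        (nrm (dyadicD n (k + s) f) * nrm (dyadicD n (k + d + s) f))) := by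
  have hw := hK.nice_wOp hn hγ0 hγ1 s k hf
  have hw' := hK.nice_wOp hn hγ0 hγ1 s (k + d) hf
  have hC := (rhoC_pos hn hγ0).le
  have e : pOp K s k f - dyadicE n (k + d) (pOp K s k f) =
      wOp K s k f - dyadicE n (k + d) (wOp K s k f) := by
    simp only [pOp]
    rw [hw.dyadicE_sub (hw.dyadicE k), dyadicE_dyadicE_of_ge (by omega)]
    abel
  have e2 : ∫ x, pOp K s k f x * pOp K s (k + d) f x =
      ∫ x, (wOp K s k f - dyadicE n (k + d) (wOp K s k f)) x * wOp K s (k + d) f x := by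
    rw [← e, (hK.nice_pOp hn hγ0 hγ1 s k hf).integral_sub_dyadicE_mul hw']
    rfl
  rw [e2]
  calc _ ≤ _ := abs_integral_mul_le (hw.sub (hw.dyadicE _)) hw'
    _ ≤ (rhoC n γ * wt ((1/2 : ℝ) ^ γ) s d * nrm (dyadicD n (k + s) f)) *
        (rhoC n γ * ((1/2 : ℝ) ^ γ) ^ s * nrm (dyadicD n (k + d + s) f)) :=
      mul_le_mul (hK.nrm_wOp_sub_le hn hγ0 hγ1 s k d hf)
        (hK.nrm_wOp_le hn hγ0 hγ1 s (k + d) hf) nrm_nonneg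
        (mul_nonneg (mul_nonneg hC (wt_nonneg (by positivity) _ _)) nrm_nonneg)
    _ = _ := by ring

lemma IsNormalisedKernel.abs_integral_pOp_le (hn : 0 < n) (hγ0 : 0 < γ) (hγ1 : γ ≤ 1)
    (hK : IsNormalisedKernel n γ K) (s : ℕ) (k l : ℤ) (hf : Nice f) :
    |∫ x, pOp K s k f x * pOp K s l f x| ≤
      rhoC n γ ^ 2 * ((1/2 : ℝ) ^ γ) ^ s * (wt ((1/2 : ℝ) ^ γ) s (k - l).natAbs *
        (nrm (dyadicD n (k + s) f) * nrm (dyadicD n (l + s) f))) := by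
  rcases le_total k l with h | h
  · obtain ⟨d, rfl⟩ := Int.le.dest h
    rw [show (k - (k + d)).natAbs = d by omega]
    exact hK.abs_integral_pOp_le_of_le hn hγ0 hγ1 s k d hf
  · obtain ⟨d, rfl⟩ := Int.le.dest h
    rw [show (l + d - l).natAbs = d by omega]
    simp only [mul_comm (pOp K s (l + d) f _), mul_comm (nrm (dyadicD n (l + d + s) f))]
    exact hK.abs_integral_pOp_le_of_le hn hγ0 hγ1 s l d hf

/-- The common operator bound. -/
def opB (n : ℕ) (γ : ℝ) (s : ℕ) : ℝ := 4 * rhoC n γ * wtSum ((1/2 : ℝ) ^ γ) s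

lemma half_rpow_lt_one (hγ0 : 0 < γ) : (1/2 : ℝ) ^ γ < 1 :=
  Real.rpow_lt_one (by norm_num) (by norm_num) hγ0

lemma pow_le_wtSum {q : ℝ} (hq0 : 0 < q) (hq1 : q < 1) (s : ℕ) : q ^ s ≤ wtSum q s := by
  have h1 : 1 ≤ (1 - q)⁻¹ := (one_le_inv₀ (by linarith)).2 (by linarith)
  have h2 : 0 < q ^ s := by positivity
  have h3 : (0:ℝ) ≤ s := by positivity
  rw [wtSum]
  nlinarith

lemma opB_pos (hn : 0 < n) (hγ0 : 0 < γ) (s : ℕ) : 0 < opB n γ s := by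
  have h1 : 0 < ((1/2 : ℝ) ^ γ) ^ s := by positivity
  have h2 := pow_le_wtSum (by positivity) (half_rpow_lt_one hγ0) s
  have h3 := rhoC_pos hn hγ0
  rw [opB]
  have : 0 < wtSum ((1/2 : ℝ) ^ γ) s := h1.trans_le h2
  positivity

lemma IsNormalisedKernel.nrm_sum_pOp_le (hn : 0 < n) (hγ0 : 0 < γ) (hγ1 : γ ≤ 1)
    (hK : IsNormalisedKernel n γ K) (s : ℕ) (A : Finset ℤ) (hf : Nice f) :
    nrm (∑ k ∈ A, pOp K s k f) ≤ opB n γ s * nrm f := by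
  set q := (1/2 : ℝ) ^ γ with hq
  have hq0 : 0 < q := by positivity
  have hq1 : q < 1 := half_rpow_lt_one hγ0
  have hC := (rhoC_pos hn hγ0).le
  have hW := pow_le_wtSum hq0 hq1 s
  have hqs : 0 < q ^ s := by positivity
  refine (abs_le_of_sq_le_sq' ?_ (mul_nonneg (opB_pos hn hγ0 s).le nrm_nonneg)).2
  have hP := fun k => hK.nice_pOp hn hγ0 hγ1 s k hf
  have e : nrm (∑ k ∈ A, pOp K s k f) ^ 2 =
      ∑ k ∈ A, ∑ l ∈ A, ∫ x, pOp K s k f x * pOp K s l f x := by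
    rw [nrm_sq]
    simp only [Finset.sum_apply, Finset.sum_mul_sum]
    rw [integral_finsetSum _ fun k _ => integrable_finsetSum _ fun l _ => (hP k).mul (hP l)]
    exact Finset.sum_congr rfl fun k _ => integral_finsetSum _ fun l _ => (hP k).mul (hP l)
  rw [e]
  calc _ ≤ ∑ k ∈ A, ∑ l ∈ A, rhoC n γ ^ 2 * q ^ s * (wt q s (k - l).natAbs *
        (nrm (dyadicD n (k + s) f) * nrm (dyadicD n (l + s) f))) :=
      Finset.sum_le_sum fun k _ => Finset.sum_le_sum fun l _ =>
        (le_abs_self _).trans (hK.abs_integral_pOp_le hn hγ0 hγ1 s k l hf)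
    _ = rhoC n γ ^ 2 * q ^ s * ∑ k ∈ A, ∑ l ∈ A, wt q s (k - l).natAbs *
        (nrm (dyadicD n (k + s) f) * nrm (dyadicD n (l + s) f)) := by
      simp only [Finset.mul_sum]
    _ ≤ rhoC n γ ^ 2 * q ^ s * (wtSum q s * nrm f ^ 2) := by
      refine mul_le_mul_of_nonneg_left ?_ (by positivity)
      exact (sum_sum_wt_le hq0 hq1 s A _).trans (mul_le_mul_of_nonneg_left
        (hf.sum_nrm_dyadicD_sq_le s A) (hqs.le.trans hW))
    _ ≤ _ := by
      rw [opB, ← hq]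
      have h1 : q ^ s * wtSum q s ≤ 16 * (wtSum q s * wtSum q s) := by nlinarith
      have h2 : 0 ≤ rhoC n γ ^ 2 * nrm f ^ 2 := by positivity
      nlinarith [mul_le_mul_of_nonneg_left h1 h2]

lemma IsNormalisedKernel.integral_sum_pOp_mul (hn : 0 < n) (hγ0 : 0 < γ) (hγ1 : γ ≤ 1)
    (hK : IsNormalisedKernel n γ K) (s : ℕ) (A : Finset ℤ) (hf : Nice f) (hg : Nice g) :
    ∫ x, (∑ k ∈ A, pOp K s k f) x * g x = ∫ x, f x * (∑ k ∈ A, qOp (kerT K) s k g) x := by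
  simp only [Finset.sum_apply, Finset.sum_mul, Finset.mul_sum]
  rw [integral_finsetSum _ fun k _ => (hK.nice_pOp hn hγ0 hγ1 s k hf).mul hg,
    integral_finsetSum _ fun k _ => hf.mul (hK.transpose.nice_qOp hn hγ0 hγ1 s k hg)]
  exact Finset.sum_congr rfl fun k _ => hK.integral_pOp_mul hn hγ0 hγ1 s k hf hg

lemma IsNormalisedKernel.nrm_sum_qOp_le (hn : 0 < n) (hγ0 : 0 < γ) (hγ1 : γ ≤ 1)
    (hK : IsNormalisedKernel n γ K) (s : ℕ) (A : Finset ℤ) (hg : Nice g) :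
    nrm (∑ k ∈ A, qOp K s k g) ≤ opB n γ s * nrm g := by
  have hQ : Nice (∑ k ∈ A, qOp K s k g) := Nice.sum A fun k _ => hK.nice_qOp hn hγ0 hγ1 s k hg
  have hP : Nice (∑ k ∈ A, pOp (kerT K) s k (∑ k ∈ A, qOp K s k g)) :=
    Nice.sum A fun k _ => hK.transpose.nice_pOp hn hγ0 hγ1 s k hQ
  have h1 := hK.transpose.integral_sum_pOp_mul hn hγ0 hγ1 s A hQ hg
  have h2 := hK.transpose.nrm_sum_pOp_le hn hγ0 hγ1 s A hQ
  have h3 : nrm (∑ k ∈ A, qOp K s k g) ^ 2 ≤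
      opB n γ s * nrm (∑ k ∈ A, qOp K s k g) * nrm g := by
    rw [nrm_sq]
    refine (h1.symm.le.trans (le_abs_self _)).trans ((abs_integral_mul_le hP hg).trans ?_)
    exact mul_le_mul_of_nonneg_right h2 nrm_nonneg
  rcases (nrm_nonneg (f := ∑ k ∈ A, qOp K s k g)).eq_or_lt with h | h
  · rw [← h]
    exact mul_nonneg (opB_pos hn hγ0 s).le nrm_nonneg
  · nlinarith

end Operators

section Tail
variable {n : ℕ} {γ : ℝ} {K : (Fin n → ℝ) → (Fin n → ℝ) → ℝ} {s : ℕ} {b : (Fin n → ℝ) → ℝ}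

lemma IsNormalisedKernel.lintegral_wOp_le (hn : 0 < n) (hγ0 : 0 < γ) (hγ1 : γ ≤ 1)
    (hK : IsNormalisedKernel n γ K) (s : ℕ) (k : ℤ) (hb : Nice b) :
    ∫⁻ x, ‖wOp K s k b x‖ₑ ≤
      ENNReal.ofReal (rhoC n γ * ((1/2 : ℝ) ^ γ) ^ s) * (2 * ∫⁻ x, ‖b x‖ₑ) :=
  ((hK.maj_wOp hγ0 s k hb).lintegral_le (measurable_rho _ _) (hb.dyadicD _).measurable
    (lintegral_rho_le hn hγ0 hγ1 k s)).trans (mul_le_mul_right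
      (lintegral_enorm_dyadicD_le hb.measurable _) _)

lemma dyadicE_eq_zero_of_le (hb : Nice b) {k i : ℤ} (hki : k ≤ i) (hbi : dyadicE n i b = 0) :
    dyadicE n k b = 0 := by
  rw [← hb.dyadicE_dyadicE hki, hbi]
  funext x
  exact dyadicE_const k 0 x

lemma ofReal_mul_four {c : ℝ} {t : ENNReal} :
    2 * (ENNReal.ofReal c * (2 * t)) = ENNReal.ofReal (4 * c) * t := by
  rw [ENNReal.ofReal_mul (by norm_num)]
  norm_num
  ring

lemma ofReal_mul_four' {c : ℝ} {t : ENNReal} :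
    2 * (ENNReal.ofReal c * t) ≤ ENNReal.ofReal (4 * c) * t := by
  rw [ENNReal.ofReal_mul (by norm_num), ← mul_assoc]
  gcongr
  norm_num

/-- Off-diagonal `L¹` bound for `pOp`. -/
lemma IsNormalisedKernel.setLIntegral_pOp_le (hn : 0 < n) (hγ0 : 0 < γ) (hγ1 : γ ≤ 1)
    (hK : IsNormalisedKernel n γ K) (s : ℕ) (k i : ℤ) (hb : Nice b) (hbi : dyadicE n i b = 0)
    {S X : Set (Fin n → ℝ)} (hS : CubeInv i (· ∈ S)) (hX : CubeInv i (· ∈ X))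
    (hbS : ∀ y ∉ S, b y = 0) (hd : ∀ x ∈ X, ∀ y ∈ S, 5 * (2:ℝ) ^ (-i) < ‖x - y‖) :
    ∫⁻ x in X, ‖pOp K s k b x‖ₑ ≤
      ENNReal.ofReal (4 * (rhoC n γ * wt ((1/2 : ℝ) ^ γ) s (k - i).natAbs)) *
        ∫⁻ x, ‖b x‖ₑ := by
  set q := (1/2 : ℝ) ^ γ with hq
  have hq0 : 0 < q := by positivity
  have hq1 : q < 1 := half_rpow_lt_one hγ0
  have hC := (rhoC_pos hn hγ0).le
  have hw := (hK.nice_wOp hn hγ0 hγ1 s k hb).measurable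
  rcases lt_or_ge (k + s) i with h1 | h1
  · have : pOp K s k b = 0 := by
      have hz : dyadicD n (k + s) b = 0 := by
        rw [dyadicD_eq, dyadicE_eq_zero_of_le hb (by omega) hbi,
          dyadicE_eq_zero_of_le hb (by omega) hbi, sub_self]
      have hz2 : wOp K s k b = 0 := by
        funext x
        rw [wOp, hz, tOp_eq]
        simp
      rw [pOp, hz2, zero_sub, neg_eq_zero]
      funext x
      exact dyadicE_const k 0 x
    simp [this]
  rcases lt_or_ge k i with h2 | h2
  · have hwt : wt q s (k - i).natAbs = q ^ s :=
      min_eq_left (pow_le_pow_of_le_one hq0.le hq1.le (by omega))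
    rw [hwt]
    calc _ ≤ ∫⁻ x, ‖pOp K s k b x‖ₑ := setLIntegral_le_lintegral _ _
      _ ≤ 2 * ∫⁻ x, ‖wOp K s k b x‖ₑ := lintegral_enorm_sub_dyadicE_le hw k
      _ ≤ 2 * (ENNReal.ofReal (rhoC n γ * q ^ s) * (2 * ∫⁻ x, ‖b x‖ₑ)) :=
        mul_le_mul_right (hK.lintegral_wOp_le hn hγ0 hγ1 s k hb) _
      _ = _ := ofReal_mul_four
  · obtain ⟨d, rfl⟩ := Int.le.dest h2
    rw [show (i + d - i).natAbs = d by omega]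
    have hDS : ∀ y ∉ S, dyadicD n (i + d + s) b y = 0 := fun y hy => by
      rw [dyadicD_eq, Pi.sub_apply, dyadicE_eq_zero_of_notMem (hS.mono (by omega)) hbS y hy,
        dyadicE_eq_zero_of_notMem (hS.mono (by omega)) hbS y hy, sub_self]
    calc _ ≤ 2 * ∫⁻ x in X, ‖wOp K s (i + d) b x‖ₑ :=
        setLIntegral_enorm_sub_dyadicE_le hw (hX.mono (by omega))
      _ ≤ 2 * (ENNReal.ofReal (rhoC n γ * (q ^ s * q ^ d)) * (2 * ∫⁻ x, ‖b x‖ₑ)) := by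
        refine mul_le_mul_right (((hK.maj_wOp hγ0 s (i + d) hb).setLIntegral_le
          (measurable_rho _ _) (hb.dyadicD _).measurable hX.measurableSet hDS hd).trans ?_) _
        exact mul_le_mul' (lintegral_rho_tail_le hn hγ0 i d s)
          (lintegral_enorm_dyadicD_le hb.measurable _)
      _ = _ := ofReal_mul_four
      _ ≤ _ := by
        gcongr
        exact mul_pow_le_wt hq0.le hq1.le s d

/-- Off-diagonal `L¹` bound for `qOp`. -/
lemma IsNormalisedKernel.setLIntegral_qOp_le (hn : 0 < n) (hγ0 : 0 < γ) (hγ1 : γ ≤ 1)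
    (hK : IsNormalisedKernel n γ K) (s : ℕ) (k i : ℤ) (hb : Nice b) (hbi : dyadicE n i b = 0)
    {S X : Set (Fin n → ℝ)} (hS : CubeInv i (· ∈ S)) (hX : CubeInv i (· ∈ X))
    (hbS : ∀ y ∉ S, b y = 0) (hd : ∀ x ∈ X, ∀ y ∈ S, 5 * (2:ℝ) ^ (-i) < ‖x - y‖) :
    ∫⁻ x in X, ‖qOp K s k b x‖ₑ ≤
      ENNReal.ofReal (4 * (rhoC n γ * wt ((1/2 : ℝ) ^ γ) s (k - i).natAbs)) *
        ∫⁻ x, ‖b x‖ₑ := by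
  set q := (1/2 : ℝ) ^ γ with hq
  have hq0 : 0 < q := by positivity
  have hq1 : q < 1 := half_rpow_lt_one hγ0
  have hC := (rhoC_pos hn hγ0).le
  have hh := hb.sub (hb.dyadicE k)
  have hV := hK.nice_tOp_sub_dyadicE hn hγ0 hγ1 s k hh
  have hmaj := hK.maj_sub_tOp hγ0 (k := k) (j := k + s) (by omega) hh
  rcases lt_or_ge k i with h2 | h2
  · obtain ⟨d, rfl⟩ := Int.le.dest h2.le
    rw [show (k - (k + d)).natAbs = d by omega]
    have hbk : b - dyadicE n k b = b := by
      rw [dyadicE_eq_zero_of_le hb h2.le hbi, sub_zero]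
    refine (setLIntegral_le_lintegral _ _).trans ?_
    rw [wt]
    rcases min_choice (q ^ s) (q ^ d) with h | h <;> rw [h]
    · rw [hK.qOp_eq hγ0 s k hb]
      refine (lintegral_enorm_dyadicD_le hV.measurable _).trans ?_
      refine le_trans (mul_le_mul_right ?_ _) ofReal_mul_four'
      rw [hbk] at hmaj ⊢
      exact hmaj.lintegral_le (measurable_rho _ _) hb.measurable
        (lintegral_rho_le hn hγ0 hγ1 k s)
    · have hm := hK.maj_tOp_sub hγ0 h2.le hb
      rw [hbi, sub_zero] at hm
      rw [qOp, hbk]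
      refine (lintegral_enorm_dyadicD_le (hK.bddMeas_tOp hγ0 k hb).1 _).trans ?_
      refine le_trans (mul_le_mul_right ?_ _) ofReal_mul_four'
      exact hm.lintegral_le (measurable_rho _ _) hb.measurable (lintegral_rho_le hn hγ0 hγ1 k d)
  · obtain ⟨d, rfl⟩ := Int.le.dest h2
    rw [show (i + d - i).natAbs = d by omega]
    have hhS : ∀ y ∉ S, (b - dyadicE n (i + d) b) y = 0 := fun y hy => by
      rw [Pi.sub_apply, dyadicE_eq_zero_of_notMem (hS.mono (by omega)) hbS y hy, hbS y hy, sub_self]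
    rw [hK.qOp_eq hγ0 s _ hb]
    refine (setLIntegral_enorm_dyadicD_le hV.measurable (hX.mono (by omega))).trans ?_
    calc
      _ ≤ 2 * (ENNReal.ofReal (rhoC n γ * (q ^ s * q ^ d)) * (2 * ∫⁻ x, ‖b x‖ₑ)) := by
        refine mul_le_mul_right ((hmaj.setLIntegral_le (measurable_rho _ _) hh.measurable
          hX.measurableSet hhS hd).trans ?_) _
        exact mul_le_mul' (lintegral_rho_tail_le hn hγ0 i d s)
          (lintegral_enorm_sub_dyadicE_le hb.measurable _)
      _ = _ := ofReal_mul_four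
      _ ≤ _ := by
        gcongr
        exact mul_pow_le_wt hq0.le hq1.le s d

/-- Off-diagonal `L¹` bounds with a summable weight add up. -/
lemma setLIntegral_sum_le (hn : 0 < n) (hγ0 : 0 < γ) {A : Finset ℤ} {i : ℤ} {X : Set (Fin n → ℝ)}
    {u : ℤ → (Fin n → ℝ) → ℝ} (hu : ∀ k ∈ A, Measurable (u k)) {t : ENNReal}
    (h : ∀ k ∈ A, ∫⁻ x in X, ‖u k x‖ₑ ≤
      ENNReal.ofReal (4 * (rhoC n γ * wt ((1/2 : ℝ) ^ γ) s (k - i).natAbs)) * t) :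
    ∫⁻ x in X, ‖(∑ k ∈ A, u k) x‖ₑ ≤ ENNReal.ofReal (opB n γ s) * t := by
  have hq0 : 0 < (1/2 : ℝ) ^ γ := by positivity
  have hC := (rhoC_pos hn hγ0).le
  calc _ ≤ ∫⁻ x in X, ∑ k ∈ A, ‖u k x‖ₑ := lintegral_mono fun x => by
        rw [Finset.sum_apply]; exact enorm_sum_le _ _
    _ = ∑ k ∈ A, ∫⁻ x in X, ‖u k x‖ₑ := lintegral_finsetSum' _ fun k hk =>
        (hu k hk).enorm.aemeasurable
    _ ≤ ∑ k ∈ A, ENNReal.ofReal (4 * (rhoC n γ * wt ((1/2 : ℝ) ^ γ) s (k - i).natAbs)) * t :=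
        Finset.sum_le_sum h
    _ = ENNReal.ofReal (4 * rhoC n γ * ∑ k ∈ A, wt ((1/2 : ℝ) ^ γ) s (k - i).natAbs) * t := by
        rw [← Finset.sum_mul, ← ENNReal.ofReal_sum_of_nonneg fun k _ =>
          mul_nonneg (by norm_num) (mul_nonneg hC (wt_nonneg hq0.le _ _)), Finset.mul_sum]
        simp only [mul_assoc]
    _ ≤ _ := by
        rw [opB]
        gcongr
        exact sum_wt_le hq0 (half_rpow_lt_one hγ0) s A i

end Tail

/-- The hypotheses of the Calderón–Zygmund argument, adapted to dyadic cubes. -/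
structure DyadicCZ (n : ℕ) (B : ℝ) (P : ((Fin n → ℝ) → ℝ) → (Fin n → ℝ) → ℝ) : Prop where
  nice : ∀ f, Nice f → Nice (P f)
  add : ∀ f g, Nice f → Nice g → P (f + g) = P f + P g
  nrm_le : ∀ f, Nice f → nrm (P f) ≤ B * nrm f
  tail : ∀ (i : ℤ) (b : (Fin n → ℝ) → ℝ) (S X : Set (Fin n → ℝ)), Nice b → dyadicE n i b = 0 →
    CubeInv i (· ∈ S) → CubeInv i (· ∈ X) → (∀ y ∉ S, b y = 0) →
    (∀ x ∈ X, ∀ y ∈ S, 5 * (2:ℝ) ^ (-i) < ‖x - y‖) →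
    ∫⁻ x in X, ‖P b x‖ₑ ≤ ENNReal.ofReal B * ∫⁻ x, ‖b x‖ₑ

section Instances
variable {n : ℕ} {γ : ℝ} {K : (Fin n → ℝ) → (Fin n → ℝ) → ℝ}

lemma IsNormalisedKernel.dyadicCZ_pOp (hn : 0 < n) (hγ0 : 0 < γ) (hγ1 : γ ≤ 1)
    (hK : IsNormalisedKernel n γ K) (s : ℕ) (A : Finset ℤ) :
    DyadicCZ n (opB n γ s) (fun f => ∑ k ∈ A, pOp K s k f) where
  nice f hf := Nice.sum A fun k _ => hK.nice_pOp hn hγ0 hγ1 s k hf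
  add f g hf hg := by
    rw [← Finset.sum_add_distrib]
    exact Finset.sum_congr rfl fun k _ => hK.pOp_add hn hγ0 hγ1 s k hf hg
  nrm_le f hf := hK.nrm_sum_pOp_le hn hγ0 hγ1 s A hf
  tail i b S X hb hbi hS hX hbS hd := setLIntegral_sum_le hn hγ0
    (fun k _ => (hK.nice_pOp hn hγ0 hγ1 s k hb).measurable)
    fun k _ => hK.setLIntegral_pOp_le hn hγ0 hγ1 s k i hb hbi hS hX hbS hd

lemma IsNormalisedKernel.dyadicCZ_qOp (hn : 0 < n) (hγ0 : 0 < γ) (hγ1 : γ ≤ 1)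
    (hK : IsNormalisedKernel n γ K) (s : ℕ) (A : Finset ℤ) :
    DyadicCZ n (opB n γ s) (fun f => ∑ k ∈ A, qOp K s k f) where
  nice f hf := Nice.sum A fun k _ => hK.nice_qOp hn hγ0 hγ1 s k hf
  add f g hf hg := by
    rw [← Finset.sum_add_distrib]
    exact Finset.sum_congr rfl fun k _ => hK.qOp_add hγ0 s k hf hg
  nrm_le f hf := hK.nrm_sum_qOp_le hn hγ0 hγ1 s A hf
  tail i b S X hb hbi hS hX hbS hd := setLIntegral_sum_le hn hγ0
    (fun k _ => (hK.nice_qOp hn hγ0 hγ1 s k hb).measurable)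
    fun k _ => hK.setLIntegral_qOp_le hn hγ0 hγ1 s k i hb hbi hS hX hbS hd

end Instances

section Stopping
variable {n : ℕ} {f : (Fin n → ℝ) → ℝ} {t : ℝ}

lemma Nice.abs (hf : Nice f) : Nice (fun x => |f x|) := by
  obtain ⟨⟨hm, M, hM⟩, hi⟩ := hf
  exact ⟨⟨hm.abs, M, fun x => by simpa using hM x⟩, hi.abs⟩

/-- The union of the maximal cubes of generation `j` on which the mean of `|f|` exceeds `t`. -/
def stopSet {n : ℕ} (f : (Fin n → ℝ) → ℝ) (t : ℝ) (j : ℤ) : Set (Fin n → ℝ) :=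
  {x | t < dyadicE n j (fun y => |f y|) x ∧ ∀ i < j, dyadicE n i (fun y => |f y|) x ≤ t}

lemma mem_stopSet {j : ℤ} {x : Fin n → ℝ} : x ∈ stopSet f t j ↔
    t < dyadicE n j (fun y => |f y|) x ∧ ∀ i < j, dyadicE n i (fun y => |f y|) x ≤ t := Iff.rfl

lemma cubeInv_stopSet (j : ℤ) : CubeInv j (· ∈ stopSet f t j) := by
  intro x y hxy
  have h : ∀ i ≤ j, dyadicE n i (fun y => |f y|) x = dyadicE n i (fun y => |f y|) y := fun i hi =>
    ((cubeInv_dyadicE i _).mono hi) x y hxy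
  simp only [mem_stopSet, eq_iff_iff]
  rw [h j le_rfl]
  exact and_congr_right fun _ => forall₂_congr fun i hi => by rw [h i hi.le]

lemma measurableSet_stopSet (j : ℤ) : MeasurableSet (stopSet f t j) :=
  (cubeInv_stopSet j).measurableSet

lemma stopSet_inj {i j : ℤ} {x : Fin n → ℝ} (hi : x ∈ stopSet f t i) (hj : x ∈ stopSet f t j) :
    i = j := by
  rcases lt_trichotomy i j with h | h | h
  · exact absurd (hj.2 i h) (not_le.2 hi.1)
  · exact h
  · exact absurd (hi.2 j h) (not_le.2 hj.1)

lemma disjoint_stopSet : Pairwise (Function.onFun Disjoint (stopSet f t)) := fun _ _ hij =>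
  Set.disjoint_left.2 fun _ hi hj => hij (stopSet_inj hi hj)

lemma ofReal_mul_volume_stopSet_le (hf : Nice f) (j : ℤ) :
    ENNReal.ofReal t * volume (stopSet f t j) ≤ ∫⁻ x in stopSet f t j, ‖f x‖ₑ := by
  calc _ = ∫⁻ x in stopSet f t j, ENNReal.ofReal t := (setLIntegral_const _ _).symm
    _ ≤ ∫⁻ x in stopSet f t j, ‖dyadicE n j (fun y => |f y|) x‖ₑ := by
      refine setLIntegral_mono (measurable_dyadicE _ _).enorm fun x hx => ?_
      rw [Real.enorm_eq_ofReal_abs]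
      exact ENNReal.ofReal_le_ofReal (hx.1.le.trans (le_abs_self _))
    _ ≤ ∫⁻ x in stopSet f t j, ‖|f x|‖ₑ :=
      setLIntegral_enorm_dyadicE_le hf.abs.measurable (cubeInv_stopSet j)
    _ = _ := by simp

lemma abs_dyadicE_le_of_mem_stopSet (hf : Nice f) {j : ℤ} {x : Fin n → ℝ}
    (hx : x ∈ stopSet f t j) : |dyadicE n j f x| ≤ 2 ^ n * t := by
  refine (abs_dyadicE_le _ _ _).trans ?_
  have h1 := hx.2 (j - 1) (by omega)
  refine le_trans ?_ (mul_le_mul_of_nonneg_left h1 (by positivity))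
  rw [dyadicE_eq, dyadicE_eq, ← mul_assoc]
  have e : (2:ℝ) ^ n * 2 ^ ((j - 1) * (n:ℤ)) = 2 ^ (j * (n:ℤ)) := by
    rw [← zpow_natCast, ← zpow_add₀ (by norm_num)]
    congr 1; ring
  rw [e]
  refine mul_le_mul_of_nonneg_left (setIntegral_mono_set (hf.abs.1.cubeLoc _ _)
    (Filter.Eventually.of_forall fun y => abs_nonneg _) ?_) (by positivity)
  refine Filter.Eventually.of_forall fun y hy => ?_
  rw [dyadicCube_eq] at hy ⊢
  exact cubeIdx_eq_of_le (by omega) hy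

lemma exists_mem_stopSet (hn : 0 < n) (hf : Nice f) (ht : 0 < t) {j : ℤ} {x : Fin n → ℝ}
    (hx : t < dyadicE n j (fun y => |f y|) x) : ∃ i, x ∈ stopSet f t i := by
  have hbd : ∃ b : ℤ, ∀ z : ℤ, t < dyadicE n z (fun y => |f y|) x → b ≤ z := by
    set I := ∫ y, |f y| with hI
    have hI0 : 0 ≤ I := integral_nonneg fun _ => abs_nonneg _
    obtain ⟨m, hm⟩ := pow_unbounded_of_one_lt (I / t) (by norm_num : (1:ℝ) < 2)
    refine ⟨-m, fun z hz => ?_⟩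
    by_contra hlt
    push Not at hlt
    have h1 : dyadicE n z (fun y => |f y|) x ≤ 2 ^ (z * (n:ℤ)) * I := by
      rw [dyadicE_eq]
      refine mul_le_mul_of_nonneg_left (setIntegral_le_integral hf.2.abs
        (Filter.Eventually.of_forall fun y => abs_nonneg _)) (by positivity)
    have h2 : (2:ℝ) ^ (z * (n:ℤ)) ≤ 2 ^ (-(m:ℤ)) := by
      refine zpow_le_zpow_right₀ (by norm_num) ?_
      have : (1:ℤ) ≤ n := by exact_mod_cast hn
      nlinarith
    have h3 : (2:ℝ) ^ (-(m:ℤ)) * I ≤ t := by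
      rw [zpow_neg, zpow_natCast, inv_mul_le_iff₀ (by positivity)]
      rw [div_lt_iff₀ ht] at hm
      exact hm.le
    have := mul_le_mul_of_nonneg_right h2 hI0
    linarith
  obtain ⟨i, hi, hmin⟩ := Int.exists_least_of_bdd hbd ⟨j, hx⟩
  exact ⟨i, hi, fun k hk => not_lt.1 fun h => absurd (hmin k h) (by omega)⟩

/-- The enlargement of a set at scale `2^{-j}`, made `j`-invariant. -/
def starSet {n : ℕ} (j : ℤ) (S : Set (Fin n → ℝ)) : Set (Fin n → ℝ) :=
  {x | ∃ x', cubeIdx j x' = cubeIdx j x ∧ ∃ y ∈ S, ‖x' - y‖ ≤ 5 * (2:ℝ) ^ (-j)}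

lemma cubeInv_starSet (j : ℤ) (S : Set (Fin n → ℝ)) : CubeInv j (· ∈ starSet j S) := by
  intro x y hxy
  simp only [starSet, Set.mem_ofPred_eq, hxy]

lemma lt_norm_of_notMem_starSet {j : ℤ} {S : Set (Fin n → ℝ)} :
    ∀ x ∈ (starSet j S)ᶜ, ∀ y ∈ S, 5 * (2:ℝ) ^ (-j) < ‖x - y‖ := fun x hx y hy =>
  not_le.1 fun h => hx ⟨x, rfl, y, hy, h⟩

lemma volume_starSet_le {j : ℤ} {S : Set (Fin n → ℝ)} (hS : CubeInv j (· ∈ S)) :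
    volume (starSet j S) ≤ 14 ^ n * volume S := by
  have hmS := hS.measurableSet
  have hmT := (cubeInv_starSet j S).measurableSet
  set r : ℝ := (2:ℝ) ^ (-j) with hr
  have hr0 : 0 < r := by positivity
  let φ : ℝ → ℝ := (Set.Iio (7 * r)).indicator fun _ => (2:ℝ) ^ (j * (n:ℤ))
  have hφ : Measurable φ := measurable_const.indicator measurableSet_Iio
  have hI : ∫⁻ z : Fin n → ℝ, ENNReal.ofReal (φ ‖z‖) ≤ 14 ^ n := by
    have e : ∀ z : Fin n → ℝ, ENNReal.ofReal (φ ‖z‖) = (Metric.ball (0 : Fin n → ℝ) (7 * r)).indicator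
        (fun _ => ENNReal.ofReal ((2:ℝ) ^ (j * (n:ℤ)))) z := fun z => by
      by_cases h : ‖z‖ < 7 * r <;> simp [φ, Set.indicator, h]
    simp only [e]
    rw [lintegral_indicator_const measurableSet_ball, Real.volume_pi_ball _ (by positivity),
      ← ENNReal.ofReal_mul (by positivity), Fintype.card_fin]
    refine (ENNReal.ofReal_le_ofReal (q := 14 ^ n) (le_of_eq ?_)).trans (by
      rw [ENNReal.ofReal_pow (by norm_num)]; norm_num)
    rw [show 2 * (7 * r) = 14 * r by ring, mul_pow, hr, ← zpow_natCast ((2:ℝ) ^ (-j)), ← zpow_mul,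
      mul_left_comm, ← zpow_add₀ (by norm_num)]
    norm_num
  have hmaj : Maj φ ((starSet j S).indicator 1) (S.indicator 1) := by
    intro x
    by_cases hx : x ∈ starSet j S
    · obtain ⟨x', hx', y, hy, hxy⟩ := hx
      have h1 : ∀ z ∈ dyadicCube n j (cubeIdx j y), z ∈ S ∧ ‖x - z‖ < 7 * r := by
        intro z hz
        rw [dyadicCube_eq] at hz
        refine ⟨(hS z y hz).mpr hy, ?_⟩
        have h2 := dist_lt_of_cubeIdx_eq hx'
        have h3 := dist_lt_of_cubeIdx_eq (Eq.symm hz)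
        rw [← dist_eq_norm] at hxy ⊢
        have h4 := dist_triangle4 x x' y z
        rw [dist_comm x x'] at h4
        linarith
      calc _ = (1 : ENNReal) := by simp [Set.indicator_of_mem (show x ∈ starSet j S from ⟨x', hx', y, hy, hxy⟩)]
        _ = ENNReal.ofReal ((2:ℝ) ^ (j * (n:ℤ))) * volume (dyadicCube n j (cubeIdx j y)) := by
          rw [volume_dyadicCube, ← ENNReal.ofReal_mul (by positivity), zpow_neg,
            mul_inv_cancel₀ (by positivity), ENNReal.ofReal_one]
        _ = ∫⁻ z in dyadicCube n j (cubeIdx j y), ENNReal.ofReal ((2:ℝ) ^ (j * (n:ℤ))) :=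
          (setLIntegral_const _ _).symm
        _ = ∫⁻ z in dyadicCube n j (cubeIdx j y), ENNReal.ofReal (φ ‖x - z‖) *
            ‖S.indicator (1 : (Fin n → ℝ) → ℝ) z‖ₑ := by
          refine setLIntegral_congr_fun (measurableSet_dyadicCube _ _) fun z hz => ?_
          simp [φ, Set.indicator, (h1 z hz).1, (h1 z hz).2]
        _ ≤ _ := setLIntegral_le_lintegral _ _
    · simp [Set.indicator_of_notMem hx]
  have := hmaj.lintegral_le hφ (measurable_one.indicator hmS) hI
  simpa [enorm_indicator_eq_indicator_enorm, lintegral_indicator hmS,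
    lintegral_indicator hmT] using this

end Stopping

section Weak
variable {n : ℕ} {f : (Fin n → ℝ) → ℝ} {t B : ℝ} {P : ((Fin n → ℝ) → ℝ) → (Fin n → ℝ) → ℝ}

lemma dyadicCube_ae_eq_closedBall (k : ℤ) (m : Fin n → ℤ) :
    dyadicCube n k m =ᵐ[volume]
      Metric.closedBall (cubeCenter n k m) ((2:ℝ) ^ (-k) / 2) := by
  have h0 : (0:ℝ) < 2 ^ (-k) := by positivity
  rw [dyadicCube_eq_pi]
  refine (Measure.univ_pi_Ico_ae_eq_Icc (μ := fun _ : Fin n => (volume : Measure ℝ))).trans ?_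
  rw [closedBall_pi _ (by positivity), ← Set.pi_univ_Icc]
  refine Filter.EventuallyEq.of_eq ?_
  congr 1
  ext i x
  simp only [Real.closedBall_eq_Icc, cubeCenter, Set.mem_Icc]
  constructor <;> rintro ⟨h1, h2⟩ <;> constructor <;> linarith

lemma dyadicE_eq_average (k : ℤ) (f : (Fin n → ℝ) → ℝ) (x : Fin n → ℝ) :
    dyadicE n k f x = ⨍ y in Metric.closedBall (cubeCenter n k (cubeIdx k x)) ((2:ℝ) ^ (-k) / 2),
      f y := by
  have h := dyadicCube_ae_eq_closedBall (n := n) k (cubeIdx k x)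
  rw [setAverage_eq, ← setIntegral_congr_set h, measureReal_congr h.symm, measureReal_def,
    volume_dyadicCube, ENNReal.toReal_ofReal (by positivity), zpow_neg, inv_inv, smul_eq_mul,
    dyadicE_eq]

lemma ae_tendsto_dyadicE (hf : LocallyIntegrable f) :
    ∀ᵐ x, Filter.Tendsto (fun k : ℕ => dyadicE n k f x) Filter.atTop (nhds (f x)) := by
  filter_upwards [IsUnifLocDoublingMeasure.ae_tendsto_average volume hf 1] with x hx
  simp only [dyadicE_eq_average]
  refine hx _ _ ?_ ?_
  · refine tendsto_nhdsWithin_iff.2 ⟨?_, Filter.Eventually.of_forall fun k => ?_⟩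
    · have := (tendsto_pow_atTop_nhds_zero_of_lt_one (r := (1 / 2 : ℝ)) (by norm_num)
        (by norm_num)).div_const 2
      simpa using this
    · exact Set.mem_Ioi.2 (by positivity)
  · refine Filter.Eventually.of_forall fun k => ?_
    have h0 : (0:ℝ) < 2 ^ (-(k:ℤ)) := by positivity
    have hx := (mem_dyadicCube_iff (k:ℤ) (cubeIdx k x) x).2 rfl
    rw [Metric.mem_closedBall, dist_pi_le_iff (by positivity)]
    intro i
    have := hx i
    rw [Real.dist_eq, abs_le, cubeCenter]
    constructor <;> linarith

lemma ae_abs_le_of_notMem_stopSet (hn : 0 < n) (hf : Nice f) (ht : 0 < t) :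
    ∀ᵐ x, x ∉ ⋃ j, stopSet f t j → |f x| ≤ t := by
  filter_upwards [ae_tendsto_dyadicE hf.abs.2.locallyIntegrable] with x hx hxt
  refine le_of_tendsto hx (Filter.Eventually.of_forall fun k => ?_)
  by_contra h
  exact hxt (Set.mem_iUnion.2 (exists_mem_stopSet hn hf ht (not_le.1 h)))

lemma setLIntegral_iUnion_stopSet (f g : (Fin n → ℝ) → ℝ) (t : ℝ) :
    ∫⁻ x in ⋃ j, stopSet f t j, ‖g x‖ₑ = ∑' j, ∫⁻ x in stopSet f t j, ‖g x‖ₑ :=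
  lintegral_iUnion measurableSet_stopSet disjoint_stopSet _

lemma ofReal_mul_volume_iUnion_stopSet_le (hf : Nice f) :
    ENNReal.ofReal t * volume (⋃ j, stopSet f t j) ≤ ∫⁻ x in ⋃ j, stopSet f t j, ‖f x‖ₑ := by
  rw [setLIntegral_iUnion_stopSet, measure_iUnion disjoint_stopSet measurableSet_stopSet,
    ← ENNReal.tsum_mul_left]
  exact ENNReal.tsum_le_tsum fun j => ofReal_mul_volume_stopSet_le hf j

lemma setLIntegral_iUnion_stopSet_le (hf : Nice f) (ht : 0 < t) :
    ENNReal.ofReal t * volume (⋃ j, stopSet f t j) ≤ 2 * ∫⁻ x in {x | t / 2 < |f x|}, ‖f x‖ₑ ∧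
    ∫⁻ x in ⋃ j, stopSet f t j, ‖f x‖ₑ ≤ 2 * ∫⁻ x in {x | t / 2 < |f x|}, ‖f x‖ₑ := by
  set Ω := ⋃ j, stopSet f t j with hΩ
  have hm : MeasurableSet Ω := .iUnion measurableSet_stopSet
  have hm2 : MeasurableSet {x | t / 2 < |f x|} :=
    measurableSet_lt measurable_const hf.abs.measurable
  set Φ := ∫⁻ x in {x | t / 2 < |f x|}, ‖f x‖ₑ
  have h1 : ENNReal.ofReal t * volume Ω ≤ ∫⁻ x in Ω, ‖f x‖ₑ :=
    ofReal_mul_volume_iUnion_stopSet_le hf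
  have hfin : ∫⁻ x in Ω, ‖f x‖ₑ ≠ ⊤ :=
    ((setLIntegral_le_lintegral _ _).trans_lt hf.2.2).ne
  have h2 : ∫⁻ x in Ω, ‖f x‖ₑ ≤ Φ + ENNReal.ofReal (t / 2) * volume Ω := by
    calc _ ≤ ∫⁻ x in Ω, (({x | t / 2 < |f x|}.indicator (fun x => ‖f x‖ₑ) x) +
          ENNReal.ofReal (t / 2)) := by
          refine lintegral_mono fun x => ?_
          by_cases hx : t / 2 < |f x|
          · rw [Set.indicator_of_mem (show x ∈ {x | t / 2 < |f x|} from hx)]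
            exact le_self_add
          · rw [Set.indicator_of_notMem (show x ∉ {x | t / 2 < |f x|} from hx), zero_add,
              Real.enorm_eq_ofReal_abs]
            exact ENNReal.ofReal_le_ofReal (not_lt.1 hx)
      _ ≤ _ := by
          rw [lintegral_add_right _ measurable_const, setLIntegral_const]
          refine add_le_add ((setLIntegral_le_lintegral _ _).trans ?_) le_rfl
          rw [lintegral_indicator hm2]
  have e : ENNReal.ofReal t * volume Ω = ENNReal.ofReal (t / 2) * volume Ω +
      ENNReal.ofReal (t / 2) * volume Ω := by
    rw [← add_mul, ← ENNReal.ofReal_add (by positivity) (by positivity), add_halves]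
  have h3 : ENNReal.ofReal (t / 2) * volume Ω ≤ Φ := by
    have hf2 : ENNReal.ofReal (t / 2) * volume Ω ≠ ⊤ := by
      refine ne_top_of_le_ne_top hfin (le_trans ?_ h1)
      rw [e]; exact le_self_add
    have := h1.trans h2
    rw [e] at this
    exact (ENNReal.add_le_add_iff_right hf2).1 this
  rw [two_mul]
  exact ⟨e.le.trans (add_le_add h3 h3), h2.trans (add_le_add le_rfl h3)⟩

lemma DyadicCZ.map_sum (hP : DyadicCZ n B P) (A : Finset ℤ) {u : ℤ → (Fin n → ℝ) → ℝ}
    (hu : ∀ j, Nice (u j)) : P (∑ j ∈ A, u j) = ∑ j ∈ A, P (u j) := by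
  classical
  induction A using Finset.induction_on with
  | empty =>
    have := hP.add 0 0 Nice.zero Nice.zero
    simpa using this
  | insert a A ha ih =>
    rw [Finset.sum_insert ha, Finset.sum_insert ha, hP.add _ _ (hu a) (Nice.sum A fun j _ => hu j),
      ih]

/-- The oscillating piece of generation `j` in the Calderón–Zygmund decomposition. -/
def badPart {n : ℕ} (f : (Fin n → ℝ) → ℝ) (t : ℝ) (j : ℤ) : (Fin n → ℝ) → ℝ :=
  (stopSet f t j).indicator (f - dyadicE n j f)

lemma Nice.badPart (hf : Nice f) (j : ℤ) : Nice (badPart f t j) :=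
  (hf.sub (hf.dyadicE j)).indicator (measurableSet_stopSet j)

lemma Nice.dyadicE_badPart (hf : Nice f) (j : ℤ) : _root_.dyadicE n j (_root_.badPart f t j) = 0 := by
  rw [_root_.badPart, dyadicE_indicator (cubeInv_stopSet j), hf.dyadicE_sub (hf.dyadicE j),
    hf.dyadicE_dyadicE le_rfl, sub_self, Set.indicator_zero']

lemma lintegral_enorm_badPart_le (hf : Nice f) (j : ℤ) :
    ∫⁻ x, ‖badPart f t j x‖ₑ ≤ 2 * ∫⁻ x in stopSet f t j, ‖f x‖ₑ := by
  simp only [badPart, enorm_indicator_eq_indicator_enorm]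
  rw [lintegral_indicator (measurableSet_stopSet j)]
  exact setLIntegral_enorm_sub_dyadicE_le hf.measurable (cubeInv_stopSet j)

lemma sub_sum_badPart_of_mem {A : Finset ℤ} {j : ℤ} (hj : j ∈ A) {x : Fin n → ℝ}
    (hx : x ∈ stopSet f t j) : (f - ∑ i ∈ A, badPart f t i) x = dyadicE n j f x := by
  rw [Pi.sub_apply, Finset.sum_apply, Finset.sum_eq_single_of_mem j hj]
  · simp [badPart, Set.indicator_of_mem hx]
  · exact fun i _ hij => Set.indicator_of_notMem (fun hi => hij (stopSet_inj hi hx)) _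

lemma sub_sum_badPart_of_notMem {A : Finset ℤ} {x : Fin n → ℝ}
    (hx : ∀ j ∈ A, x ∉ stopSet f t j) : (f - ∑ i ∈ A, badPart f t i) x = f x := by
  rw [Pi.sub_apply, Finset.sum_apply, Finset.sum_eq_zero, sub_zero]
  exact fun i hi => Set.indicator_of_notMem (hx i hi) _

lemma lintegral_sq_sub_sum_badPart_le (hf : Nice f) (A : Finset ℤ) :
    ∫⁻ x, ‖(f - ∑ i ∈ A, badPart f t i) x‖ₑ ^ 2 ≤
      (∫⁻ x in (⋃ j ∈ A, stopSet f t j)ᶜ, ‖f x‖ₑ ^ 2) +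
        4 ^ n * ENNReal.ofReal t ^ 2 * volume (⋃ j, stopSet f t j) := by
  have hm : MeasurableSet (⋃ j ∈ A, stopSet f t j) :=
    A.measurableSet_biUnion fun j _ => measurableSet_stopSet j
  rw [← lintegral_add_compl _ hm, add_comm]
  refine add_le_add (le_of_eq (setLIntegral_congr_fun hm.compl fun x hx => ?_)) ?_
  · have : ∀ j ∈ A, x ∉ stopSet f t j := by simpa using hx
    simp only [sub_sum_badPart_of_notMem this]
  · calc _ ≤ ∫⁻ x in ⋃ j ∈ A, stopSet f t j, 4 ^ n * ENNReal.ofReal t ^ 2 := by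
          refine setLIntegral_mono measurable_const fun x hx => ?_
          simp only [Set.mem_iUnion, exists_prop] at hx
          obtain ⟨j, hj, hx⟩ := hx
          rw [sub_sum_badPart_of_mem hj hx, Real.enorm_eq_ofReal_abs]
          refine (pow_le_pow_left₀ (zero_le) (ENNReal.ofReal_le_ofReal
            (abs_dyadicE_le_of_mem_stopSet hf hx)) 2).trans (le_of_eq ?_)
          rw [ENNReal.ofReal_mul (by positivity), mul_pow, ENNReal.ofReal_pow (by norm_num),
            ← pow_mul, mul_comm n, pow_mul]
          norm_num
      _ ≤ _ := by
          rw [setLIntegral_const]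
          exact mul_le_mul_right (measure_mono (Set.iUnion₂_subset_iUnion _ _)) _

lemma DyadicCZ.weak_aux (hP : DyadicCZ n B P) (hB : 0 < B) (hf : Nice f) (ht : 0 < t)
    (A : Finset ℤ) :
    volume {x | 2 * (B * t) < |P f x|} ≤
      (ENNReal.ofReal t ^ 2)⁻¹ * (∫⁻ x in (⋃ j ∈ A, stopSet f t j)ᶜ, ‖f x‖ₑ ^ 2) +
      4 ^ n * volume (⋃ j, stopSet f t j) + 14 ^ n * volume (⋃ j, stopSet f t j) +
      (ENNReal.ofReal t)⁻¹ * (2 * ∫⁻ x in ⋃ j, stopSet f t j, ‖f x‖ₑ) := by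
  set V := volume (⋃ j, stopSet f t j)
  set T := ENNReal.ofReal t with hT
  have hT0 : T ≠ 0 := by simpa [hT] using ht
  have hTt : T ≠ ⊤ := ENNReal.ofReal_ne_top
  set β := ENNReal.ofReal B with hβ
  have hβ0 : β ≠ 0 := by simpa [hβ] using hB
  have hβt : β ≠ ⊤ := ENNReal.ofReal_ne_top
  set b := badPart f t
  have hb : ∀ j, Nice (b j) := fun j => hf.badPart j
  set g := f - ∑ j ∈ A, b j with hg
  have hgn : Nice g := hf.sub (Nice.sum A fun j _ => hb j)
  set X := (⋃ j, starSet j (stopSet f t j)) with hX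
  have hXm : MeasurableSet X := .iUnion fun j => (cubeInv_starSet j _).measurableSet
  have hsplit : P f = P g + ∑ j ∈ A, P (b j) := by
    rw [← hP.map_sum A hb, ← hP.add _ _ hgn (Nice.sum A fun j _ => hb j), hg, sub_add_cancel]
  have hsub : {x | 2 * (B * t) < |P f x|} ⊆
      ({x | β * T ≤ ‖P g x‖ₑ} ∪ X) ∪ {x | β * T ≤ Xᶜ.indicator
        (fun x => ‖(∑ j ∈ A, P (b j)) x‖ₑ) x} := by
    intro x hx
    by_cases hxX : x ∈ X
    · exact Or.inl (Or.inr hxX)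
    simp only [Set.mem_union, Set.mem_ofPred_eq, hxX, or_false] at hx ⊢
    rw [Set.indicator_of_mem (show x ∈ Xᶜ from hxX), Real.enorm_eq_ofReal_abs,
      Real.enorm_eq_ofReal_abs, hβ, hT, ← ENNReal.ofReal_mul hB.le]
    by_contra hcon
    rw [not_or] at hcon
    have h1 : |P g x| ≤ B * t := not_lt.1 fun h => hcon.1 (ENNReal.ofReal_le_ofReal h.le)
    have h2 : |(∑ j ∈ A, P (b j)) x| ≤ B * t :=
      not_lt.1 fun h => hcon.2 (ENNReal.ofReal_le_ofReal h.le)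
    rw [hsplit, Pi.add_apply] at hx
    have := abs_add_le (P g x) ((∑ j ∈ A, P (b j)) x)
    linarith
  have c1 : volume {x | β * T ≤ ‖P g x‖ₑ} ≤ (T ^ 2)⁻¹ *
      (∫⁻ x in (⋃ j ∈ A, stopSet f t j)ᶜ, ‖f x‖ₑ ^ 2) + 4 ^ n * V := by
    have h1 : (β * T) ^ 2 * volume {x | β * T ≤ ‖P g x‖ₑ} ≤ ∫⁻ x, ‖P g x‖ₑ ^ 2 := by
      refine le_trans (mul_le_mul_right (measure_mono fun x hx => ?_) _)
        (mul_meas_ge_le_lintegral ((hP.nice g hgn).measurable.enorm.pow_const 2) _)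
      exact pow_le_pow_left₀ zero_le (show β * T ≤ ‖P g x‖ₑ from hx) 2
    have h2 : ∫⁻ x, ‖P g x‖ₑ ^ 2 ≤ β ^ 2 * ∫⁻ x, ‖g x‖ₑ ^ 2 := by
      rw [lintegral_enorm_sq_eq (hP.nice g hgn), lintegral_enorm_sq_eq hgn, hβ,
        ← ENNReal.ofReal_pow hB.le, ← ENNReal.ofReal_mul (by positivity), ← mul_pow]
      exact ENNReal.ofReal_le_ofReal (pow_le_pow_left₀ nrm_nonneg (hP.nrm_le g hgn) 2)
    have h3 := h1.trans (h2.trans (mul_le_mul_right (lintegral_sq_sub_sum_badPart_le hf A) _))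
    rw [mul_pow, mul_assoc, ENNReal.mul_le_mul_iff_right (pow_ne_zero 2 hβ0)
      (ENNReal.pow_ne_top hβt)] at h3
    rw [← ENNReal.mul_le_mul_iff_right (pow_ne_zero 2 hT0) (ENNReal.pow_ne_top hTt), mul_add,
      ← mul_assoc, ENNReal.mul_inv_cancel (pow_ne_zero 2 hT0) (ENNReal.pow_ne_top hTt), one_mul]
    refine h3.trans (le_of_eq ?_)
    ring
  have c2 : volume X ≤ 14 ^ n * V := by
    refine (measure_iUnion_le _).trans ?_
    rw [show V = _ from measure_iUnion disjoint_stopSet measurableSet_stopSet,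
      ← ENNReal.tsum_mul_left]
    exact ENNReal.tsum_le_tsum fun j => volume_starSet_le (cubeInv_stopSet j)
  have c3 : volume {x | β * T ≤ Xᶜ.indicator (fun x => ‖(∑ j ∈ A, P (b j)) x‖ₑ) x} ≤
      T⁻¹ * (2 * ∫⁻ x in ⋃ j, stopSet f t j, ‖f x‖ₑ) := by
    have hmb : ∀ j, Measurable (P (b j)) := fun j => (hP.nice _ (hb j)).measurable
    have h1 : β * T * volume {x | β * T ≤ Xᶜ.indicator (fun x => ‖(∑ j ∈ A, P (b j)) x‖ₑ) x} ≤
        ∫⁻ x in Xᶜ, ‖(∑ j ∈ A, P (b j)) x‖ₑ := by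
      rw [← lintegral_indicator hXm.compl]
      exact mul_meas_ge_le_lintegral
        ((Nice.sum A fun j _ => hP.nice _ (hb j)).measurable.enorm.indicator hXm.compl) _
    have h2 : ∫⁻ x in Xᶜ, ‖(∑ j ∈ A, P (b j)) x‖ₑ ≤
        β * (2 * ∫⁻ x in ⋃ j, stopSet f t j, ‖f x‖ₑ) := by
      calc _ ≤ ∫⁻ x in Xᶜ, ∑ j ∈ A, ‖P (b j) x‖ₑ := by
            refine lintegral_mono fun x => ?_
            rw [Finset.sum_apply]
            exact enorm_sum_le _ _
        _ = ∑ j ∈ A, ∫⁻ x in Xᶜ, ‖P (b j) x‖ₑ :=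
            lintegral_finsetSum _ fun j _ => (hmb j).enorm
        _ ≤ ∑ j ∈ A, β * (2 * ∫⁻ x in stopSet f t j, ‖f x‖ₑ) := by
            refine Finset.sum_le_sum fun j _ => ?_
            calc _ ≤ ∫⁻ x in (starSet j (stopSet f t j))ᶜ, ‖P (b j) x‖ₑ :=
                  lintegral_mono_set (Set.compl_subset_compl.2
                    (Set.subset_iUnion (fun j => starSet j (stopSet f t j)) j))
              _ ≤ β * ∫⁻ x, ‖b j x‖ₑ := by
                  refine hP.tail j (b j) (stopSet f t j) _ (hb j) (hf.dyadicE_badPart j)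
                    (cubeInv_stopSet j) (fun x y hxy => ?_)
                    (fun y hy => Set.indicator_of_notMem hy _) lt_norm_of_notMem_starSet
                  simp only [Set.mem_compl_iff]
                  exact congrArg Not (cubeInv_starSet j _ x y hxy)
              _ ≤ _ := mul_le_mul_right (lintegral_enorm_badPart_le hf j) _
        _ ≤ _ := by
            rw [← Finset.mul_sum, ← Finset.mul_sum, setLIntegral_iUnion_stopSet]
            exact mul_le_mul_right (mul_le_mul_right (ENNReal.sum_le_tsum A) _) _
    have h3 := h1.trans h2
    rw [mul_assoc, ENNReal.mul_le_mul_iff_right hβ0 hβt] at h3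
    rwa [← ENNReal.mul_le_mul_iff_right hT0 hTt, ← mul_assoc T T⁻¹, ENNReal.mul_inv_cancel hT0 hTt,
      one_mul]
  calc _ ≤ _ := measure_mono hsub
    _ ≤ _ := measure_union_le _ _
    _ ≤ _ := add_le_add (measure_union_le _ _) le_rfl
    _ ≤ _ := add_le_add (add_le_add c1 c2) c3

lemma tendsto_setLIntegral_compl_stopSet (hf : Nice f) :
    Filter.Tendsto (fun J : ℕ => ∫⁻ x in (⋃ j ∈ Finset.Icc (-(J:ℤ)) J, stopSet f t j)ᶜ, ‖f x‖ₑ ^ 2)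
      Filter.atTop (nhds (∫⁻ x in (⋃ j, stopSet f t j)ᶜ, ‖f x‖ₑ ^ 2)) := by
  have hm : ∀ J : ℕ, MeasurableSet (⋃ j ∈ Finset.Icc (-(J:ℤ)) J, stopSet f t j) := fun J =>
    Finset.measurableSet_biUnion _ fun j _ => measurableSet_stopSet j
  have hm' : MeasurableSet (⋃ j, stopSet f t j) := .iUnion measurableSet_stopSet
  have hF : Measurable fun x => ‖f x‖ₑ ^ 2 := hf.measurable.enorm.pow_const 2
  simp only [← lintegral_indicator (hm _).compl, ← lintegral_indicator hm'.compl]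
  refine tendsto_lintegral_of_dominated_convergence (fun x => ‖f x‖ₑ ^ 2)
    (fun J => hF.indicator (hm J).compl)
    (fun J => Filter.Eventually.of_forall fun x => Set.indicator_le_self _ _ x) ?_
    (Filter.Eventually.of_forall fun x => ?_)
  · rw [lintegral_enorm_sq_eq hf]
    exact ENNReal.ofReal_ne_top
  · refine tendsto_const_nhds.congr' ?_
    by_cases hx : x ∈ ⋃ j, stopSet f t j
    · obtain ⟨j, hj⟩ := Set.mem_iUnion.1 hx
      filter_upwards [Filter.eventually_ge_atTop j.natAbs] with J hJ
      have h2 : x ∈ ⋃ j ∈ Finset.Icc (-(J:ℤ)) J, stopSet f t j := by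
        simp only [Set.mem_iUnion, exists_prop, Finset.mem_Icc]
        exact ⟨j, by omega, hj⟩
      rw [Set.indicator_of_notMem (Set.notMem_compl_iff.2 hx),
        Set.indicator_of_notMem (Set.notMem_compl_iff.2 h2)]
    · refine Filter.Eventually.of_forall fun J => ?_
      have h2 : x ∉ ⋃ j ∈ Finset.Icc (-(J:ℤ)) J, stopSet f t j := fun h =>
        hx (Set.iUnion₂_subset_iUnion _ _ h)
      simp only [Set.indicator_of_mem (show x ∈ (⋃ j, stopSet f t j)ᶜ from hx),
        Set.indicator_of_mem
          (show x ∈ (⋃ j ∈ Finset.Icc (-(J:ℤ)) J, stopSet f t j)ᶜ from h2)]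

/-- The truncated weak-type estimate obtained from the Calderón–Zygmund decomposition. -/
lemma DyadicCZ.volume_lt_abs_le (hP : DyadicCZ n B P) (hn : 0 < n) (hB : 0 < B) (hf : Nice f)
    (ht : 0 < t) :
    volume {x | 2 * (B * t) < |P f x|} ≤
      (ENNReal.ofReal t ^ 2)⁻¹ * (∫⁻ x in {x | |f x| ≤ t}, ‖f x‖ₑ ^ 2) +
      (2 * 4 ^ n + 2 * 14 ^ n + 4) *
        ((ENNReal.ofReal t)⁻¹ * ∫⁻ x in {x | t / 2 < |f x|}, ‖f x‖ₑ) := by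
  set V := volume (⋃ j, stopSet f t j) with hV
  set T := ENNReal.ofReal t with hT
  have hT0 : T ≠ 0 := by simpa [hT] using ht
  have hTt : T ≠ ⊤ := ENNReal.ofReal_ne_top
  obtain ⟨h1, h2⟩ := setLIntegral_iUnion_stopSet_le hf ht
  set Φ := ∫⁻ x in {x | t / 2 < |f x|}, ‖f x‖ₑ
  have hlim := (((ENNReal.Tendsto.const_mul (tendsto_setLIntegral_compl_stopSet (t := t) hf)
    (Or.inr (ENNReal.inv_ne_top.2 (pow_ne_zero 2 hT0)))).add_const (4 ^ n * V)).add_const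
      (14 ^ n * V)).add_const (T⁻¹ * (2 * ∫⁻ x in ⋃ j, stopSet f t j, ‖f x‖ₑ))
  have key := ge_of_tendsto' hlim fun J => hP.weak_aux hB hf ht (Finset.Icc (-(J:ℤ)) J)
  refine key.trans ?_
  have hV' : V ≤ T⁻¹ * (2 * Φ) := by
    rwa [← ENNReal.mul_le_mul_iff_right hT0 hTt, ← mul_assoc T T⁻¹, ENNReal.mul_inv_cancel hT0 hTt,
      one_mul]
  have hae : ∫⁻ x in (⋃ j, stopSet f t j)ᶜ, ‖f x‖ₑ ^ 2 ≤ ∫⁻ x in {x | |f x| ≤ t}, ‖f x‖ₑ ^ 2 := by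
    refine lintegral_mono' (Measure.restrict_mono_ae ?_) le_rfl
    filter_upwards [ae_abs_le_of_notMem_stopSet hn hf ht] with x hx h
    exact hx h
  calc _ ≤ (T ^ 2)⁻¹ * (∫⁻ x in {x | |f x| ≤ t}, ‖f x‖ₑ ^ 2) + 4 ^ n * (T⁻¹ * (2 * Φ)) +
        14 ^ n * (T⁻¹ * (2 * Φ)) + T⁻¹ * (2 * (2 * Φ)) :=
        add_le_add (add_le_add (add_le_add (mul_le_mul_right hae _) (mul_le_mul_right hV' _))
          (mul_le_mul_right hV' _)) (mul_le_mul_right (mul_le_mul_right h2 _) _)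
    _ = _ := by ring

end Weak

section Interpolation

lemma lintegral_Ioi_ite_le {p a : ℝ} (hp : p < 2) (ha : 0 ≤ a) :
    ∫⁻ t in Set.Ioi (0:ℝ), (if a ≤ t then ENNReal.ofReal (a ^ 2 * t ^ (p - 3)) else 0) ≤
      ENNReal.ofReal (a ^ p / (2 - p)) := by
  rcases ha.eq_or_lt with rfl | ha
  · simp
  calc _ ≤ ∫⁻ t, (if a ≤ t then ENNReal.ofReal (a ^ 2 * t ^ (p - 3)) else 0) :=
        setLIntegral_le_lintegral _ _
    _ = ∫⁻ t in Set.Ici a, ENNReal.ofReal (a ^ 2 * t ^ (p - 3)) := by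
        rw [← lintegral_indicator measurableSet_Ici]
        rfl
    _ = ∫⁻ t in Set.Ioi a, ENNReal.ofReal (a ^ 2 * t ^ (p - 3)) :=
        setLIntegral_congr Ioi_ae_eq_Ici.symm
    _ = ENNReal.ofReal (∫ t in Set.Ioi a, a ^ 2 * t ^ (p - 3)) := by
        refine (ofReal_integral_eq_lintegral_ofReal
          ((integrableOn_Ioi_rpow_of_lt (by linarith) ha).const_mul _) ?_).symm
        filter_upwards [ae_restrict_mem measurableSet_Ioi] with t ht
        have : 0 < t := ha.trans ht
        positivity
    _ = _ := by
        rw [integral_const_mul, integral_Ioi_rpow_of_lt (by linarith) ha]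
        congr 1
        have e : a ^ p = a ^ 2 * a ^ (p - 3 + 1) := by
          rw [← Real.rpow_natCast, ← Real.rpow_add ha]; congr 1; push_cast; ring
        rw [e, mul_div_assoc, show p - 3 + 1 = -(2 - p) by ring, neg_div_neg_eq]

lemma lintegral_Ioi_ite_lt_le {p a : ℝ} (hp : 1 < p) (ha : 0 ≤ a) :
    ∫⁻ t in Set.Ioi (0:ℝ), (if t < 2 * a then ENNReal.ofReal (a * t ^ (p - 2)) else 0) ≤
      ENNReal.ofReal (2 ^ (p - 1) / (p - 1) * a ^ p) := by
  have h1 : IntegrableOn (fun t : ℝ => t ^ (p - 2)) (Set.Ioc 0 (2 * a)) :=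
    (intervalIntegrable_iff_integrableOn_Ioc_of_le (by positivity)).1
      (intervalIntegral.intervalIntegrable_rpow' (by linarith))
  calc _ = ∫⁻ t in Set.Ioi (0:ℝ), (Set.Iio (2 * a)).indicator
          (fun t => ENNReal.ofReal (a * t ^ (p - 2))) t := rfl
    _ = ∫⁻ t in Set.Iio (2 * a) ∩ Set.Ioi 0, ENNReal.ofReal (a * t ^ (p - 2)) := by
        rw [lintegral_indicator measurableSet_Iio, Measure.restrict_restrict measurableSet_Iio]
    _ ≤ ∫⁻ t in Set.Ioc 0 (2 * a), ENNReal.ofReal (a * t ^ (p - 2)) :=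
        lintegral_mono_set fun t ht => ⟨ht.2, le_of_lt ht.1⟩
    _ = ENNReal.ofReal (∫ t in Set.Ioc 0 (2 * a), a * t ^ (p - 2)) := by
        refine (ofReal_integral_eq_lintegral_ofReal (h1.const_mul _) ?_).symm
        filter_upwards [ae_restrict_mem measurableSet_Ioc] with t ht
        have : 0 < t := ht.1
        positivity
    _ = _ := by
        rw [integral_const_mul, ← intervalIntegral.integral_of_le (by positivity),
          integral_rpow (Or.inl (by linarith)), show p - 2 + 1 = p - 1 by ring,
          Real.zero_rpow (by linarith), sub_zero, Real.mul_rpow (by norm_num) ha]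
        congr 1
        have e : a ^ p = a * a ^ (p - 1) := by
          rcases ha.eq_or_lt with rfl | ha
          · rw [Real.zero_rpow (by linarith), zero_mul]
          · nth_rw 2 [← Real.rpow_one a]
            rw [← Real.rpow_add ha]; congr 1; ring
        rw [e]; ring

variable {n : ℕ}

lemma DyadicCZ.exists_lintegral_rpow_le (hn : 0 < n) {p : ℝ} (hp : 1 < p) (hp2 : p < 2) :
    ∃ C : ℝ, 0 < C ∧ ∀ (B : ℝ) (P : ((Fin n → ℝ) → ℝ) → (Fin n → ℝ) → ℝ), 0 < B →
      DyadicCZ n B P → ∀ f, Nice f →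
        ∫⁻ x, ENNReal.ofReal (|P f x| ^ p) ≤
          ENNReal.ofReal (C * B ^ p) * ∫⁻ x, ENNReal.ofReal (|f x| ^ p) := by
  have h2p : 0 < 2 - p := by linarith
  have hp1 : 0 < p - 1 := by linarith
  set D : ℝ := 2 * 4 ^ n + 2 * 14 ^ n + 4 with hD
  have hD0 : 0 < D := by positivity
  have hDe : (2 * 4 ^ n + 2 * 14 ^ n + 4 : ENNReal) = ENNReal.ofReal D := by
    rw [hD, ENNReal.ofReal_add (by positivity) (by positivity),
      ENNReal.ofReal_add (by positivity) (by positivity), ENNReal.ofReal_mul (by positivity),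
      ENNReal.ofReal_mul (by positivity), ENNReal.ofReal_pow (by positivity),
      ENNReal.ofReal_pow (by positivity)]
    norm_num
  clear_value D
  refine ⟨2 ^ p * (p * (1 / (2 - p) + D * (2 ^ (p - 1) / (p - 1)))), by positivity,
    fun B P hB hP f hf => ?_⟩
  set a : (Fin n → ℝ) → ℝ := fun x => |f x| with ha
  have ham : Measurable a := hf.abs.measurable
  have ha0 : ∀ x, 0 ≤ a x := fun x => abs_nonneg _
  set u : (Fin n → ℝ) → ℝ := fun x => |P f x| / (2 * B) with hu
  have hum : Measurable u := (hP.nice f hf).abs.measurable.div_const _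
  have hu0 : ∀ x, 0 ≤ u x := fun x => by positivity
  let G₁ : ℝ → (Fin n → ℝ) → ENNReal := fun t x =>
    if a x ≤ t then ENNReal.ofReal (a x ^ 2 * t ^ (p - 3)) else 0
  let G₂ : ℝ → (Fin n → ℝ) → ENNReal := fun t x =>
    if t < 2 * a x then ENNReal.ofReal (a x * t ^ (p - 2)) else 0
  have hG₁ : Measurable (Function.uncurry G₁) :=
    Measurable.ite (measurableSet_le (by fun_prop) (by fun_prop)) (by fun_prop) measurable_const
  have hG₂ : Measurable (Function.uncurry G₂) :=
    Measurable.ite (measurableSet_lt (by fun_prop) (by fun_prop)) (by fun_prop) measurable_const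
  have hlevel : ∀ t ∈ Set.Ioi (0:ℝ), volume {x | t < u x} * ENNReal.ofReal (t ^ (p - 1)) ≤
      (∫⁻ x, G₁ t x) + ENNReal.ofReal D * ∫⁻ x, G₂ t x := by
    intro t ht
    have ht : 0 < t := ht
    have e0 : {x | t < u x} = {x | 2 * (B * t) < |P f x|} := by
      ext x
      simp only [Set.mem_ofPred_eq, hu]
      rw [lt_div_iff₀ (by positivity)]
      ring_nf
    have hm1 : MeasurableSet {x | |f x| ≤ t} := measurableSet_le ham measurable_const
    have hm2 : MeasurableSet {x | t / 2 < |f x|} := measurableSet_lt measurable_const ham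
    have e1 : ∫⁻ x, G₁ t x = ENNReal.ofReal (t ^ (p - 1)) *
        ((ENNReal.ofReal t ^ 2)⁻¹ * ∫⁻ x in {x | |f x| ≤ t}, ‖f x‖ₑ ^ 2) := by
      rw [← mul_assoc, ← lintegral_indicator hm1, ← lintegral_const_mul _
        ((hf.measurable.enorm.pow_const 2).indicator hm1)]
      refine lintegral_congr fun x => ?_
      by_cases hx : |f x| ≤ t
      · rw [Set.indicator_of_mem (show x ∈ {x | |f x| ≤ t} from hx)]
        simp only [G₁, ha, if_pos hx]
        rw [Real.enorm_eq_ofReal_abs, ← ENNReal.ofReal_pow ht.le, ← ENNReal.ofReal_pow (abs_nonneg _),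
          ← ENNReal.ofReal_inv_of_pos (by positivity), ← ENNReal.ofReal_mul (by positivity),
          ← ENNReal.ofReal_mul (by positivity)]
        congr 1
        rw [show p - 3 = p - 1 - (2:ℕ) by push_cast; ring, Real.rpow_sub_natCast ht.ne']
        field_simp
      · rw [Set.indicator_of_notMem (show x ∉ {x | |f x| ≤ t} from hx)]
        simp only [G₁, ha, if_neg hx, mul_zero]
    have e2 : ∫⁻ x, G₂ t x = ENNReal.ofReal (t ^ (p - 1)) *
        ((ENNReal.ofReal t)⁻¹ * ∫⁻ x in {x | t / 2 < |f x|}, ‖f x‖ₑ) := by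
      rw [← mul_assoc, ← lintegral_indicator hm2, ← lintegral_const_mul _
        (hf.measurable.enorm.indicator hm2)]
      refine lintegral_congr fun x => ?_
      by_cases hx : t / 2 < |f x|
      · rw [Set.indicator_of_mem (show x ∈ {x | t / 2 < |f x|} from hx)]
        simp only [G₂, ha, if_pos (show t < 2 * |f x| by linarith)]
        rw [Real.enorm_eq_ofReal_abs,
          ← ENNReal.ofReal_inv_of_pos (by positivity), ← ENNReal.ofReal_mul (by positivity),
          ← ENNReal.ofReal_mul (by positivity)]
        congr 1
        rw [show p - 2 = p - 1 - 1 by ring, Real.rpow_sub_one ht.ne']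
        field_simp
      · rw [Set.indicator_of_notMem (show x ∉ {x | t / 2 < |f x|} from hx)]
        simp only [G₂, ha, if_neg (show ¬ t < 2 * |f x| by linarith), mul_zero]
    rw [e0, e1, e2, mul_comm]
    refine (mul_le_mul_right (hP.volume_lt_abs_le hn hB hf ht) _).trans (le_of_eq ?_)
    rw [hDe]; ring
  have hcake := lintegral_rpow_eq_lintegral_meas_lt_mul volume (Filter.Eventually.of_forall hu0)
    hum.aemeasurable (p := p) (by linarith)
  have hmain : ∫⁻ x, ENNReal.ofReal (u x ^ p) ≤ ENNReal.ofReal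
      (p * (1 / (2 - p) + D * (2 ^ (p - 1) / (p - 1)))) * ∫⁻ x, ENNReal.ofReal (a x ^ p) := by
    have s1 : ∫⁻ t in Set.Ioi (0:ℝ), ∫⁻ x, G₁ t x ≤
        ENNReal.ofReal (1 / (2 - p)) * ∫⁻ x, ENNReal.ofReal (a x ^ p) := by
      rw [lintegral_lintegral_swap hG₁.aemeasurable, ← lintegral_const_mul _ (by fun_prop)]
      refine lintegral_mono fun x => (lintegral_Ioi_ite_le hp2 (ha0 x)).trans (le_of_eq ?_)
      rw [← ENNReal.ofReal_mul (by positivity)]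
      congr 1; ring
    have s2 : ∫⁻ t in Set.Ioi (0:ℝ), ∫⁻ x, G₂ t x ≤
        ENNReal.ofReal (2 ^ (p - 1) / (p - 1)) * ∫⁻ x, ENNReal.ofReal (a x ^ p) := by
      rw [lintegral_lintegral_swap hG₂.aemeasurable, ← lintegral_const_mul _ (by fun_prop)]
      refine lintegral_mono fun x => (lintegral_Ioi_ite_lt_le hp (ha0 x)).trans (le_of_eq ?_)
      rw [← ENNReal.ofReal_mul (by positivity)]
    rw [hcake]
    calc _ ≤ ENNReal.ofReal p * ∫⁻ t in Set.Ioi (0:ℝ),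
          ((∫⁻ x, G₁ t x) + ENNReal.ofReal D * ∫⁻ x, G₂ t x) :=
          mul_le_mul_right (setLIntegral_mono' measurableSet_Ioi hlevel) _
      _ = ENNReal.ofReal p * ((∫⁻ t in Set.Ioi (0:ℝ), ∫⁻ x, G₁ t x) +
          ENNReal.ofReal D * ∫⁻ t in Set.Ioi (0:ℝ), ∫⁻ x, G₂ t x) := by
          have m1 : Measurable fun t => ∫⁻ x, G₁ t x := hG₁.lintegral_prod_right
          have m2 : Measurable fun t => ∫⁻ x, G₂ t x := hG₂.lintegral_prod_right
          rw [lintegral_add_left m1, lintegral_const_mul _ m2]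
      _ ≤ ENNReal.ofReal p * (ENNReal.ofReal (1 / (2 - p)) * (∫⁻ x, ENNReal.ofReal (a x ^ p)) +
          ENNReal.ofReal D * (ENNReal.ofReal (2 ^ (p - 1) / (p - 1)) *
            ∫⁻ x, ENNReal.ofReal (a x ^ p))) :=
          mul_le_mul_right (add_le_add s1 (mul_le_mul_right s2 _)) _
      _ = _ := by
          rw [ENNReal.ofReal_mul (p := p) (by positivity),
            ENNReal.ofReal_add (by positivity) (by positivity), ENNReal.ofReal_mul hD0.le]
          ring
  have e : ∀ x, ENNReal.ofReal (|P f x| ^ p) =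
      ENNReal.ofReal ((2 * B) ^ p) * ENNReal.ofReal (u x ^ p) := fun x => by
    rw [← ENNReal.ofReal_mul (by positivity), ← Real.mul_rpow (by positivity) (hu0 x)]
    congr 2
    simp only [hu]; field_simp
  simp only [e]
  rw [lintegral_const_mul _ (by fun_prop)]
  refine (mul_le_mul_right hmain _).trans (le_of_eq ?_)
  rw [← mul_assoc, ← ENNReal.ofReal_mul (by positivity), Real.mul_rpow (by norm_num) hB.le]
  congr 2
  ring

end Interpolation

section StrongType
variable {n : ℕ} {B : ℝ} {P Q : ((Fin n → ℝ) → ℝ) → (Fin n → ℝ) → ℝ}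

lemma Nice.integrable_abs_rpow {u : (Fin n → ℝ) → ℝ} (hu : Nice u) {p : ℝ} (hp : 1 ≤ p) :
    Integrable fun x => |u x| ^ p := by
  obtain ⟨⟨hm, M, hM⟩, hi⟩ := hu
  refine (hi.abs.const_mul (M ^ (p - 1))).mono' (hm.abs.pow_const p).aestronglyMeasurable
    (Filter.Eventually.of_forall fun x => ?_)
  rw [Real.norm_of_nonneg (by positivity)]
  rcases (abs_nonneg (u x)).eq_or_lt with h | h
  · rw [← h, Real.zero_rpow (by linarith), mul_zero]
  · calc |u x| ^ p = |u x| ^ (p - 1) * |u x| := by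
          nth_rw 3 [← Real.rpow_one |u x|]
          rw [← Real.rpow_add h]; congr 1; ring
      _ ≤ _ := mul_le_mul_of_nonneg_right
          (Real.rpow_le_rpow (abs_nonneg _) (hM x) (by linarith)) (abs_nonneg _)

/-- The function `|u|^{p-2} u`. -/
def dualFn {n : ℕ} (p : ℝ) (u : (Fin n → ℝ) → ℝ) : (Fin n → ℝ) → ℝ :=
  fun x => |u x| ^ (p - 2) * u x

lemma abs_dualFn {p : ℝ} (hp : 1 < p) (u : (Fin n → ℝ) → ℝ) (x : Fin n → ℝ) :
    |dualFn p u x| = |u x| ^ (p - 1) := by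
  rw [dualFn, abs_mul, abs_of_nonneg (by positivity)]
  rcases (abs_nonneg (u x)).eq_or_lt with h | h
  · rw [← h, mul_zero, Real.zero_rpow (by linarith)]
  · nth_rw 2 [← Real.rpow_one |u x|]
    rw [← Real.rpow_add h]; congr 1; ring

lemma mul_dualFn {p : ℝ} (hp : 0 < p) (u : (Fin n → ℝ) → ℝ) (x : Fin n → ℝ) :
    u x * dualFn p u x = |u x| ^ p := by
  rw [dualFn, mul_left_comm, ← pow_two, ← sq_abs]
  rcases (abs_nonneg (u x)).eq_or_lt with h | h
  · rw [← h, Real.zero_rpow hp.ne']; simp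
  · rw [← Real.rpow_natCast, ← Real.rpow_add h]; congr 1; push_cast; ring

lemma Nice.dualFn {u : (Fin n → ℝ) → ℝ} (hu : Nice u) {p : ℝ} (hp : 2 ≤ p) :
    Nice (dualFn p u) := by
  have hm : Measurable (_root_.dualFn p u) :=
    (hu.abs.measurable.pow_const _).mul hu.measurable
  have hI := hu.integrable_abs_rpow (p := p - 1) (by linarith)
  obtain ⟨⟨-, M, hM⟩, -⟩ := hu
  refine ⟨⟨hm, M ^ (p - 1), fun x => ?_⟩, hI.mono' hm.aestronglyMeasurable
    (Filter.Eventually.of_forall fun x => (abs_dualFn (by linarith) u x).le)⟩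
  rw [abs_dualFn (by linarith)]
  gcongr
  · linarith
  · exact hM x

lemma DyadicCZ.lintegral_rpow_le_of_dual (hP : DyadicCZ n B P)
    (hQ : DyadicCZ n B Q) (hB : 0 < B)
    (hPQ : ∀ f g, Nice f → Nice g → ∫ x, P f x * g x = ∫ x, f x * Q g x)
    {p q C : ℝ} (hp : 2 < p) (hpq : p.HolderConjugate q) (hC : 0 < C)
    (hq : ∀ g, Nice g → ∫⁻ x, ENNReal.ofReal (|Q g x| ^ q) ≤
      ENNReal.ofReal (C * B ^ q) * ∫⁻ x, ENNReal.ofReal (|g x| ^ q))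
    {f : (Fin n → ℝ) → ℝ} (hf : Nice f) :
    ∫⁻ x, ENNReal.ofReal (|P f x| ^ p) ≤
      ENNReal.ofReal ((C ^ (1 / q) * B) ^ p) * ∫⁻ x, ENNReal.ofReal (|f x| ^ p) := by
  have hp0 : 0 < p := by linarith
  have hq0 : 0 < q := hpq.symm.pos
  have hu := hP.nice f hf
  set u := P f with hu_def
  have hg := hu.dualFn hp.le
  have hQg := hQ.nice _ hg
  set U := ∫⁻ x, ENNReal.ofReal (|u x| ^ p) with hU
  set F := ∫⁻ x, ENNReal.ofReal (|f x| ^ p) with hF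
  have hUt : U ≠ ⊤ := by
    have := (hu.integrable_abs_rpow (p := p) (by linarith)).lintegral_lt_top
    exact this.ne
  have h1 : U ≤ ∫⁻ x, ENNReal.ofReal |f x| * ENNReal.ofReal |Q (dualFn p u) x| := by
    rw [hU, ← ofReal_integral_eq_lintegral_ofReal (hu.integrable_abs_rpow (by linarith))
      (Filter.Eventually.of_forall fun x => by positivity)]
    simp only [← mul_dualFn hp0 u]
    rw [hu_def, hPQ f _ hf hg, ← hu_def]
    refine (ENNReal.ofReal_le_ofReal (le_abs_self _)).trans ?_
    rw [← Real.enorm_eq_ofReal_abs]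
    refine (enorm_integral_le_lintegral_enorm _).trans (le_of_eq (lintegral_congr fun x => ?_))
    rw [enorm_mul, Real.enorm_eq_ofReal_abs, Real.enorm_eq_ofReal_abs]
  have h2 : U ≤ F ^ (1 / p) * (ENNReal.ofReal (C * B ^ q) * U) ^ (1 / q) := by
    refine h1.trans ((ENNReal.lintegral_mul_le_Lp_mul_Lq volume hpq
      hf.abs.measurable.ennreal_ofReal.aemeasurable
      hQg.abs.measurable.ennreal_ofReal.aemeasurable).trans ?_)
    simp only [ENNReal.ofReal_rpow_of_nonneg (abs_nonneg _) hp0.le,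
      ENNReal.ofReal_rpow_of_nonneg (abs_nonneg _) hq0.le]
    refine mul_le_mul_right (ENNReal.rpow_le_rpow ((hq _ hg).trans (le_of_eq ?_))
      (by positivity)) _
    congr 1
    refine lintegral_congr fun x => ?_
    rw [abs_dualFn (by linarith), ← Real.rpow_mul (abs_nonneg _), hpq.sub_one_mul_conj]
  rcases eq_or_ne U 0 with h0 | h0
  · rw [h0]; exact zero_le
  have hsum : 1 / p + 1 / q = 1 := by
    simpa [one_div] using hpq.inv_add_inv_eq_one
  have hcb : (C * B ^ q) ^ (1 / q) = C ^ (1 / q) * B := by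
    rw [Real.mul_rpow hC.le (by positivity), ← Real.rpow_mul hB.le, mul_one_div_cancel hq0.ne',
      Real.rpow_one]
  have h3 : U ^ (1 / p) ≤ ENNReal.ofReal (C ^ (1 / q) * B) * F ^ (1 / p) := by
    have e : U = U ^ (1 / p) * U ^ (1 / q) := by
      rw [← ENNReal.rpow_add _ _ h0 hUt, hsum, ENNReal.rpow_one]
    rw [ENNReal.mul_rpow_of_nonneg _ _ (by positivity),
      ENNReal.ofReal_rpow_of_nonneg (by positivity) (by positivity), hcb] at h2
    nth_rw 1 [e] at h2
    rw [← mul_assoc] at h2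
    have hne : U ^ (1 / q) ≠ 0 := by simp [ENNReal.rpow_eq_zero_iff, h0, hUt]
    have hnt : U ^ (1 / q) ≠ ⊤ := ENNReal.rpow_ne_top_of_nonneg (by positivity) hUt
    rw [mul_comm (ENNReal.ofReal _)]
    exact (ENNReal.mul_le_mul_iff_left hne hnt).1 h2
  have h4 := ENNReal.rpow_le_rpow h3 hp0.le
  rwa [ENNReal.mul_rpow_of_nonneg _ _ hp0.le, ← ENNReal.rpow_mul, ← ENNReal.rpow_mul,
    one_div_mul_cancel hp0.ne', ENNReal.rpow_one, ENNReal.rpow_one,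
    ENNReal.ofReal_rpow_of_nonneg (by positivity) hp0.le] at h4

lemma DyadicCZ.exists_lintegral_rpow_le_of_adjoint (hn : 0 < n) {p : ℝ} (hp : 1 < p) :
    ∃ C : ℝ, 0 < C ∧ ∀ (B : ℝ) (P Q : ((Fin n → ℝ) → ℝ) → (Fin n → ℝ) → ℝ), 0 < B →
      DyadicCZ n B P → DyadicCZ n B Q →
      (∀ f g, Nice f → Nice g → ∫ x, P f x * g x = ∫ x, f x * Q g x) → ∀ f, Nice f →
        ∫⁻ x, ENNReal.ofReal (|P f x| ^ p) ≤
          ENNReal.ofReal ((C * B) ^ p) * ∫⁻ x, ENNReal.ofReal (|f x| ^ p) := by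
  have hp0 : 0 < p := by linarith
  rcases lt_trichotomy p 2 with h | rfl | h
  · obtain ⟨C, hC, H⟩ := DyadicCZ.exists_lintegral_rpow_le hn hp h
    refine ⟨C ^ (1 / p), by positivity, fun B P Q hB hP _ _ f hf => ?_⟩
    rw [Real.mul_rpow (by positivity) hB.le, ← Real.rpow_mul hC.le, one_div_mul_cancel hp0.ne',
      Real.rpow_one]
    exact H B P hB hP f hf
  · refine ⟨1, one_pos, fun B P Q hB hP _ _ f hf => ?_⟩
    have e : ∀ u : (Fin n → ℝ) → ℝ, Nice u →
        ∫⁻ x, ENNReal.ofReal (|u x| ^ (2:ℝ)) = ENNReal.ofReal (nrm u ^ 2) := fun u hu => by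
      rw [← lintegral_enorm_sq_eq hu]
      refine lintegral_congr fun x => ?_
      rw [Real.enorm_eq_ofReal_abs, ← ENNReal.ofReal_pow (abs_nonneg _), Real.rpow_two]
    rw [e _ (hP.nice f hf), e _ hf, ← ENNReal.ofReal_mul (by positivity), one_mul, Real.rpow_two,
      ← mul_pow]
    exact ENNReal.ofReal_le_ofReal (pow_le_pow_left₀ nrm_nonneg (hP.nrm_le f hf) 2)
  · have hpq := Real.HolderConjugate.conjExponent hp
    set q := Real.conjExponent p with hq
    have hq2 : q < 2 := by
      rw [hq, Real.conjExponent, div_lt_iff₀ (by linarith)]; linarith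
    obtain ⟨C, hC, H⟩ := DyadicCZ.exists_lintegral_rpow_le hn hpq.symm.lt hq2
    exact ⟨C ^ (1 / q), by positivity, fun B P Q hB hP hQ hPQ f hf =>
      hP.lintegral_rpow_le_of_dual hQ hB hPQ h hpq hC (fun g hg => H B Q hB hQ g hg) hf⟩

lemma eLpNorm_le_of_lintegral_rpow_le {u f : (Fin n → ℝ) → ℝ} {p M : ℝ} (hp : 0 < p) (hM : 0 ≤ M)
    (h : ∫⁻ x, ENNReal.ofReal (|u x| ^ p) ≤
      ENNReal.ofReal (M ^ p) * ∫⁻ x, ENNReal.ofReal (|f x| ^ p)) :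
    eLpNorm u (ENNReal.ofReal p) volume ≤
      ENNReal.ofReal M * eLpNorm f (ENNReal.ofReal p) volume := by
  have e : ∀ v : (Fin n → ℝ) → ℝ, eLpNorm v (ENNReal.ofReal p) volume =
      (∫⁻ x, ENNReal.ofReal (|v x| ^ p)) ^ (1 / p) := fun v => by
    rw [eLpNorm_eq_lintegral_rpow_enorm_toReal (by simpa using hp) ENNReal.ofReal_ne_top,
      ENNReal.toReal_ofReal hp.le]
    simp only [Real.enorm_eq_ofReal_abs, ENNReal.ofReal_rpow_of_nonneg (abs_nonneg _) hp.le]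
  rw [e, e]
  refine (ENNReal.rpow_le_rpow h (by positivity)).trans (le_of_eq ?_)
  rw [ENNReal.mul_rpow_of_nonneg _ _ (by positivity),
    ENNReal.ofReal_rpow_of_nonneg (by positivity) (by positivity), ← Real.rpow_mul hM,
    mul_one_div_cancel hp.ne', Real.rpow_one]

end StrongType

section Haar

lemma haar1D_eq (k m : ℤ) (η : Bool) (t : ℝ) :
    haar1D k m η t = (√((2:ℝ) ^ (-k)))⁻¹ *
      ((if ⌊(2:ℝ) ^ (k + 1) * t⌋ = 2 * m then 1 else 0) +
        (if ⌊(2:ℝ) ^ (k + 1) * t⌋ = 2 * m + 1 then (if η then -1 else 1) else 0)) := by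
  have h2 : (0:ℝ) < (2:ℝ) ^ k := by positivity
  have hk : (2:ℝ) ^ (k + 1) = 2 * 2 ^ k := by rw [zpow_add₀ (by norm_num), zpow_one, mul_comm]
  have e1 : t ∈ Set.Ico ((2:ℝ) ^ (-k) * m) ((2:ℝ) ^ (-k) * (m + 1 / 2)) ↔
      ⌊(2:ℝ) ^ (k + 1) * t⌋ = 2 * m := by
    rw [Set.mem_Ico, zpow_neg, inv_mul_le_iff₀ h2, lt_inv_mul_iff₀ h2, Int.floor_eq_iff, hk]
    push_cast
    constructor <;> rintro ⟨a, b⟩ <;> constructor <;> linarith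
  have e2 : t ∈ Set.Ico ((2:ℝ) ^ (-k) * (m + 1 / 2)) ((2:ℝ) ^ (-k) * (m + 1)) ↔
      ⌊(2:ℝ) ^ (k + 1) * t⌋ = 2 * m + 1 := by
    rw [Set.mem_Ico, zpow_neg, inv_mul_le_iff₀ h2, lt_inv_mul_iff₀ h2, Int.floor_eq_iff, hk]
    push_cast
    constructor <;> rintro ⟨a, b⟩ <;> constructor <;> linarith
  have e3 : t ∈ Set.Ico ((2:ℝ) ^ (-k) * m) ((2:ℝ) ^ (-k) * (m + 1)) ↔
      (⌊(2:ℝ) ^ (k + 1) * t⌋ = 2 * m ∨ ⌊(2:ℝ) ^ (k + 1) * t⌋ = 2 * m + 1) := by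
    rw [← e1, ← e2]
    simp only [Set.mem_Ico, zpow_neg, inv_mul_le_iff₀ h2, lt_inv_mul_iff₀ h2]
    constructor
    · rintro ⟨a, b⟩
      rcases lt_or_ge (2 ^ k * t) (m + 1 / 2) with h | h
      · exact Or.inl ⟨a, h⟩
      · exact Or.inr ⟨h, b⟩
    · rintro (⟨a, b⟩ | ⟨a, b⟩) <;> constructor <;> linarith
  simp only [haar1D, Set.indicator_apply, e1, e2, e3, Pi.one_apply]
  congr 1
  cases η <;> simp only [if_true, Bool.false_eq_true, if_false] <;> split_ifs <;>
    first | omega | norm_num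

lemma measurable_haar1D (k m : ℤ) (η : Bool) : Measurable (haar1D k m η) := by
  rw [show haar1D k m η = _ from funext (haar1D_eq k m η)]
  have : Measurable fun t : ℝ => ⌊(2:ℝ) ^ (k + 1) * t⌋ := by fun_prop
  refine measurable_const.mul ((Measurable.ite (this (measurableSet_singleton _)) measurable_const
    measurable_const).add (Measurable.ite (this (measurableSet_singleton _)) measurable_const
    measurable_const))

lemma abs_haar1D_le (k m : ℤ) (η : Bool) (t : ℝ) :
    |haar1D k m η t| ≤ (√((2:ℝ) ^ (-k)))⁻¹ := by
  rw [haar1D_eq, abs_mul, abs_of_nonneg (by positivity)]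
  refine mul_le_of_le_one_right (by positivity) ?_
  split_ifs <;> first | omega | norm_num

lemma haar1D_eq_zero {k m : ℤ} {η : Bool} {t : ℝ}
    (ht : t ∉ Set.Ico ((2:ℝ) ^ (-k) * m) ((2:ℝ) ^ (-k) * (m + 1))) : haar1D k m η t = 0 := by
  have h2 : (0:ℝ) < (2:ℝ) ^ (-k) := by positivity
  have h3 : t ∉ Set.Ico ((2:ℝ) ^ (-k) * m) ((2:ℝ) ^ (-k) * (m + 1 / 2)) := fun h =>
    ht ⟨h.1, h.2.trans (by nlinarith)⟩
  have h4 : t ∉ Set.Ico ((2:ℝ) ^ (-k) * (m + 1 / 2)) ((2:ℝ) ^ (-k) * (m + 1)) := fun h =>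
    ht ⟨le_trans (by nlinarith) h.1, h.2⟩
  rw [haar1D, Set.indicator_of_notMem ht, Set.indicator_of_notMem h3, Set.indicator_of_notMem h4,
    sub_zero, ite_self, mul_zero]

lemma integrable_haar1D (k m : ℤ) (η : Bool) : Integrable (haar1D k m η) := by
  have h : IntegrableOn (haar1D k m η) (Set.Ico ((2:ℝ) ^ (-k) * m) ((2:ℝ) ^ (-k) * (m + 1))) :=
    Measure.integrableOn_of_bounded (measure_Ico_lt_top).ne
      (measurable_haar1D k m η).aestronglyMeasurable
      (Filter.Eventually.of_forall (abs_haar1D_le k m η))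
  exact (integrableOn_iff_integrable_of_support_subset fun t ht => by
    by_contra h; exact ht (haar1D_eq_zero h)).1 h

lemma integral_haar1D_true (k m : ℤ) : ∫ t, haar1D k m true t = 0 := by
  have h2 : (0:ℝ) < (2:ℝ) ^ (-k) := by positivity
  simp only [haar1D, if_true]
  rw [integral_const_mul, integral_sub, integral_indicator_one measurableSet_Ico,
    integral_indicator_one measurableSet_Ico, Real.volume_real_Ico_of_le (by nlinarith),
    Real.volume_real_Ico_of_le (by nlinarith)]
  · ring
  · exact (integrable_indicator_iff measurableSet_Ico).2 (integrableOn_const measure_Ico_lt_top.ne)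
  · exact (integrable_indicator_iff measurableSet_Ico).2 (integrableOn_const measure_Ico_lt_top.ne)

variable {n : ℕ}

lemma nice_haarFn (k : ℤ) (m : Fin n → ℤ) (η : Fin n → Bool) : Nice (haarFn n k m η) := by
  refine ⟨⟨?_, (√((2:ℝ) ^ (-k)))⁻¹ ^ n, fun x => ?_⟩,
    Integrable.fintype_prod fun i => integrable_haar1D k (m i) (η i)⟩
  · exact Finset.measurable_prod _ fun i _ =>
      (measurable_haar1D k (m i) (η i)).comp (measurable_pi_apply i)
  · rw [haarFn, Finset.abs_prod]
    refine (Finset.prod_le_prod (fun i _ => abs_nonneg _)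
      fun i _ => abs_haar1D_le k (m i) (η i) (x i)).trans (le_of_eq ?_)
    simp

lemma cubeInv_haarFn (k : ℤ) (m : Fin n → ℤ) (η : Fin n → Bool) :
    CubeInv (k + 1) (haarFn n k m η) := fun x y hxy =>
  Finset.prod_congr rfl fun i _ => by
    have : ⌊(2:ℝ) ^ (k + 1) * x i⌋ = ⌊(2:ℝ) ^ (k + 1) * y i⌋ := congrFun hxy i
    rw [haar1D_eq, haar1D_eq, this]

lemma haarFn_eq_zero {k : ℤ} {m : Fin n → ℤ} {η : Fin n → Bool} {x : Fin n → ℝ}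
    (hx : x ∉ dyadicCube n k m) : haarFn n k m η x = 0 := by
  rw [dyadicCube_eq_pi, Set.mem_univ_pi, not_forall] at hx
  obtain ⟨i, hi⟩ := hx
  exact Finset.prod_eq_zero (Finset.mem_univ i) (haar1D_eq_zero hi)

lemma integral_haarFn (k : ℤ) (m : Fin n → ℤ) {η : Fin n → Bool} (hη : η ≠ fun _ => false) :
    ∫ x, haarFn n k m η x = 0 := by
  obtain ⟨i, hi⟩ := Function.ne_iff.1 hη
  have hi : η i = true := by simpa using hi
  simp only [haarFn]
  rw [integral_fintype_prod_volume_eq_prod (fun i => haar1D k (m i) (η i))]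
  refine Finset.prod_eq_zero (Finset.mem_univ i) ?_
  rw [hi, integral_haar1D_true]

lemma dyadicE_haarFn (k : ℤ) (m : Fin n → ℤ) {η : Fin n → Bool} (hη : η ≠ fun _ => false) :
    dyadicE n k (haarFn n k m η) = 0 := by
  ext x
  rw [dyadicE_eq]
  by_cases h : cubeIdx k x = m
  · rw [h, setIntegral_eq_integral_of_forall_compl_eq_zero fun y hy => haarFn_eq_zero hy,
      integral_haarFn k m hη, mul_zero, Pi.zero_apply]
  · rw [setIntegral_eq_zero_of_forall_eq_zero, mul_zero, Pi.zero_apply]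
    intro y hy
    refine haarFn_eq_zero fun hy' => h ?_
    rw [mem_dyadicCube_iff] at hy hy'
    rw [← hy, hy']

lemma dyadicD_haarFn {k j : ℤ} (hj : j ≠ k) (m : Fin n → ℤ) {η : Fin n → Bool}
    (hη : η ≠ fun _ => false) : dyadicD n j (haarFn n k m η) = 0 := by
  have hnice := nice_haarFn k m η
  have hz : ∀ i ≤ k, dyadicE n i (haarFn n k m η) = 0 := fun i hi => by
    rw [← hnice.dyadicE_dyadicE hi, dyadicE_haarFn k m hη]
    exact funext fun x => dyadicE_const i 0 x
  have hs : ∀ i, k < i → dyadicE n i (haarFn n k m η) = haarFn n k m η := fun i hi =>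
    funext fun x => dyadicE_of_inv ((cubeInv_haarFn k m η).mono (by omega)) x
  rw [dyadicD_eq]
  rcases lt_or_gt_of_ne hj with h | h
  · rw [hz _ (by omega), hz _ h.le, sub_zero]
  · rw [hs _ (by omega), hs _ h, sub_self]

lemma dyadicD_smul (j : ℤ) (c : ℝ) (f : (Fin n → ℝ) → ℝ) :
    dyadicD n j (c • f) = c • dyadicD n j f := by
  have h : ∀ k, dyadicE n k (c • f) = c • dyadicE n k f := fun k =>
    funext fun x => dyadicE_mul_left (h := fun _ => c) (fun _ _ _ => rfl) f x
  rw [dyadicD_eq, h, h, ← smul_sub, dyadicD_eq]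

lemma nice_and_dyadicD_eq_zero (F : Finset (ℤ × (Fin n → ℤ) × (Fin n → Bool)))
    (c : ℤ × (Fin n → ℤ) × (Fin n → Bool) → ℝ) (hF : ∀ q ∈ F, q.2.2 ≠ (fun _ => false)) :
    Nice (∑ q ∈ F, c q • haarFn n q.1 q.2.1 q.2.2) ∧
      ∀ j ∉ F.image Prod.fst, dyadicD n j (∑ q ∈ F, c q • haarFn n q.1 q.2.1 q.2.2) = 0 := by
  have hN : ∀ q, Nice (c q • haarFn n q.1 q.2.1 q.2.2) := fun q => (nice_haarFn _ _ _).smul _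
  refine ⟨Nice.sum F fun q _ => hN q, fun j hj => ?_⟩
  have hsum : dyadicD n j (∑ q ∈ F, c q • haarFn n q.1 q.2.1 q.2.2) =
      ∑ q ∈ F, dyadicD n j (c q • haarFn n q.1 q.2.1 q.2.2) := by
    clear hj hF
    induction F using Finset.cons_induction with
    | empty =>
      rw [Finset.sum_empty, Finset.sum_empty]
      simpa using dyadicD_smul j 0 (0 : (Fin n → ℝ) → ℝ)
    | cons a F ha ih =>
      rw [Finset.sum_cons, Finset.sum_cons, (hN a).1.dyadicD_add (Nice.sum F fun q _ => hN q).1, ih]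
  rw [hsum]
  refine Finset.sum_eq_zero fun q hq => ?_
  rw [dyadicD_smul, dyadicD_haarFn (fun h => hj (Finset.mem_image.2 ⟨q, hq, h.symm⟩)) _ (hF q hq),
    smul_zero]

lemma psiOp_eq_sum (K : (Fin n → ℝ) → (Fin n → ℝ) → ℝ) (s : ℕ) {f : (Fin n → ℝ) → ℝ}
    {A : Finset ℤ} (hA : ∀ j ∉ A, dyadicD n j f = 0) :
    PsiOp n K s f = ∑ k ∈ A.image (· - (s:ℤ)), pOp K s k f := by
  ext x
  rw [Finset.sum_apply]
  refine tsum_eq_sum fun k hk => ?_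
  have h : dyadicD n (k + (s:ℤ)) f = 0 :=
    hA _ fun h => hk (Finset.mem_image.2 ⟨_, h, by ring⟩)
  have h2 : czTrunc K (4 * (2:ℝ) ^ (-k)) 0 = 0 := by
    ext y; simp [czTrunc]
  rw [h, h2, Pi.zero_apply, zero_sub, neg_eq_zero]
  exact dyadicE_const k 0 x

lemma opB_le {γ : ℝ} (hn : 0 < n) (hγ0 : 0 < γ) (s : ℕ) :
    opB n γ s ≤ 8 * rhoC n γ * (1 - (1 / 2 : ℝ) ^ γ)⁻¹ *
      (1 + (s:ℝ)) * (2:ℝ) ^ (-(s:ℝ) * γ) := by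
  have hq1 := half_rpow_lt_one hγ0
  have e : (2:ℝ) ^ (-(s:ℝ) * γ) = ((1 / 2 : ℝ) ^ γ) ^ s := by
    rw [← Real.rpow_natCast, ← Real.rpow_mul (by norm_num), one_div, Real.inv_rpow (by norm_num),
      ← Real.rpow_neg (by norm_num)]
    congr 1; ring
  have hq0 : 0 < (1 / 2 : ℝ) ^ γ := by positivity
  set q := (1 / 2 : ℝ) ^ γ
  have h1 : 1 ≤ (1 - q)⁻¹ := (one_le_inv₀ (by linarith)).2 (by linarith)
  have hr := rhoC_pos hn hγ0
  have h2 : (s:ℝ) + (1 - q)⁻¹ ≤ (1 - q)⁻¹ * (1 + s) := by nlinarith [(Nat.cast_nonneg s : (0:ℝ) ≤ s)]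
  rw [e, opB, wtSum]
  calc _ = 8 * rhoC n γ * q ^ s * (s + (1 - q)⁻¹) := by ring
    _ ≤ 8 * rhoC n γ * q ^ s * ((1 - q)⁻¹ * (1 + s)) := by gcongr
    _ = _ := by ring

end Haar

/-- Proposition 5.1: the bound on `Ψ_s` in `L^p`. -/
theorem statement11 (n : ℕ) (hn : 0 < n) (p γ : ℝ) (hp : 1 < p)
    (hγ0 : 0 < γ) (hγ1 : γ ≤ 1) :
    ∃ C : ℝ, 0 < C ∧
      ∀ K : (Fin n → ℝ) → (Fin n → ℝ) → ℝ, IsNormalisedKernel n γ K →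
      ∀ s : ℕ,
      ∀ (F : Finset (ℤ × (Fin n → ℤ) × (Fin n → Bool)))
        (c : ℤ × (Fin n → ℤ) × (Fin n → Bool) → ℝ),
        (∀ q ∈ F, q.2.2 ≠ (fun _ => false)) →
      ∀ f : (Fin n → ℝ) → ℝ,
        (f = fun x => ∑ q ∈ F, c q * haarFn n q.1 q.2.1 q.2.2 x) →
        eLpNorm (PsiOp n K s f) (ENNReal.ofReal p) volume ≤
          ENNReal.ofReal (C * (1 + (s:ℝ)) * (2:ℝ) ^ (-(s:ℝ) * γ)) *
            eLpNorm f (ENNReal.ofReal p) volume := by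
  obtain ⟨C, hC, H⟩ := DyadicCZ.exists_lintegral_rpow_le_of_adjoint hn hp
  have hq1 := half_rpow_lt_one hγ0
  have hr := rhoC_pos hn hγ0
  have hq2 : 0 < (1 - (1 / 2 : ℝ) ^ γ)⁻¹ := inv_pos.2 (by linarith)
  refine ⟨C * (8 * rhoC n γ * (1 - (1 / 2 : ℝ) ^ γ)⁻¹), by positivity,
    fun K hK s F c hF f hf => ?_⟩
  have hf' : f = ∑ q ∈ F, c q • haarFn n q.1 q.2.1 q.2.2 := by
    rw [hf]; ext x; simp [Finset.sum_apply]
  obtain ⟨hN, hD⟩ := nice_and_dyadicD_eq_zero F c hF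
  rw [← hf'] at hN hD
  rw [psiOp_eq_sum K s hD]
  set A := (F.image Prod.fst).image (· - (s:ℤ))
  have hB := opB_pos hn hγ0 s
  have key := H (opB n γ s) (fun f => ∑ k ∈ A, pOp K s k f) (fun f => ∑ k ∈ A, qOp (kerT K) s k f)
    hB (hK.dyadicCZ_pOp hn hγ0 hγ1 s A) (hK.transpose.dyadicCZ_qOp hn hγ0 hγ1 s A)
    (fun f g hf hg => hK.integral_sum_pOp_mul hn hγ0 hγ1 s A hf hg) f hN
  refine (eLpNorm_le_of_lintegral_rpow_le (by linarith) (by positivity) key).trans ?_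
  refine mul_le_mul_left (ENNReal.ofReal_le_ofReal ?_) _
  calc _ ≤ _ := mul_le_mul_of_nonneg_left (opB_le hn hγ0 s) hC.le
    _ = _ := by ring

end
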